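/- arXiv:2006.01975 — 8 statements merged into one kernel-verified Lean document; each statement's English description precedes it below -/
import Mathlib

section
/- There is a universal constant C > 0 such that for every β ≥ 1, every 0 < ε < 1, and every β-balanced weighted directed graph w on a finite vertex set V with |V| = n ≥ 2, there exists a weight function w_H : V × V → ℝ with w_H(u,v) ≥ 0 for all u,v, with w_H(u,v) > 0 only if w(u,v) > 0, and with |{(u,v) : w_H(u,v) > 0}| ≤ C·β·n·(log n)/ε², such that (1−ε)·w(S,S̄) ≤ w_H(S,S̄) ≤ (1+ε)·w(S,S̄) for every S ⊆ V. -/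
open Finset

/-- The value of the directed cut `(S, Sᶜ)` in the weighted digraph `w`. -/
noncomputable def cutW {V : Type} [Fintype V] [DecidableEq V]
    (w : V × V → ℝ) (S : Finset V) : ℝ :=
  ∑ u ∈ S, ∑ v ∈ Sᶜ, w (u, v)

section CutCounting

variable {V E : Type} [DecidableEq V]

/-- The vertex set `S` separates two vertices of `H`. -/
def Splits (H S : Finset V) : Prop := (∃ a ∈ H, a ∈ S) ∧ ∃ b ∈ H, b ∉ S

/-- The total weight of the edges of the multigraph `(T, s, t)` with exactly one end in `S`. -/
noncomputable def multiCut (T : Finset E) (s t : E → V) (y : E → ℝ) (S : Finset V) : ℝ :=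
  ∑ e ∈ T with ¬(s e ∈ S ↔ t e ∈ S), y e

/-- Replacing the vertex `j` by the vertex `i`. -/
def mergeInto (i j v : V) : V := if v = j then i else v

lemma mergeInto_mem_erase_iff {i j v : V} {S : Finset V} (hij : i ≠ j)
    (h : i ∈ S ↔ j ∈ S) : mergeInto i j v ∈ S.erase j ↔ v ∈ S := by
  unfold mergeInto
  split_ifs with hv
  · subst hv; simp [hij, h]
  · simp [hv]

open Classical in
lemma sum_contract_le {H : Finset V} {i j : V} (hi : i ∈ H) (hij : i ≠ j)
    (T : Finset E) (s t : E → V) (y : E → ℝ) (g : ℝ → ℝ) (hg : ∀ x, 0 ≤ g x) :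
    ∑ S ∈ H.powerset with Splits H S ∧ (i ∈ S ↔ j ∈ S), g (multiCut T s t y S) ≤
      ∑ S ∈ (H.erase j).powerset with Splits (H.erase j) S,
        g (multiCut T (mergeInto i j ∘ s) (mergeInto i j ∘ t) y S) := by
  have hcut : ∀ S : Finset V, (i ∈ S ↔ j ∈ S) →
      multiCut T (mergeInto i j ∘ s) (mergeInto i j ∘ t) y (S.erase j) =
        multiCut T s t y S := by
    intro S hS
    simp only [multiCut, Function.comp, mergeInto_mem_erase_iff hij hS]
  have hinj : Set.InjOn (fun S : Finset V => S.erase j)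
      (H.powerset.filter fun S => Splits H S ∧ (i ∈ S ↔ j ∈ S) : Finset (Finset V)) := by
    intro S hS S' hS' h
    simp only [coe_filter, Set.mem_ofPred_eq] at hS hS'
    ext v
    rw [← mergeInto_mem_erase_iff hij hS.2.2, ← mergeInto_mem_erase_iff hij hS'.2.2]
    exact iff_of_eq (congrArg (fun R => mergeInto i j v ∈ R) h)
  calc _ = ∑ S ∈ H.powerset with Splits H S ∧ (i ∈ S ↔ j ∈ S),
        g (multiCut T (mergeInto i j ∘ s) (mergeInto i j ∘ t) y (S.erase j)) := by
        refine sum_congr rfl fun S hS => ?_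
        rw [hcut S (mem_filter.1 hS).2.2]
    _ = ∑ S ∈ (H.powerset.filter fun S => Splits H S ∧ (i ∈ S ↔ j ∈ S)).image
          (fun S => S.erase j),
        g (multiCut T (mergeInto i j ∘ s) (mergeInto i j ∘ t) y S) :=
        (sum_image (f := fun S => g (multiCut T (mergeInto i j ∘ s) (mergeInto i j ∘ t) y S))
          hinj).symm
    _ ≤ _ := by
        refine sum_le_sum_of_subset_of_nonneg ?_ fun _ _ _ => hg _
        intro R hR
        obtain ⟨S, hS, rfl⟩ := mem_image.1 hR
        obtain ⟨hSH, ⟨⟨a, haH, ha⟩, b, hbH, hb⟩, hs⟩ := mem_filter.1 hS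
        have key : ∀ v ∈ H, mergeInto i j v ∈ H.erase j := by
          intro v hv
          unfold mergeInto
          split_ifs with h
          · simp [hi, hij]
          · simp [hv, h]
        refine mem_filter.2 ⟨mem_powerset.2 (erase_subset_erase j (mem_powerset.1 hSH)),
          ⟨_, key a haH, (mergeInto_mem_erase_iff hij hs).2 ha⟩,
          ⟨_, key b hbH, fun h => hb ((mergeInto_mem_erase_iff hij hs).1 h)⟩⟩

/-- In a multigraph of minimum cut at least `1`, the sum of the vertex degrees is at least the
number of vertices. -/
lemma card_le_two_mul_sum {H : Finset V} (hH : 2 ≤ #H) {T : Finset E} {s t : E → V} {y : E → ℝ}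
    (hT : ∀ e ∈ T, s e ∈ H ∧ t e ∈ H) (hy : ∀ e ∈ T, 0 ≤ y e)
    (hmin : ∀ S, Splits H S → 1 ≤ multiCut T s t y S) :
    (#H : ℝ) ≤ 2 * ∑ e ∈ T with s e ≠ t e, y e := by
  have h1 : ∀ v ∈ H, 1 ≤ multiCut T s t y {v} := by
    intro v hv
    obtain ⟨b, hb, hbv⟩ := exists_mem_ne (by omega : 1 < #H) v
    exact hmin _ ⟨⟨v, hv, by simp⟩, b, hb, by simpa using hbv⟩
  have h2 : ∀ v, multiCut T s t y {v} ≤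
      ∑ e ∈ T.filter (fun e => s e ≠ t e) with s e = v, y e +
        ∑ e ∈ T.filter (fun e => s e ≠ t e) with t e = v, y e := by
    intro v
    simp only [multiCut, sum_filter, ← sum_add_distrib]
    refine sum_le_sum fun e he => ?_
    have := hy e he
    by_cases h1 : s e = v <;> by_cases h2 : t e = v <;> by_cases h3 : s e = t e <;>
      simp_all
  calc (#H : ℝ) = ∑ v ∈ H, (1 : ℝ) := by simp
    _ ≤ ∑ v ∈ H, (∑ e ∈ T.filter (fun e => s e ≠ t e) with s e = v, y e +
        ∑ e ∈ T.filter (fun e => s e ≠ t e) with t e = v, y e) :=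
        sum_le_sum fun v hv => (h1 v hv).trans (h2 v)
    _ = _ := by
        rw [sum_add_distrib, sum_fiberwise_of_maps_to, sum_fiberwise_of_maps_to, two_mul]
        · exact fun e he => (hT e (mem_filter.1 he).1).2
        · exact fun e he => (hT e (mem_filter.1 he).1).1

/-- The weight `(m + 1) ^ (-16 c)` compared with the weight `m ^ (-16 c)` thinned by the
probability that a cut of value `c` survives a contraction. -/
lemma exp_neg_log_succ_le {m : ℕ} (hm : 1 ≤ m) {c W : ℝ} (hc : 0 ≤ c) (hcW : c ≤ W)
    (hW : (m + 1 : ℝ) ≤ 2 * W) :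
    Real.exp (-(16 * Real.log (m + 1 : ℝ) * c)) ≤
      Real.exp (-(16 * Real.log (m : ℝ) * c)) * (1 - c / W) + (1 / 4) ^ (m + 1) := by
  have hm' : (1 : ℝ) ≤ m := by exact_mod_cast hm
  have hW0 : 0 < W := by linarith
  have hz1 : c / W ≤ 1 := (div_le_one hW0).2 hcW
  by_cases h : c ≤ W / 2
  · set z := c / W with hz
    have hzc : c = z * W := by rw [hz]; field_simp
    have hz0 : 0 ≤ z := by positivity
    have hz2 : z ≤ 1 / 2 := by rw [hz, div_le_iff₀ hW0]; linarith
    have hlog : 1 / (m + 1 : ℝ) ≤ Real.log (m + 1 : ℝ) - Real.log m := by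
      rw [← Real.log_div (by positivity) (by positivity)]
      refine le_trans (le_of_eq ?_)
        (Real.one_sub_inv_le_log_of_pos (x := (m + 1 : ℝ) / m) (by positivity))
      field_simp
      ring
    have h8 : 8 * z ≤ 16 * c * (Real.log (m + 1 : ℝ) - Real.log m) := by
      refine le_trans ?_ (mul_le_mul_of_nonneg_left hlog (by positivity))
      rw [mul_one_div, le_div_iff₀ (by positivity), hzc]
      nlinarith
    have hexp : Real.exp (-(8 * z)) ≤ 1 - z := by
      rw [Real.exp_neg, inv_le_comm₀ (Real.exp_pos _) (by linarith)]
      refine le_trans ?_ (Real.add_one_le_exp _)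
      rw [inv_le_iff_one_le_mul₀ (by linarith)]
      nlinarith
    have : Real.exp (-(16 * Real.log (m + 1 : ℝ) * c)) ≤
        Real.exp (-(16 * Real.log (m : ℝ) * c)) * Real.exp (-(8 * z)) := by
      rw [← Real.exp_add]
      exact Real.exp_le_exp.2 (by linarith)
    have h3 := mul_le_mul_of_nonneg_left hexp (Real.exp_pos (-(16 * Real.log (m : ℝ) * c))).le
    have : (0 : ℝ) ≤ (1 / 4) ^ (m + 1) := by positivity
    linarith
  · have h1 : Real.exp (-(16 * Real.log (m + 1 : ℝ) * c)) ≤ (1 / 4) ^ (m + 1) := by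
      have : ((1 : ℝ) / 4) ^ (m + 1) = Real.exp (-((m + 1 : ℝ) * (2 * Real.log 2))) := by
        rw [Real.exp_neg, mul_comm, show (2 : ℝ) * Real.log 2 = Real.log 4 by
          rw [show (4 : ℝ) = 2 ^ 2 by norm_num, Real.log_pow]; norm_num, Real.exp_mul,
          Real.exp_log (by norm_num), one_div, inv_pow]
        exact_mod_cast rfl
      rw [this]
      have hl : Real.log 2 ≤ Real.log (m + 1 : ℝ) := Real.log_le_log (by norm_num) (by linarith)
      have hl2 : 0 < Real.log 2 := Real.log_pos (by norm_num)
      have : (m + 1 : ℝ) * (2 * Real.log 2) ≤ 16 * Real.log (m + 1 : ℝ) * c := by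
        have : (m + 1 : ℝ) * Real.log 2 ≤ 4 * c * Real.log (m + 1 : ℝ) :=
          mul_le_mul (by linarith) hl hl2.le (by linarith)
        have : 0 ≤ c * Real.log (m + 1 : ℝ) := by
          apply mul_nonneg hc; linarith
        linarith
      exact Real.exp_le_exp.2 (by linarith)
    have h2 : 0 ≤ Real.exp (-(16 * Real.log (m : ℝ) * c)) * (1 - c / W) :=
      mul_nonneg (Real.exp_pos _).le (by linarith)
    linarith

open Classical in
/-- Weighted form of Karger's cut counting bound. -/
theorem sum_exp_neg_multiCut_le (T : Finset E) {y : E → ℝ} (hy : ∀ e ∈ T, 0 ≤ y e) :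
    ∀ (n : ℕ) (H : Finset V) (s t : E → V), #H = n → (∀ e ∈ T, s e ∈ H ∧ t e ∈ H) →
      (∀ S, Splits H S → 1 ≤ multiCut T s t y S) →
      ∑ S ∈ H.powerset with Splits H S,
        Real.exp (-(16 * Real.log n * multiCut T s t y S)) ≤ 1 - (1 / 2) ^ n := by
  intro n
  induction n with
  | zero =>
    intro H s t hH hT hmin
    rw [card_eq_zero] at hH
    subst hH
    simp [Splits]
  | succ m ih =>
    intro H s t hH hT hmin
    rcases Nat.eq_zero_or_pos m with rfl | hm
    · obtain ⟨a, rfl⟩ := card_eq_one.1 hH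
      have : ∀ S : Finset V, ¬ Splits {a} S := by
        intro S; simp [Splits]
      simp [this]
      norm_num
    set cut := multiCut T s t y with hcut
    set W := ∑ e ∈ T with s e ≠ t e, y e with hW
    have hW2 : (m + 1 : ℝ) ≤ 2 * W := by
      have := card_le_two_mul_sum (by omega) hT hy hmin
      rw [hH] at this
      exact_mod_cast this
    have hm' : (1 : ℝ) ≤ m := by exact_mod_cast hm
    have hW0 : 0 < W := by linarith
    have hcut0 : ∀ S, 0 ≤ cut S := fun S =>
      sum_nonneg fun e he => hy e (mem_filter.1 he).1
    have hcutW : ∀ S, W - cut S = ∑ e ∈ T with s e ≠ t e,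
        if (s e ∈ S ↔ t e ∈ S) then y e else 0 := by
      intro S
      simp only [hW, hcut, multiCut, sum_filter, ← sum_sub_distrib]
      refine sum_congr rfl fun e _ => ?_
      by_cases h : s e = t e
      · simp [h]
      · by_cases h' : (s e ∈ S ↔ t e ∈ S) <;> simp [h, h']
    have hcutle : ∀ S, cut S ≤ W := by
      intro S
      rw [← sub_nonneg, hcutW]
      refine sum_nonneg fun e he => ?_
      have := hy e (mem_filter.1 he).1
      split_ifs <;> simp [this]
    set g : ℝ → ℝ := fun c => Real.exp (-(16 * Real.log (m : ℝ) * c)) with hg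
    have havg : ∑ S ∈ H.powerset with Splits H S, g (cut S) * (W - cut S) ≤
        W * (1 - (1 / 2) ^ m) := by
      calc _ = ∑ e ∈ T with s e ≠ t e, y e *
            ∑ S ∈ H.powerset with Splits H S ∧ (s e ∈ S ↔ t e ∈ S), g (cut S) := by
            simp only [hcutW, mul_sum]
            rw [sum_comm]
            refine sum_congr rfl fun e _ => ?_
            rw [← filter_filter, sum_filter _ (fun S => g (cut S) * _)]
            simp only [sum_filter]
            refine sum_congr rfl fun S _ => ?_
            split_ifs <;> simp [mul_comm]
        _ ≤ ∑ e ∈ T with s e ≠ t e, y e * (1 - (1 / 2) ^ m) := by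
            refine sum_le_sum fun e he => ?_
            obtain ⟨heT, hne⟩ := mem_filter.1 he
            refine mul_le_mul_of_nonneg_left ?_ (hy e heT)
            refine (sum_contract_le (hT e heT).1 hne T s t y g
              fun x => (Real.exp_pos _).le).trans ?_
            have key : ∀ v ∈ H, mergeInto (s e) (t e) v ∈ H.erase (t e) := by
              intro v hv
              unfold mergeInto
              split_ifs with h
              · simp [(hT e heT).1, hne]
              · simp [hv, h]
            refine ih (H.erase (t e)) _ _ (by rw [card_erase_of_mem (hT e heT).2, hH]; rfl)
              (fun e' he' => ⟨key _ (hT e' he').1, key _ (hT e' he').2⟩) ?_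
            rintro S ⟨⟨a, haH, ha⟩, b, hbH, hb⟩
            set S' : Finset V := if s e ∈ S then insert (t e) (S.erase (t e))
              else S.erase (t e) with hS'
            have hmem : ∀ v, mergeInto (s e) (t e) v ∈ S ↔ v ∈ S' := by
              intro v
              unfold mergeInto
              rw [hS']
              by_cases h1 : v = t e <;> by_cases h2 : s e ∈ S <;> simp [h1, h2]
            have hid : ∀ v ∈ H.erase (t e), mergeInto (s e) (t e) v = v := by
              intro v hv
              simp [mergeInto, ne_of_mem_erase hv]
            refine (hmin S' ⟨⟨a, mem_of_mem_erase haH, ?_⟩, b, mem_of_mem_erase hbH, ?_⟩).trans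
              (le_of_eq ?_)
            · rwa [← hmem, hid a haH]
            · rwa [← hmem, hid b hbH]
            · simp only [hcut, multiCut, Function.comp, hmem]
        _ = _ := by rw [← sum_mul]
    have hpt : ∀ S, Real.exp (-(16 * Real.log ((m + 1 : ℕ) : ℝ) * cut S)) ≤
        g (cut S) * (W - cut S) / W + (1 / 4) ^ (m + 1) := by
      intro S
      have := exp_neg_log_succ_le hm (hcut0 S) (hcutle S) hW2
      rw [mul_div_assoc, sub_div, div_self hW0.ne']
      exact_mod_cast this
    calc _ ≤ ∑ S ∈ H.powerset with Splits H S,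
          (g (cut S) * (W - cut S) / W + (1 / 4) ^ (m + 1)) := sum_le_sum fun S _ => hpt S
      _ ≤ (1 - (1 / 2) ^ m) + 2 ^ (m + 1) * (1 / 4) ^ (m + 1) := by
          rw [sum_add_distrib, ← sum_div]
          refine add_le_add ((div_le_iff₀ hW0).2 (by linarith)) ?_
          rw [sum_const, nsmul_eq_mul]
          refine mul_le_mul_of_nonneg_right ?_ (by positivity)
          have := card_filter_le H.powerset (fun S => Splits H S)
          rw [card_powerset, hH] at this
          exact_mod_cast this
      _ = 1 - (1 / 2) ^ (m + 1) := by
          rw [← mul_pow, pow_succ]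
          norm_num
          ring

end CutCounting

section StrengthDecomposition

variable {V : Type} [DecidableEq V]

/-- The total weight of the edges inside `H` with exactly one end in `S`. -/
noncomputable def undCut (y : V × V → ℝ) (H S : Finset V) : ℝ :=
  multiCut (H ×ˢ H) Prod.fst Prod.snd y S

lemma undCut_eq (y : V × V → ℝ) (H S : Finset V) :
    undCut y H S = ∑ p ∈ H ×ˢ H with ¬(p.1 ∈ S ↔ p.2 ∈ S), y p := rfl

lemma undCut_nonneg {y : V × V → ℝ} (hy : ∀ p, 0 ≤ y p) (H S : Finset V) : 0 ≤ undCut y H S :=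
  sum_nonneg fun _ _ => hy _

lemma undCut_congr {y z : V × V → ℝ} {H : Finset V} (h : ∀ p ∈ H ×ˢ H, y p = z p)
    (S : Finset V) : undCut y H S = undCut z H S :=
  sum_congr rfl fun p hp => h p (mem_filter.1 hp).1

lemma undCut_eq_zero_of_not_splits {H S : Finset V} (h : ¬ Splits H S) (y : V × V → ℝ) :
    undCut y H S = 0 := by
  rw [undCut_eq, filter_false_of_mem, sum_empty]
  rintro ⟨a, b⟩ hp hab
  obtain ⟨ha, hb⟩ := mem_product.1 hp
  simp only at ha hb hab
  apply h
  by_cases haS : a ∈ S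
  · exact ⟨⟨a, ha, haS⟩, b, hb, by tauto⟩
  · exact ⟨⟨b, hb, by tauto⟩, a, ha, haS⟩

/-- Edges inside `X` are inside `X ∩ R`, inside `X \ R`, or separated by `R`. -/
lemma sum_filter_product_split (f : V × V → ℝ) (X R : Finset V) (P : V × V → Prop)
    [DecidablePred P] :
    ∑ p ∈ X ×ˢ X with P p, f p =
      ∑ p ∈ (X ∩ R) ×ˢ (X ∩ R) with P p, f p + ∑ p ∈ (X \ R) ×ˢ (X \ R) with P p, f p +
        ∑ p ∈ X ×ˢ X with P p ∧ ¬(p.1 ∈ R ↔ p.2 ∈ R), f p := by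
  have h1 : ((X ∩ R) ×ˢ (X ∩ R)).filter P =
      (X ×ˢ X).filter fun p => P p ∧ p.1 ∈ R ∧ p.2 ∈ R := by
    ext p; simp only [mem_filter, mem_product, mem_inter]; tauto
  have h2 : ((X \ R) ×ˢ (X \ R)).filter P =
      (X ×ˢ X).filter fun p => P p ∧ p.1 ∉ R ∧ p.2 ∉ R := by
    ext p; simp only [mem_filter, mem_product, mem_sdiff]; tauto
  rw [h1, h2]
  simp only [sum_filter, ← sum_add_distrib]
  refine sum_congr rfl fun p _ => ?_
  by_cases hP : P p <;> by_cases ha : p.1 ∈ R <;> by_cases hb : p.2 ∈ R <;> simp [hP, ha, hb]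

/-- The sum of `lam` over the sets containing both ends of `p`. -/
noncomputable def levelSum [Fintype V] (lam : Finset V → ℝ) (p : V × V) : ℝ :=
  ∑ H, if p ∈ H ×ˢ H then lam H else 0

lemma levelSum_add [Fintype V] (lam mu : Finset V → ℝ) (p : V × V) :
    levelSum (lam + mu) p = levelSum lam p + levelSum mu p := by
  simp only [levelSum, ← sum_add_distrib, Pi.add_apply]
  refine sum_congr rfl fun H _ => ?_
  split_ifs <;> simp

lemma levelSum_single [Fintype V] (X : Finset V) (c : ℝ) {p : V × V} (hp : p ∈ X ×ˢ X) :
    levelSum (Pi.single X c) p = c := by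
  rw [levelSum, sum_eq_single X]
  · simp [hp]
  · intro H _ hH; simp [hH]
  · simp

lemma levelSum_eq_zero [Fintype V] {lam : Finset V → ℝ} {A : Finset V}
    (h : ∀ H, lam H ≠ 0 → H ⊆ A) {p : V × V} (hp : p ∉ A ×ˢ A) : levelSum lam p = 0 := by
  refine sum_eq_zero fun H _ => ?_
  by_cases hH : lam H = 0
  · simp [hH]
  · rw [if_neg fun hpH => hp (product_subset_product (h H hH) (h H hH) hpH)]

lemma levelSum_nonneg [Fintype V] {lam : Finset V → ℝ} (h : ∀ H, 0 ≤ lam H) (p : V × V) :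
    0 ≤ levelSum lam p :=
  sum_nonneg fun H _ => by split_ifs <;> simp [h]

open Classical in
lemma card_support_add_le [Fintype V] (lam mu : Finset V → ℝ) :
    #{H | (lam + mu) H ≠ 0} ≤ #{H | lam H ≠ 0} + #{H | mu H ≠ 0} := by
  refine (card_le_card fun H hH => ?_).trans (card_union_le _ _)
  simp only [mem_filter, mem_univ, true_and, mem_union, Pi.add_apply] at hH ⊢
  by_contra! h
  exact hH (by rw [h.1, h.2, add_zero])

open Classical in
/-- Decomposition of a weighted graph by edge strengths: `w = y · (c + levelSum lam)`, where
`y` has small total weight and minimum cut at least `1` on every set in the support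
of `lam`. -/
theorem exists_strength_decomposition [Fintype V] {w : V × V → ℝ} (hw : ∀ p, 0 ≤ w p)
    (hw0 : ∀ u, w (u, u) = 0) : ∀ (m : ℕ) (X : Finset V), #X = m → X.Nonempty →
    ∀ c : ℝ, 0 < c → ∃ (y : V × V → ℝ) (lam : Finset V → ℝ),
      (∀ p, 0 ≤ y p) ∧ (∀ H, 0 ≤ lam H) ∧
      (∀ p ∈ X ×ˢ X, w p = y p * (c + levelSum lam p)) ∧
      ∑ p ∈ X ×ˢ X, y p ≤ #X - 1 ∧
      #{H | lam H ≠ 0} + 1 ≤ #X ∧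
      (∀ H, lam H ≠ 0 → H ⊆ X ∧ ∀ S, Splits H S → 1 ≤ undCut y H S) ∧
      ∀ S, min 1 (undCut w X S / c) ≤ undCut y X S := by
  intro m
  induction m using Nat.strong_induction_on with
  | _ m ih =>
  intro X hXm hX c hc
  rcases Nat.lt_or_ge 1 #X with h1 | h1
  swap
  · obtain ⟨a, rfl⟩ := card_eq_one.1 (le_antisymm h1 hX.card_pos)
    have hns : ∀ S : Finset V, ¬ Splits {a} S := by intro S; simp [Splits]
    refine ⟨0, 0, by simp, by simp, ?_, by simp, by simp, by simp, ?_⟩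
    · rintro ⟨u, v⟩ hp
      obtain ⟨rfl, rfl⟩ : u = a ∧ v = a := by simpa using hp
      simp [hw0]
    · intro S
      rw [undCut_eq_zero_of_not_splits (hns S), undCut_eq_zero_of_not_splits (hns S)]
      simp
  obtain ⟨a, ha, b, hb, hab⟩ := one_lt_card.1 h1
  have hne : (univ.filter fun S : Finset V => Splits X S).Nonempty :=
    ⟨{a}, by
      simp only [mem_filter, mem_univ, true_and]
      exact ⟨⟨a, ha, by simp⟩, b, hb, by simpa using hab.symm⟩⟩
  obtain ⟨R, hR, hRmin⟩ := exists_min_image _ (undCut w X) hne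
  simp only [mem_filter, mem_univ, true_and] at hR hRmin
  set k := undCut w X R with hk
  set c' := max c k with hc'
  have hc'0 : 0 < c' := lt_of_lt_of_le hc (le_max_left _ _)
  obtain ⟨⟨a, ha, haR⟩, b, hb, hbR⟩ := hR
  have hcard : #(X ∩ R) + #(X \ R) = #X := card_inter_add_card_sdiff X R
  have hAne : (X ∩ R).Nonempty := ⟨a, by simp [ha, haR]⟩
  have hBne : (X \ R).Nonempty := ⟨b, by simp [hb, hbR]⟩
  have hA0 := hAne.card_pos
  have hB0 := hBne.card_pos
  obtain ⟨yA, lA, hyA, hlA, hwA, hsA, hcA, hmA, hiA⟩ :=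
    ih #(X ∩ R) (by omega) (X ∩ R) rfl hAne c' hc'0
  obtain ⟨yB, lB, hyB, hlB, hwB, hsB, hcB, hmB, hiB⟩ :=
    ih #(X \ R) (by omega) (X \ R) rfl hBne c' hc'0
  set A := X ∩ R with hA
  set B := X \ R with hB
  have hAB : ∀ p, p ∈ A ×ˢ A → p ∉ B ×ˢ B := by
    rintro ⟨u, v⟩ h h'
    simp only [hA, hB, mem_product, mem_inter, mem_sdiff] at h h'
    tauto
  set y : V × V → ℝ := fun p => if p ∈ A ×ˢ A then yA p else if p ∈ B ×ˢ B then yB p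
    else w p / c' with hy
  have hyeA : ∀ p ∈ A ×ˢ A, y p = yA p := fun p hp => if_pos hp
  have hyeB : ∀ p ∈ B ×ˢ B, y p = yB p := fun p hp => by
    rw [hy]; dsimp only; rw [if_neg fun h => hAB p h hp, if_pos hp]
  have hyeC : ∀ p, ¬(p.1 ∈ R ↔ p.2 ∈ R) → p ∉ A ×ˢ A ∧ p ∉ B ×ˢ B := by
    rintro ⟨u, v⟩ h
    simp only [hA, hB, mem_product, mem_inter, mem_sdiff] at h ⊢
    tauto
  have hyC : ∀ p, ¬(p.1 ∈ R ↔ p.2 ∈ R) → y p = w p / c' := fun p hp => by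
    rw [hy]; dsimp only; rw [if_neg (hyeC p hp).1, if_neg (hyeC p hp).2]
  have hy0 : ∀ p, 0 ≤ y p := by
    intro p
    rw [hy]; dsimp only
    split_ifs
    · exact hyA p
    · exact hyB p
    · exact div_nonneg (hw p) hc'0.le
  have hsplit : ∀ (P : V × V → Prop) [DecidablePred P], ∑ p ∈ X ×ˢ X with P p, y p =
      ∑ p ∈ A ×ˢ A with P p, yA p + ∑ p ∈ B ×ˢ B with P p, yB p +
        (∑ p ∈ X ×ˢ X with P p ∧ ¬(p.1 ∈ R ↔ p.2 ∈ R), w p) / c' := by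
    intro P _
    rw [sum_filter_product_split y X R P, sum_div]
    refine congrArg₂ _ (congrArg₂ _ ?_ ?_) ?_
    · exact sum_congr rfl fun p hp => hyeA p (mem_filter.1 hp).1
    · exact sum_congr rfl fun p hp => hyeB p (mem_filter.1 hp).1
    · exact sum_congr rfl fun p hp => hyC p (mem_filter.1 hp).2.2
  have hinv : ∀ S, min 1 (undCut w X S / c') ≤ undCut y X S := by
    intro S
    have e1 : undCut y X S = undCut yA A S + undCut yB B S + _ :=
      hsplit fun p => ¬(p.1 ∈ S ↔ p.2 ∈ S)
    have e2 : undCut w X S = undCut w A S + undCut w B S + _ :=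
      sum_filter_product_split w X R fun p => ¬(p.1 ∈ S ↔ p.2 ∈ S)
    have h3 : 0 ≤ (∑ p ∈ X ×ˢ X with ¬(p.1 ∈ S ↔ p.2 ∈ S) ∧ ¬(p.1 ∈ R ↔ p.2 ∈ R), w p) / c' :=
      div_nonneg (sum_nonneg fun p _ => hw p) hc'0.le
    have hA' := hiA S
    have hB' := hiB S
    have hA'' := div_nonneg (undCut_nonneg hw A S) hc'0.le
    have hB'' := div_nonneg (undCut_nonneg hw B S) hc'0.le
    have hA3 := undCut_nonneg hyA A S
    have hB3 := undCut_nonneg hyB B S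
    rw [e1, e2, add_div, add_div]
    rcases min_le_iff.1 hA' with h | h
    · exact (min_le_left _ _).trans (by linarith)
    rcases min_le_iff.1 hB' with h' | h'
    · exact (min_le_left _ _).trans (by linarith)
    exact (min_le_right _ _).trans (by linarith)
  refine ⟨y, lA + lB + Pi.single X (c' - c), hy0, ?_, ?_, ?_, ?_, ?_, ?_⟩
  · intro H
    have : 0 ≤ (Pi.single X (c' - c) : Finset V → ℝ) H := by
      by_cases h : H = X
      · subst h; simp [hc']
      · simp [h]
    simpa using add_nonneg (add_nonneg (hlA H) (hlB H)) this
  · intro p hp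
    rw [levelSum_add, levelSum_add, levelSum_single X _ hp]
    by_cases hpA : p ∈ A ×ˢ A
    · rw [levelSum_eq_zero (fun H hH => (hmB H hH).1) (hAB p hpA), hyeA p hpA, hwA p hpA]
      ring
    by_cases hpB : p ∈ B ×ˢ B
    · rw [levelSum_eq_zero (fun H hH => (hmA H hH).1) hpA, hyeB p hpB, hwB p hpB]
      ring
    rw [levelSum_eq_zero (fun H hH => (hmA H hH).1) hpA,
      levelSum_eq_zero (fun H hH => (hmB H hH).1) hpB, hy]
    dsimp only
    rw [if_neg hpA, if_neg hpB]
    field_simp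
    ring
  · have := hsplit fun _ => True
    simp only [filter_true, true_and] at this
    rw [this]
    have h2 : (∑ p ∈ X ×ˢ X with ¬(p.1 ∈ R ↔ p.2 ∈ R), w p) / c' ≤ 1 :=
      (div_le_one hc'0).2 (le_max_right _ _)
    have h3 : (#A : ℝ) + #B = #X := by exact_mod_cast hcard
    linarith
  · have h1 := card_support_add_le (lA + lB) (Pi.single X (c' - c))
    have h2 := card_support_add_le lA lB
    have h3 : #{H | (Pi.single X (c' - c) : Finset V → ℝ) H ≠ 0} ≤ 1 := by
      refine card_le_one.2 fun H hH H' hH' => ?_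
      have : ∀ H, H ∈ univ.filter (fun H => (Pi.single X (c' - c) : Finset V → ℝ) H ≠ 0) →
          H = X := by
        intro H hH
        by_contra h
        simp [h] at hH
      rw [this H hH, this H' hH']
    omega
  · intro H hH
    by_cases h2 : lA H ≠ 0
    · obtain ⟨hs, hm⟩ := hmA H h2
      refine ⟨hs.trans inter_subset_left, fun S hS => (hm S hS).trans (le_of_eq ?_)⟩
      exact undCut_congr (fun p hp => (hyeA p (product_subset_product hs hs hp)).symm) S
    by_cases h3 : lB H ≠ 0
    · obtain ⟨hs, hm⟩ := hmB H h3
      refine ⟨hs.trans sdiff_subset, fun S hS => (hm S hS).trans (le_of_eq ?_)⟩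
      exact undCut_congr (fun p hp => (hyeB p (product_subset_product hs hs hp)).symm) S
    push Not at h2 h3
    have hHX : H = X := by
      by_contra h
      simp [h2, h3, h] at hH
    subst hHX
    have hck : c' = k := by
      refine max_eq_right (le_of_lt (lt_of_not_ge fun h => hH ?_))
      simp [h2, h3, hc', max_eq_left h]
    refine ⟨subset_rfl, fun S hS => le_trans ?_ (hinv S)⟩
    refine le_min le_rfl ((one_le_div hc'0).2 ?_)
    rw [hck]
    exact hRmin S hS
  · intro S
    by_cases hS : Splits X S
    · rcases max_choice c k with h | h
      · rw [← hc'] at h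
        rw [← h]
        exact hinv S
      · refine (min_le_left _ _).trans (le_trans ?_ (hinv S))
        refine le_min le_rfl ((one_le_div hc'0).2 ?_)
        rw [hc', h]
        exact hRmin S hS
    · rw [undCut_eq_zero_of_not_splits hS, undCut_eq_zero_of_not_splits hS]
      simp

end StrengthDecomposition

section Sampling

variable {E : Type}

/-- The sampled weight of `e`: a chosen element is rescaled to have expectation `y e`, where the
sampling probability is `min 1 (ρ * y e)`. -/
noncomputable def sampled (ρ : ℝ) (y : E → ℝ) (x : E → Bool) (e : E) : ℝ :=
  if x e then y e / min 1 (ρ * y e) else 0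

lemma sampled_nonneg {ρ : ℝ} (hρ : 0 ≤ ρ) {y : E → ℝ} (hy : ∀ e, 0 ≤ y e) (x : E → Bool)
    (e : E) : 0 ≤ sampled ρ y x e := by
  unfold sampled
  split_ifs
  · exact div_nonneg (hy e) (le_min zero_le_one (mul_nonneg hρ (hy e)))
  · exact le_rfl

variable [Fintype E] [DecidableEq E]

/-- The probability of the outcome `x` when each `e` is independently chosen with
probability `q e`. -/
noncomputable def bernoulliWeight (q : E → ℝ) (x : E → Bool) : ℝ :=
  ∏ e, if x e then q e else 1 - q e

/-- The expectation of `f` when each `e` is independently chosen with probability `q e`. -/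
noncomputable def bernoulliExp (q : E → ℝ) (f : (E → Bool) → ℝ) : ℝ :=
  ∑ x, bernoulliWeight q x * f x

lemma bernoulliExp_prod (q : E → ℝ) (a : E → Bool → ℝ) :
    bernoulliExp q (fun x => ∏ e, a e (x e)) =
      ∏ e, (q e * a e true + (1 - q e) * a e false) := by
  have := Fintype.prod_sum (fun (e : E) (b : Bool) => (if b then q e else 1 - q e) * a e b)
  simp only [Fintype.sum_bool, if_true, Bool.false_eq_true, if_false, prod_mul_distrib] at this
  rw [this]
  rfl

lemma sum_bernoulliWeight (q : E → ℝ) : ∑ x, bernoulliWeight q x = 1 := by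
  have := bernoulliExp_prod q (fun _ _ => 1)
  simpa [bernoulliExp] using this

lemma bernoulliExp_add (q : E → ℝ) (f g : (E → Bool) → ℝ) :
    bernoulliExp q (fun x => f x + g x) = bernoulliExp q f + bernoulliExp q g := by
  simp [bernoulliExp, mul_add, sum_add_distrib]

lemma bernoulliExp_const_mul (q : E → ℝ) (c : ℝ) (f : (E → Bool) → ℝ) :
    bernoulliExp q (fun x => c * f x) = c * bernoulliExp q f := by
  simp only [bernoulliExp, mul_sum]
  exact sum_congr rfl fun x _ => by ring

lemma bernoulliExp_sum {K : Type} (q : E → ℝ) (s : Finset K) (f : K → (E → Bool) → ℝ) :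
    bernoulliExp q (fun x => ∑ k ∈ s, f k x) = ∑ k ∈ s, bernoulliExp q (f k) := by
  simp only [bernoulliExp, mul_sum]
  exact sum_comm

lemma exists_le_bernoulliExp {q : E → ℝ} (hq0 : ∀ e, 0 ≤ q e) (hq1 : ∀ e, q e ≤ 1)
    (f : (E → Bool) → ℝ) : ∃ x, f x ≤ bernoulliExp q f := by
  by_contra! h
  have hW : ∀ x, 0 ≤ bernoulliWeight q x := fun x =>
    prod_nonneg fun e _ => by split_ifs <;> linarith [hq0 e, hq1 e]
  have h0 : ∑ x, bernoulliWeight q x * (f x - bernoulliExp q f) = 0 := by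
    simp only [mul_sub, sum_sub_distrib, ← sum_mul, sum_bernoulliWeight]
    simp [bernoulliExp]
  rw [sum_eq_zero_iff_of_nonneg fun x _ => mul_nonneg (hW x) (sub_nonneg.2 (h x).le)] at h0
  have : ∑ x, bernoulliWeight q x = 0 := sum_eq_zero fun x hx =>
    (mul_eq_zero.1 (h0 x hx)).resolve_right (sub_pos.2 (h x)).ne'
  rw [sum_bernoulliWeight] at this
  exact one_ne_zero this

lemma bernoulli_moment_le {q θ : ℝ} (hq : 0 ≤ q) (hθ : |θ| ≤ 1) :
    q * Real.exp (θ * (1 - q)) + (1 - q) * Real.exp (θ * (0 - q)) ≤ Real.exp (θ ^ 2 * q) := by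
  have h1 : Real.exp θ - 1 - θ ≤ θ ^ 2 :=
    (le_abs_self _).trans (Real.abs_exp_sub_one_sub_id_le hθ)
  calc _ = Real.exp (-(θ * q)) * (q * (Real.exp θ - 1) + 1) := by
        rw [show θ * (1 - q) = -(θ * q) + θ by ring, show θ * (0 - q) = -(θ * q) by ring,
          Real.exp_add]
        ring
    _ ≤ Real.exp (-(θ * q)) * Real.exp (q * (Real.exp θ - 1)) :=
        mul_le_mul_of_nonneg_left (Real.add_one_le_exp _) (Real.exp_pos _).le
    _ ≤ _ := by
        rw [← Real.exp_add]
        refine Real.exp_le_exp.2 ?_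
        nlinarith

lemma sampled_moment_le {ρ θ y : ℝ} (hρ : 0 < ρ) (hθ : |θ| ≤ 1) (hy : 0 ≤ y) :
    min 1 (ρ * y) * Real.exp (θ * ρ * (y / min 1 (ρ * y) - y)) +
      (1 - min 1 (ρ * y)) * Real.exp (θ * ρ * (0 - y)) ≤ Real.exp (θ ^ 2 * ρ * y) := by
  rcases le_total 1 (ρ * y) with h | h
  · rw [min_eq_left h]
    simp only [div_one, sub_self, mul_zero, Real.exp_zero, one_mul, zero_mul, add_zero]
    exact Real.one_le_exp (by positivity)
  · rw [min_eq_right h]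
    rcases hy.eq_or_lt with rfl | hy
    · simp
    · rw [mul_assoc (θ ^ 2)]
      convert bernoulli_moment_le (q := ρ * y) (by positivity) hθ using 4
      · field_simp
      · ring

/-- Exponential moment bound for the deviation of a sampled sum. -/
lemma bernoulliExp_exp_deviation_le {ρ θ : ℝ} (hρ : 0 < ρ) (hθ : |θ| ≤ 1) {y : E → ℝ}
    (hy : ∀ e, 0 ≤ y e) (D : Finset E) :
    bernoulliExp (fun e => min 1 (ρ * y e))
      (fun x => Real.exp (θ * ρ * (∑ e ∈ D, sampled ρ y x e - ∑ e ∈ D, y e))) ≤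
      Real.exp (θ ^ 2 * ρ * ∑ e ∈ D, y e) := by
  have h1 : ∀ x : E → Bool,
      Real.exp (θ * ρ * (∑ e ∈ D, sampled ρ y x e - ∑ e ∈ D, y e)) =
      ∏ e, if e ∈ D then
        Real.exp (θ * ρ * ((if x e then y e / min 1 (ρ * y e) else 0) - y e)) else 1 := by
    intro x
    rw [← sum_sub_distrib, mul_sum, Real.exp_sum, prod_ite_mem, univ_inter]
    rfl
  simp only [h1]
  rw [bernoulliExp_prod _ (fun e b => if e ∈ D then
    Real.exp (θ * ρ * ((if b then y e / min 1 (ρ * y e) else 0) - y e)) else 1),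
    mul_sum, Real.exp_sum, ← univ_inter D, ← prod_ite_mem]
  refine prod_le_prod (fun e _ => ?_) fun e _ => ?_
  · have h0 : 0 ≤ min 1 (ρ * y e) := le_min zero_le_one (mul_nonneg hρ.le (hy e))
    have h1 : min 1 (ρ * y e) ≤ 1 := min_le_left _ _
    refine add_nonneg (mul_nonneg h0 ?_) (mul_nonneg (by linarith) ?_) <;>
      split_ifs <;> positivity
  · by_cases he : e ∈ D
    · simpa [he] using sampled_moment_le hρ hθ (hy e)
    · simp [he]

/-- Exponential moment bound for the number of chosen elements. -/
lemma bernoulliExp_two_pow_card_le {q : E → ℝ} (hq : ∀ e, 0 ≤ q e) :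
    bernoulliExp q (fun x => 2 ^ #{e | x e = true}) ≤ Real.exp (∑ e, q e) := by
  have h1 : ∀ x : E → Bool, (2 : ℝ) ^ #{e | x e = true} = ∏ e, if x e then 2 else 1 := by
    intro x
    rw [← prod_filter, prod_const]
  simp only [h1]
  rw [bernoulliExp_prod q (fun _ b => if b then 2 else 1), Real.exp_sum]
  refine prod_le_prod (fun e _ => ?_) fun e _ => ?_
  · simp; linarith [hq e]
  · simp
    linarith [Real.add_one_le_exp (q e)]

end Sampling

section Sparsification

variable {V : Type} [DecidableEq V]

/-- The total weight of the edges inside `H` that leave `S`. -/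
noncomputable def dirCut (y : V × V → ℝ) (H S : Finset V) : ℝ :=
  ∑ p ∈ H ×ˢ H with p.1 ∈ S ∧ p.2 ∉ S, y p

lemma dirCut_eq_zero_of_not_splits {H S : Finset V} (h : ¬ Splits H S) (y : V × V → ℝ) :
    dirCut y H S = 0 := by
  rw [dirCut, filter_false_of_mem, sum_empty]
  rintro ⟨a, b⟩ hp hab
  obtain ⟨ha, hb⟩ := mem_product.1 hp
  exact h ⟨⟨a, ha, hab.1⟩, b, hb, hab.2⟩

lemma dirCut_inter (y : V × V → ℝ) (H S : Finset V) : dirCut y H (S ∩ H) = dirCut y H S := by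
  refine sum_congr (filter_congr fun p hp => ?_) fun _ _ => rfl
  obtain ⟨ha, hb⟩ := mem_product.1 hp
  simp [ha, hb]

lemma undCut_inter (y : V × V → ℝ) (H S : Finset V) : undCut y H (S ∩ H) = undCut y H S := by
  refine sum_congr (filter_congr fun p hp => ?_) fun _ _ => rfl
  obtain ⟨ha, hb⟩ := mem_product.1 hp
  simp [ha, hb]

lemma splits_inter_iff {H S : Finset V} : Splits H (S ∩ H) ↔ Splits H S := by
  unfold Splits
  refine and_congr (exists_congr fun a => and_congr_right fun h => by simp [h])
    (exists_congr fun a => and_congr_right fun h => by simp [h])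

open Classical in
lemma sum_exp_neg_undCut_le [Fintype V] {y : V × V → ℝ} (hy : ∀ p, 0 ≤ y p) {H : Finset V}
    (hmin : ∀ S, Splits H S → 1 ≤ undCut y H S) :
    ∑ S ∈ H.powerset with Splits H S,
        Real.exp (-(19 * Real.log (Fintype.card V) * undCut y H S)) ≤
      Real.exp (-(3 * Real.log (Fintype.card V))) := by
  have hk := sum_exp_neg_multiCut_le (H ×ˢ H) (fun p _ => hy p) #H H Prod.fst Prod.snd rfl
    (fun p hp => mem_product.1 hp) hmin
  calc _ ≤ ∑ S ∈ H.powerset with Splits H S, Real.exp (-(3 * Real.log (Fintype.card V))) *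
        Real.exp (-(16 * Real.log #H * undCut y H S)) := by
        refine sum_le_sum fun S hS => ?_
        obtain ⟨-, hS⟩ := mem_filter.1 hS
        rw [← Real.exp_add]
        refine Real.exp_le_exp.2 ?_
        have h1 := hmin S hS
        obtain ⟨⟨a, ha, -⟩, -⟩ := hS
        have hH : (1 : ℝ) ≤ #H := by exact_mod_cast card_pos.2 ⟨a, ha⟩
        have hlog : Real.log #H ≤ Real.log (Fintype.card V) :=
          Real.log_le_log (by linarith) (by exact_mod_cast card_le_univ H)
        have hlog0 := Real.log_nonneg hH
        nlinarith [mul_nonneg (hlog0.trans hlog) (sub_nonneg.2 h1),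
          mul_nonneg (sub_nonneg.2 hlog) (zero_le_one.trans h1)]
    _ ≤ _ := by
        rw [← mul_sum]
        refine mul_le_of_le_one_right (Real.exp_pos _).le (hk.trans ?_)
        have : (0 : ℝ) ≤ (1 / 2) ^ #H := by positivity
        linarith

open Classical in
/-- Sampling edges independently preserves all directed cuts of all sets of `F` up to an error
controlled by the undirected cut. -/
theorem exists_sampling [Fintype V] (hV : 2 ≤ Fintype.card V) {y : V × V → ℝ}
    (hy : ∀ p, 0 ≤ y p) {F : Finset (Finset V)} (hF : #F ≤ Fintype.card V)
    (hmin : ∀ H ∈ F, ∀ S, Splits H S → 1 ≤ undCut y H S) {ε β ρ : ℝ} (hε : 0 < ε)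
    (hε1 : ε ≤ 1) (hβ : 0 < β) (hρ : 0 < ρ)
    (hρε : ε ^ 2 * ρ = 19 * β * Real.log (Fintype.card V)) :
    ∃ z : V × V → ℝ, (∀ p, 0 ≤ z p) ∧ (∀ p, 0 < z p → 0 < y p) ∧
      ((#{p | 0 < z p} : ℝ) ≤ 2 + 2 * (ρ * ∑ p, y p)) ∧
      ∀ H ∈ F, ∀ S, |dirCut z H S - dirCut y H S| ≤
        ε * (dirCut y H S + undCut y H S / β) := by
  set q : V × V → ℝ := fun p => min 1 (ρ * y p) with hq
  have hq0 : ∀ p, 0 ≤ q p := fun p => le_min zero_le_one (mul_nonneg hρ.le (hy p))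
  have hq1 : ∀ p, q p ≤ 1 := fun p => min_le_left _ _
  set Q := ∑ p, q p with hQ
  have hQle : Q ≤ ρ * ∑ p, y p := by
    rw [hQ, mul_sum]
    exact sum_le_sum fun p _ => min_le_right _ _
  have hn : (2 : ℝ) ≤ Fintype.card V := by exact_mod_cast hV
  set n : ℝ := (Fintype.card V : ℝ) with hndef
  set dev : Finset V → Finset V → (V × V → Bool) → ℝ := fun H S x =>
    dirCut (sampled ρ y x) H S - dirCut y H S with hdev
  set err : Finset V → Finset V → ℝ := fun H S =>
    ε * (dirCut y H S + undCut y H S / β) with herr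
  set g₁ : (V × V → Bool) → ℝ := fun x =>
    1 / 4 * Real.exp (-Q) * 2 ^ #{p | x p = true} with hg₁
  set g₂ : Finset V → Finset V → (V × V → Bool) → ℝ := fun H S x =>
    Real.exp (-(ε * ρ * err H S)) * Real.exp (ε * ρ * dev H S x) +
      Real.exp (-(ε * ρ * err H S)) * Real.exp (-ε * ρ * dev H S x) with hg₂
  have hE₁ : bernoulliExp q g₁ ≤ 1 / 4 := by
    rw [hg₁, bernoulliExp_const_mul]
    calc _ ≤ 1 / 4 * Real.exp (-Q) * Real.exp Q :=
          mul_le_mul_of_nonneg_left (bernoulliExp_two_pow_card_le hq0) (by positivity)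
      _ = 1 / 4 := by rw [mul_assoc, ← Real.exp_add]; simp
  have hE₂ : ∀ H S, bernoulliExp q (g₂ H S) ≤
      2 * Real.exp (-(19 * Real.log n * undCut y H S)) := by
    intro H S
    have key : ∀ θ : ℝ, θ ^ 2 = ε ^ 2 → Real.exp (-(ε * ρ * err H S)) *
        bernoulliExp q (fun x => Real.exp (θ * ρ * dev H S x)) ≤
        Real.exp (-(19 * Real.log n * undCut y H S)) := by
      intro θ hθ
      have hθ1 : |θ| ≤ 1 := by
        rw [← sq_le_one_iff_abs_le_one, hθ]
        exact pow_le_one₀ hε.le hε1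
      refine (mul_le_mul_of_nonneg_left (bernoulliExp_exp_deviation_le hρ hθ1 hy
        ((H ×ˢ H).filter fun p => p.1 ∈ S ∧ p.2 ∉ S)) (Real.exp_pos _).le).trans ?_
      rw [← Real.exp_add, hθ]
      refine Real.exp_le_exp.2 (le_of_eq ?_)
      have h2 : ε * ρ * err H S = ε ^ 2 * ρ * dirCut y H S +
          ε ^ 2 * ρ * (undCut y H S / β) := by rw [herr]; ring
      rw [h2, hρε]
      unfold dirCut
      field_simp
      ring
    rw [hg₂]
    simp only
    rw [bernoulliExp_add, bernoulliExp_const_mul, bernoulliExp_const_mul]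
    linarith [key ε rfl, key (-ε) (by ring)]
  obtain ⟨x, hx⟩ := exists_le_bernoulliExp hq0 hq1
    (fun x => g₁ x + ∑ H ∈ F, ∑ S ∈ H.powerset with Splits H S, g₂ H S x)
  have hEx : bernoulliExp q
      (fun x => g₁ x + ∑ H ∈ F, ∑ S ∈ H.powerset with Splits H S, g₂ H S x) < 1 := by
    rw [bernoulliExp_add, bernoulliExp_sum]
    simp only [bernoulliExp_sum]
    have h2 : ∀ H ∈ F, ∑ S ∈ H.powerset with Splits H S, bernoulliExp q (g₂ H S) ≤
        2 * Real.exp (-(3 * Real.log n)) := by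
      intro H hH
      refine (sum_le_sum fun S _ => hE₂ H S).trans ?_
      rw [← mul_sum]
      exact mul_le_mul_of_nonneg_left (sum_exp_neg_undCut_le hy (hmin H hH)) zero_le_two
    have h3 : Real.exp (-(3 * Real.log n)) = 1 / n ^ 3 := by
      rw [Real.exp_neg, mul_comm, Real.exp_mul, Real.exp_log (by linarith), one_div]
      norm_cast
    have h4 := (sum_le_sum h2).trans_eq (by rw [sum_const, nsmul_eq_mul])
    have h5 : (#F : ℝ) * (2 * Real.exp (-(3 * Real.log n))) ≤ 1 / 2 := by
      calc _ ≤ n * (2 * Real.exp (-(3 * Real.log n))) :=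
            mul_le_mul_of_nonneg_right (Nat.cast_le.2 hF) (by positivity)
        _ = 2 / n ^ 2 := by rw [h3]; field_simp
        _ ≤ 2 / 2 ^ 2 := by gcongr
        _ = 1 / 2 := by norm_num
    linarith
  have hlt := hx.trans_lt hEx
  have hg₁0 : 0 ≤ g₁ x := by rw [hg₁]; positivity
  have hg₂0 : ∀ H S, 0 ≤ g₂ H S x := fun H S => by rw [hg₂]; positivity
  refine ⟨sampled ρ y x, sampled_nonneg hρ.le hy x, fun p hp => ?_, ?_, fun H hH S => ?_⟩
  · refine (hy p).lt_of_ne fun h => ?_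
    simp [sampled, ← h] at hp
  · have h1 : g₁ x < 1 := lt_of_le_of_lt
      (le_add_of_nonneg_right (sum_nonneg fun H _ => sum_nonneg fun S _ => hg₂0 H S)) hlt
    have hsub : #{p | 0 < sampled ρ y x p} ≤ #{p | x p = true} := by
      refine card_le_card fun p hp => ?_
      simp only [mem_filter, mem_univ, true_and] at hp ⊢
      by_contra h
      simp [sampled, h] at hp
    have h2 : (2 : ℝ) ^ #{p | x p = true} ≤ 4 * Real.exp Q := by
      have : 2 ^ #{p | x p = true} = 4 * Real.exp Q * g₁ x := by
        rw [hg₁]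
        simp only
        rw [Real.exp_neg]
        field_simp
      rw [this]
      exact mul_le_of_le_one_right (by positivity) h1.le
    have h3 := Real.log_le_log (by positivity) h2
    rw [Real.log_pow, Real.log_mul (by norm_num) (Real.exp_pos _).ne', Real.log_exp,
      show (4 : ℝ) = 2 ^ 2 by norm_num, Real.log_pow] at h3
    have h4 : (1 / 2 : ℝ) < Real.log 2 := by linarith [Real.log_two_gt_d9]
    have h5 : (#{p | 0 < sampled ρ y x p} : ℝ) ≤ #{p | x p = true} := by exact_mod_cast hsub
    have hQ0 : 0 ≤ Q := sum_nonneg fun p _ => hq0 p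
    push_cast at h3
    by_contra! hcon
    nlinarith
  · by_cases hS : Splits H S
    swap
    · simp [dirCut_eq_zero_of_not_splits hS, undCut_eq_zero_of_not_splits hS]
    rw [← dirCut_inter _ H S, ← dirCut_inter y H S, ← undCut_inter y H S]
    set R := S ∩ H with hR
    have h1 : g₂ H R x < 1 := by
      refine lt_of_le_of_lt ?_ hlt
      refine le_trans ?_ (le_add_of_nonneg_left hg₁0)
      refine le_trans ?_ (single_le_sum (fun H _ => sum_nonneg fun S _ => hg₂0 H S) hH)
      refine single_le_sum (f := fun S => g₂ H S x) (fun S _ => hg₂0 H S) ?_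
      exact mem_filter.2 ⟨mem_powerset.2 inter_subset_right, splits_inter_iff.2 hS⟩
    have hερ : 0 < ε * ρ := mul_pos hε hρ
    have key : ∀ t, Real.exp (-(ε * ρ * err H R)) * Real.exp (ε * ρ * t) < 1 →
        t ≤ err H R := by
      intro t ht
      rw [← Real.exp_add, Real.exp_lt_one_iff] at ht
      by_contra! hcon
      nlinarith [mul_lt_mul_of_pos_left hcon hερ]
    have p1 : 0 < Real.exp (-(ε * ρ * err H R)) * Real.exp (ε * ρ * dev H R x) := by positivity
    have p2 : 0 < Real.exp (-(ε * ρ * err H R)) * Real.exp (-ε * ρ * dev H R x) := by positivity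
    simp only [hg₂] at h1
    refine abs_le'.2 ⟨key _ (by linarith), key _ ?_⟩
    rw [show ε * ρ * -(dirCut (sampled ρ y x) H R - dirCut y H R) = -ε * ρ * dev H R x by
      rw [hdev]; ring]
    linarith

lemma dirCut_mul_levelSum [Fintype V] (y : V × V → ℝ) (lam : Finset V → ℝ) (S : Finset V) :
    ∑ p with p.1 ∈ S ∧ p.2 ∉ S, y p * levelSum lam p = ∑ H, lam H * dirCut y H S := by
  simp only [levelSum, dirCut, mul_sum]
  rw [sum_comm]
  refine sum_congr rfl fun H _ => ?_
  rw [sum_filter, sum_filter, ← univ_inter (H ×ˢ H), ← sum_ite_mem]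
  refine sum_congr rfl fun p _ => ?_
  rw [univ_inter]
  split_ifs <;> simp [mul_comm]

lemma undCut_mul_levelSum [Fintype V] (y : V × V → ℝ) (lam : Finset V → ℝ) (S : Finset V) :
    undCut (fun p => y p * levelSum lam p) univ S = ∑ H, lam H * undCut y H S := by
  simp only [levelSum, undCut_eq, mul_sum, univ_product_univ]
  rw [sum_comm]
  refine sum_congr rfl fun H _ => ?_
  rw [sum_filter, sum_filter, ← univ_inter (H ×ˢ H), ← sum_ite_mem]
  refine sum_congr rfl fun p _ => ?_
  rw [univ_inter]
  split_ifs <;> simp [mul_comm]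

lemma cutW_eq_sum_filter [Fintype V] (w : V × V → ℝ) (S : Finset V) :
    cutW w S = ∑ p with p.1 ∈ S ∧ p.2 ∉ S, w p := by
  rw [cutW, ← sum_product']
  refine sum_congr ?_ fun _ _ => rfl
  ext p
  simp

lemma cutW_mul_levelSum [Fintype V] (y : V × V → ℝ) (lam : Finset V → ℝ) (S : Finset V) :
    cutW (fun p => y p * levelSum lam p) S = ∑ H, lam H * dirCut y H S := by
  rw [cutW_eq_sum_filter, dirCut_mul_levelSum]

lemma undCut_univ_eq [Fintype V] (w : V × V → ℝ) (S : Finset V) :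
    undCut w univ S = cutW w S + cutW w Sᶜ := by
  rw [cutW_eq_sum_filter, cutW_eq_sum_filter, undCut_eq, univ_product_univ]
  simp only [sum_filter, ← sum_add_distrib]
  refine sum_congr rfl fun p _ => ?_
  by_cases h1 : p.1 ∈ S <;> by_cases h2 : p.2 ∈ S <;> simp [h1, h2]

/-- In a strongly connected digraph every nontrivial cut is positive. -/
lemma cutW_pos [Fintype V] {w : V × V → ℝ} (hw : ∀ p, 0 ≤ w p)
    (hconn : ∀ u v : V, Relation.ReflTransGen (fun x y => 0 < w (x, y)) u v) {S : Finset V}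
    (hS : Splits univ S) : 0 < cutW w S := by
  obtain ⟨⟨a, -, ha⟩, b, -, hb⟩ := hS
  obtain ⟨u, v, hu, hv, huv⟩ : ∃ u v, u ∈ S ∧ v ∉ S ∧ 0 < w (u, v) := by
    by_contra! h
    have : ∀ v, Relation.ReflTransGen (fun x y => 0 < w (x, y)) a v → v ∈ S := by
      intro v hv
      induction hv with
      | refl => exact ha
      | tail _ h' ih => by_contra hc; exact absurd (h _ _ ih hc) (not_le.2 h')
    exact hb (this b (hconn a b))
  rw [cutW_eq_sum_filter]
  exact sum_pos' (fun p _ => hw p) ⟨(u, v), by simp [hu, hv], huv⟩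

open Classical in
/-- A connected weighted graph is a nonnegative combination of at most `|V|` graphs
of minimum cut at least `1`, cut out of one graph `y` of small total weight. -/
theorem exists_level_decomposition [Fintype V] (hV : 2 ≤ Fintype.card V) {w : V × V → ℝ}
    (hw : ∀ p, 0 ≤ w p) (hw0 : ∀ u, w (u, u) = 0)
    (hpos : ∀ S, Splits univ S → 0 < undCut w univ S) :
    ∃ (y : V × V → ℝ) (lam : Finset V → ℝ),
      (∀ p, 0 ≤ y p) ∧ (∀ H, 0 ≤ lam H) ∧ (w = fun p => y p * levelSum lam p) ∧
      (∀ p, 0 < levelSum lam p) ∧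
      ∑ p, y p ≤ Fintype.card V ∧ #{H | lam H ≠ 0} ≤ Fintype.card V ∧
      ∀ H, lam H ≠ 0 → ∀ S, Splits H S → 1 ≤ undCut y H S := by
  obtain ⟨a, b, hab⟩ := Fintype.exists_pair_of_one_lt_card (by omega : 1 < Fintype.card V)
  have hne : (univ.filter fun S : Finset V => Splits univ S).Nonempty :=
    ⟨{a}, by
      simp only [mem_filter, mem_univ, true_and]
      exact ⟨⟨a, mem_univ a, by simp⟩, b, mem_univ b, by simpa using hab.symm⟩⟩
  obtain ⟨R, hR, hRmin⟩ := exists_min_image _ (undCut w univ) hne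
  simp only [mem_filter, mem_univ, true_and] at hR hRmin
  set c := undCut w univ R with hc
  have hc0 : 0 < c := hpos R hR
  obtain ⟨y, lam, hy, hlam, hwy, hsum, hcard, hmin, hinv⟩ :=
    exists_strength_decomposition hw hw0 _ (univ : Finset V) rfl ⟨a, mem_univ a⟩ c hc0
  have hlev : ∀ p, levelSum (lam + Pi.single univ c) p = c + levelSum lam p := by
    intro p
    rw [levelSum_add, levelSum_single _ _ (by simp), add_comm]
  have hc' : ∀ H, 0 ≤ (Pi.single univ c : Finset V → ℝ) H := by
    intro H
    by_cases h : H = univ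
    · subst h; simp [hc0.le]
    · simp [h]
  refine ⟨y, lam + Pi.single univ c, hy, fun H => add_nonneg (hlam H) (hc' H), ?_, ?_, ?_, ?_, ?_⟩
  · funext p
    rw [hlev]
    exact hwy p (by simp)
  · intro p
    rw [hlev]
    exact add_pos_of_pos_of_nonneg hc0 (levelSum_nonneg hlam p)
  · rw [univ_product_univ, card_univ] at hsum
    linarith
  · have h1 := card_support_add_le lam (Pi.single univ c)
    have h3 : #{H | (Pi.single univ c : Finset V → ℝ) H ≠ 0} ≤ 1 := by
      refine card_le_one.2 fun H hH H' hH' => ?_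
      have : ∀ H, H ∈ univ.filter (fun H => (Pi.single univ c : Finset V → ℝ) H ≠ 0) →
          H = univ := by
        intro H hH
        by_contra h
        simp [h] at hH
      rw [this H hH, this H' hH']
    rw [card_univ] at hcard
    omega
  · intro H hH
    by_cases h : lam H ≠ 0
    · exact (hmin H h).2
    push Not at h
    have hHu : H = univ := by
      by_contra h'
      simp [h, h'] at hH
    subst hHu
    intro S hS
    refine le_trans (le_min le_rfl ((one_le_div hc0).2 ?_)) (hinv S)
    exact hRmin S hS

end Sparsification


/-- For-all cut sparsifiers for `β`-balanced digraphs (cf. Ikeda–Tanigawa / Theorem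
`forall-strong` specialized to `β`-balanced graphs): there is a universal constant `C`
such that every `β`-balanced weighted digraph on `n ≥ 2` vertices has a subgraph
reweighting with at most `C·β·n·log n/ε²` edges preserving all cuts up to `1 ± ε`. -/
theorem forall_sparsifier_beta_balanced :
    ∃ C : ℝ, 0 < C ∧
      ∀ (V : Type) [Fintype V] [DecidableEq V] (w : V × V → ℝ) (n : ℕ) (ε β : ℝ),
        n = Fintype.card V → 2 ≤ n →
        (∀ p : V × V, 0 ≤ w p) → (∀ u : V, w (u, u) = 0) →
        0 < ε → ε < 1 → 1 ≤ β →
        (∀ u v : V, Relation.ReflTransGen (fun x y => 0 < w (x, y)) u v) →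
        (∀ S : Finset V, cutW w S ≤ β * cutW w Sᶜ) →
        ∃ w_H : V × V → ℝ,
          (∀ p : V × V, 0 ≤ w_H p) ∧
          (∀ p : V × V, 0 < w_H p → 0 < w p) ∧
          (({p : V × V | 0 < w_H p}.ncard : ℝ) ≤ C * β * n * Real.log n / ε ^ 2) ∧
          (∀ S : Finset V,
            (1 - ε) * cutW w S ≤ cutW w_H S ∧ cutW w_H S ≤ (1 + ε) * cutW w S) := by
  refine ⟨4 * 171, by norm_num, ?_⟩
  intro V _ _ w n ε β hn hn2 hw hw0 hε hε1 hβ hconn hbal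
  subst hn
  classical
  have hpos : ∀ S, Splits univ S → 0 < undCut w univ S := by
    intro S hS
    rw [undCut_univ_eq]
    have : 0 ≤ cutW w Sᶜ := sum_nonneg fun _ _ => sum_nonneg fun _ _ => hw _
    linarith [cutW_pos hw hconn hS]
  obtain ⟨y, lam, hy, hlam, hwy, hlev, hsum, hcard, hmin⟩ :=
    exists_level_decomposition hn2 hw hw0 hpos
  have hn : (2 : ℝ) ≤ Fintype.card V := by exact_mod_cast hn2
  set n : ℝ := (Fintype.card V : ℝ) with hndef
  have hlog : 1 / 2 < Real.log n := by
    have := Real.log_le_log (by norm_num) hn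
    linarith [Real.log_two_gt_d9]
  have hβ0 : 0 < β := by linarith
  set ρ := 171 * β * Real.log n / ε ^ 2 with hρ
  have hρ0 : 0 < ρ := by positivity
  obtain ⟨z, hz, hzy, hzcard, hzdev⟩ := exists_sampling hn2 hy hcard
    (fun H hH => hmin H (mem_filter.1 hH).2) (ε := ε / 3) (by positivity) (by linarith) hβ0 hρ0
    (by rw [hρ, ← hndef]; field_simp; norm_num)
  refine ⟨fun p => z p * levelSum lam p, fun p => mul_nonneg (hz p) (hlev p).le, ?_, ?_, ?_⟩
  · intro p hp
    rw [hwy]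
    exact mul_pos (hzy p (pos_of_mul_pos_left hp (hlev p).le)) (hlev p)
  · have h1 : {p : V × V | 0 < z p * levelSum lam p} =
        ((univ.filter fun p => 0 < z p : Finset (V × V)) : Set (V × V)) := by
      ext p
      simp [mul_pos_iff_of_pos_right (hlev p)]
    rw [h1, Set.ncard_coe_finset]
    have h2 : ρ * ∑ p, y p ≤ ρ * n := mul_le_mul_of_nonneg_left hsum hρ0.le
    have h3 : 1 ≤ ρ := by
      rw [hρ, one_le_div (by positivity)]
      have : ε ^ 2 ≤ 1 := pow_le_one₀ hε.le hε1.le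
      nlinarith
    have h4 : 4 * 171 * β * n * Real.log n / ε ^ 2 = 4 * (ρ * n) := by rw [hρ]; ring
    rw [h4]
    nlinarith
  · intro S
    have hdev : |cutW (fun p => z p * levelSum lam p) S - cutW w S| ≤
        ε / 3 * (cutW w S + undCut w univ S / β) := by
      rw [hwy, cutW_mul_levelSum, cutW_mul_levelSum, undCut_mul_levelSum, sum_div,
        ← sum_add_distrib, mul_sum, ← sum_sub_distrib]
      refine (abs_sum_le_sum_abs _ _).trans (sum_le_sum fun H _ => ?_)
      rw [← mul_sub, abs_mul, abs_of_nonneg (hlam H)]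
      by_cases hH : lam H = 0
      · simp [hH]
      · refine (mul_le_mul_of_nonneg_left (hzdev H (by simpa using hH) S) (hlam H)).trans
          (le_of_eq ?_)
        ring
    have hund : undCut w univ S / β ≤ 2 * cutW w S := by
      rw [undCut_univ_eq, div_le_iff₀ hβ0]
      have h1 := hbal Sᶜ
      rw [compl_compl] at h1
      have h2 : 0 ≤ cutW w S := sum_nonneg fun _ _ => sum_nonneg fun _ _ => hw _
      nlinarith
    have := mul_le_mul_of_nonneg_left hund (by positivity : 0 ≤ ε / 3)
    obtain ⟨h1, h2⟩ := abs_le.1 hdev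
    constructor <;> linarith
end

section
/- Let V be a finite set, s ≠ t two vertices of V, and c : V × V → ℝ a symmetric capacity function (c(u,v) = c(v,u) ≥ 0, c(u,u) = 0). Let f : V × V → ℝ be a feasible flow: 0 ≤ f(u,v) ≤ c(u,v) for all u,v, and Σ_v f(x,v) = Σ_v f(v,x) for every x ∉ {s,t}. Let v* > 0 and 0 < γ ≤ 1 be such that the flow value Σ_v f(s,v) − Σ_v f(v,s) equals (1−γ)·v*, and such that Σ_{u∈S,x∉S} c(u,x) ≥ v* for every S ⊆ V with s ∈ S and t ∉ S. Define the residual capacities r(u,v) := c(u,v) − f(u,v) + f(v,u). Then for every S ⊆ V with s ∈ S and t ∉ S, writing r(S,S̄) := Σ_{u∈S,x∉S} r(u,x) and r(S̄,S) := Σ_{x∉S,u∈S} r(x,u), one has r(S,S̄) > 0 and r(S,S̄) ≤ r(S̄,S) ≤ (2/γ)·r(S,S̄); that is, every s-t cut of the residual graph is (2/γ)-balanced. -/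
open Finset

/-- The net flow across any cut separating `s` from `t` equals the net flow out of `s`. -/
theorem net_flow_across_cut {V : Type*} [Fintype V] [DecidableEq V] {s t : V} (f : V × V → ℝ)
    (hcons : ∀ x : V, x ≠ s → x ≠ t → (∑ v : V, f (x, v)) = ∑ v : V, f (v, x))
    {S : Finset V} (hs : s ∈ S) (ht : t ∉ S) :
    (∑ u ∈ S, ∑ x ∈ Sᶜ, f (u, x)) - ∑ u ∈ S, ∑ x ∈ Sᶜ, f (x, u) =
      (∑ v : V, f (s, v)) - ∑ v : V, f (v, s) := by
  have hsum : ∑ u ∈ S, ((∑ v : V, f (u, v)) - ∑ v : V, f (v, u)) =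
      (∑ v : V, f (s, v)) - ∑ v : V, f (v, s) := by
    refine Finset.sum_eq_single_of_mem s hs fun x hx hxs => ?_
    rw [hcons x hxs (ne_of_mem_of_not_mem hx ht), sub_self]
  have hinner : ∑ u ∈ S, ∑ v ∈ S, f (u, v) = ∑ u ∈ S, ∑ v ∈ S, f (v, u) := Finset.sum_comm
  simp only [← Finset.sum_add_sum_compl S, Finset.sum_sub_distrib, Finset.sum_add_distrib]
    at hsum ⊢
  linarith

/-- Every `s`-`t` cut of the residual graph of a feasible flow in an undirected
(symmetric-capacity) network with a `1-γ` fraction of a value-`v*` flow routed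
is `(2/γ)`-balanced. -/
theorem residual_cuts_balanced {V : Type*} [Fintype V] [DecidableEq V]
    (s t : V) (hst : s ≠ t) (c f : V × V → ℝ)
    (hsym : ∀ u v : V, c (u, v) = c (v, u))
    (hcnn : ∀ u v : V, 0 ≤ c (u, v))
    (hcdiag : ∀ u : V, c (u, u) = 0)
    (hf0 : ∀ u v : V, 0 ≤ f (u, v))
    (hfc : ∀ u v : V, f (u, v) ≤ c (u, v))
    (hcons : ∀ x : V, x ≠ s → x ≠ t → (∑ v : V, f (x, v)) = ∑ v : V, f (v, x))
    (vstar γ : ℝ) (hv : 0 < vstar) (hγ0 : 0 < γ) (hγ1 : γ ≤ 1)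
    (hval : (∑ v : V, f (s, v)) - (∑ v : V, f (v, s)) = (1 - γ) * vstar)
    (hcap : ∀ S : Finset V, s ∈ S → t ∉ S → vstar ≤ ∑ u ∈ S, ∑ x ∈ Sᶜ, c (u, x)) :
    ∀ S : Finset V, s ∈ S → t ∉ S →
      (0 < ∑ u ∈ S, ∑ x ∈ Sᶜ, (c (u, x) - f (u, x) + f (x, u))) ∧
      ((∑ u ∈ S, ∑ x ∈ Sᶜ, (c (u, x) - f (u, x) + f (x, u)))
          ≤ ∑ x ∈ Sᶜ, ∑ u ∈ S, (c (x, u) - f (x, u) + f (u, x))) ∧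
      ((∑ x ∈ Sᶜ, ∑ u ∈ S, (c (x, u) - f (x, u) + f (u, x)))
          ≤ (2 / γ) * ∑ u ∈ S, ∑ x ∈ Sᶜ, (c (u, x) - f (u, x) + f (x, u))) := by
  intro S hs ht
  have hnet := net_flow_across_cut f hcons hs ht
  rw [hval] at hnet
  have hC := hcap S hs ht
  rw [Finset.sum_comm (s := Sᶜ) (t := S)]
  simp only [Finset.sum_sub_distrib, Finset.sum_add_distrib]
  have hsymS : ∑ u ∈ S, ∑ x ∈ Sᶜ, c (x, u) = ∑ u ∈ S, ∑ x ∈ Sᶜ, c (u, x) :=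
    Finset.sum_congr rfl fun u _ => Finset.sum_congr rfl fun x _ => hsym x u
  rw [hsymS]
  have hγv : 0 < γ * vstar := mul_pos hγ0 hv
  refine ⟨by linarith, by nlinarith, ?_⟩
  rw [div_mul_eq_mul_div, le_div_iff₀ hγ0]
  generalize (∑ u ∈ S, ∑ x ∈ Sᶜ, c (u, x)) = C at *
  generalize (∑ u ∈ S, ∑ x ∈ Sᶜ, f (u, x)) = A at *
  generalize (∑ u ∈ S, ∑ x ∈ Sᶜ, f (x, u)) = B at *
  obtain rfl : A = B + (1 - γ) * vstar := by linarith
  nlinarith [mul_nonneg (sub_nonneg.2 hC) (by linarith : 0 ≤ 2 - γ), mul_pos hγ0 hγv]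
end

section
/- There exist a universal constant ε₀ > 0 and a constant n₀ such that the following holds for every n ≥ n₀. Let V be a finite set with |V| = 2n and set β = 8n. Let b be a natural number, and suppose there exist functions sk : (V × V → ℝ) → Fin(2^b) and f : Set V → Fin(2^b) → ℝ such that for every β-balanced weighted digraph w on V with all weights in {0,1} and every S ⊆ V one has |f(S)(sk(w)) − w(S,S̄)| ≤ ε₀·w(S,S̄). Then b ≥ n²/4. -/
open Finset

/-- The value of the directed cut `(S, V ∖ S)` in the weighted digraph `w`,
for a set `S` of vertices. -/
noncomputable def cutS {V : Type} [Fintype V] (w : V × V → ℝ) (S : Set V) : ℝ := by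
  classical exact ∑ p : V × V, if p.1 ∈ S ∧ p.2 ∉ S then w p else 0
section Balance

variable {V : Type} [Fintype V]

theorem cutS_eq_sum (w : V × V → ℝ) (S : Set V)
    [DecidablePred fun p : V × V => p.1 ∈ S ∧ p.2 ∉ S] :
    cutS w S = ∑ p : V × V, if p.1 ∈ S ∧ p.2 ∉ S then w p else 0 :=
  Finset.sum_congr rfl fun p _ => by congr

theorem cutS_nonneg {w : V × V → ℝ} (hw : ∀ p, 0 ≤ w p) (S : Set V) : 0 ≤ cutS w S := by
  classical
  rw [cutS_eq_sum]
  refine Finset.sum_nonneg fun p _ => ?_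
  split_ifs
  exacts [hw p, le_rfl]

/-- A cut with weights at most one weighs at most the number of pairs it separates. -/
theorem cutS_le_card_mul_card [DecidableEq V] {w : V × V → ℝ} (hw : ∀ p, w p ≤ 1)
    (S : Finset V) : cutS w S ≤ (#S : ℝ) * #Sᶜ := by
  classical
  rw [cutS_eq_sum, ← Finset.sum_filter]
  calc ∑ p : V × V with p.1 ∈ (S : Set V) ∧ p.2 ∉ (S : Set V), w p
      ≤ ∑ p : V × V with p.1 ∈ (S : Set V) ∧ p.2 ∉ (S : Set V), (1 : ℝ) :=
        Finset.sum_le_sum fun p _ => hw p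
    _ = (#(S ×ˢ Sᶜ) : ℝ) := by
        rw [Finset.sum_const, nsmul_eq_mul, mul_one]
        congr 2
        ext p
        simp
    _ = (#S : ℝ) * #Sᶜ := by rw [Finset.card_product]; push_cast; rfl

theorem card_le_cutS_of_injective {w : V × V → ℝ} (hw : ∀ p, 0 ≤ w p) (S : Set V)
    (T : Finset V) (g : V → V × V) (hg : Function.Injective g)
    (h : ∀ v ∈ T, (g v).1 ∈ S ∧ (g v).2 ∉ S ∧ w (g v) = 1) : (#T : ℝ) ≤ cutS w S := by
  classical
  rw [cutS_eq_sum]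
  calc (#T : ℝ) = ∑ p ∈ T.image g, if p.1 ∈ S ∧ p.2 ∉ S then w p else 0 := by
        rw [Finset.sum_image hg.injOn, Finset.sum_congr rfl (g := fun _ => (1 : ℝ))]
        · simp
        · intro v hv
          obtain ⟨h1, h2, h3⟩ := h v hv
          rw [if_pos ⟨h1, h2⟩, h3]
    _ ≤ _ := by
        refine Finset.sum_le_sum_of_subset_of_nonneg (Finset.subset_univ _) fun p _ _ => ?_
        split_ifs
        exacts [hw p, le_rfl]

/-- A digraph with weights in `[0, 1]` containing a bidirected spanning star is
`|V|`-balanced. -/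
theorem cutS_le_card_mul_cutS_compl {w : V × V → ℝ} (hw0 : ∀ p, 0 ≤ w p)
    (hw1 : ∀ p, w p ≤ 1) (c : V) (hout : ∀ v, v ≠ c → w (c, v) = 1)
    (hin : ∀ v, v ≠ c → w (v, c) = 1) (S : Set V) :
    cutS w S ≤ (Fintype.card V : ℝ) * cutS w Sᶜ := by
  classical
  obtain ⟨S, rfl⟩ : ∃ T : Finset V, (T : Set V) = S := ⟨S.toFinset, by simp⟩
  refine (cutS_le_card_mul_card hw1 S).trans ?_
  have hV : ∀ T : Finset V, (#T : ℝ) ≤ Fintype.card V := fun T => by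
    exact_mod_cast Finset.card_le_univ T
  by_cases hc : c ∈ S
  · have : (#Sᶜ : ℝ) ≤ cutS w (S : Set V)ᶜ := by
      refine card_le_cutS_of_injective hw0 _ _ (fun v => (v, c))
        (fun a b h => (Prod.mk.inj h).1) fun v hv => ?_
      rw [Finset.mem_compl] at hv
      refine ⟨by simpa using hv, by simpa using hc, hin v ?_⟩
      rintro rfl
      exact hv hc
    exact mul_le_mul (hV S) this (by positivity) (by positivity)
  · have : (#S : ℝ) ≤ cutS w (S : Set V)ᶜ := by
      refine card_le_cutS_of_injective hw0 _ _ (fun v => (c, v))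
        (fun a b h => (Prod.mk.inj h).2) fun v hv => ?_
      refine ⟨by simpa using hc, by simpa using hv, hout v ?_⟩
      rintro rfl
      exact hc hv
    rw [mul_comm]
    exact mul_le_mul (hV Sᶜ) this (by positivity) (by positivity)

end Balance

section Star

variable {L R : Type} [DecidableEq R]

/-- The indicator of the bipartite digraph from `L` to `R` with out-neighbourhoods `N`,
joined in both directions to an additional centre `none`. -/
def starWeight (N : L → Finset R) : Option (L ⊕ R) → Option (L ⊕ R) → ℝ
  | none, none => 0
  | none, some _ => 1
  | some _, none => 1
  | some (.inl u), some (.inr r) => if r ∈ N u then 1 else 0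
  | some (.inl _), some (.inl _) => 0
  | some (.inr _), some _ => 0

theorem starWeight_eq_zero_or_one (N : L → Finset R) (x y : Option (L ⊕ R)) :
    starWeight N x y = 0 ∨ starWeight N x y = 1 := by
  rcases x with _ | u | r <;> rcases y with _ | v | s <;> simp [starWeight]
  exact (em _).symm

theorem starWeight_self (N : L → Finset R) (x : Option (L ⊕ R)) : starWeight N x x = 0 := by
  rcases x with _ | u | r <;> simp [starWeight]

theorem starWeight_none_left (N : L → Finset R) {x : Option (L ⊕ R)} (hx : x ≠ none) :
    starWeight N none x = 1 := by
  rcases x with _ | x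
  exacts [absurd rfl hx, rfl]

theorem starWeight_none_right (N : L → Finset R) {x : Option (L ⊕ R)} (hx : x ≠ none) :
    starWeight N x none = 1 := by
  rcases x with _ | u | r
  exacts [absurd rfl hx, rfl, rfl]

/-- The source side of a cut that exposes the out-edges of `u` into `T`. -/
def probeSet (u : L) (T : Finset R) : Set (Option (L ⊕ R))
  | none => False
  | some (.inl v) => v = u
  | some (.inr r) => r ∉ T

variable [Fintype L] [Fintype R] {V : Type} [Fintype V]

theorem cutS_starWeight_probeSet (e : V ≃ Option (L ⊕ R)) (N : L → Finset R) (u : L)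
    (T : Finset R) :
    cutS (fun p : V × V => starWeight N (e p.1) (e p.2)) (e ⁻¹' probeSet u T)
      = 1 + (Fintype.card R - #T) + #(T ∩ N u) := by
  classical
  have hnone : none ∉ probeSet u T := id
  have hinl : ∀ v, some (.inl v) ∈ probeSet u T ↔ v = u := fun _ => Iff.rfl
  have hinr : ∀ r, some (.inr r) ∈ probeSet u T ↔ r ∉ T := fun _ => Iff.rfl
  rw [cutS_eq_sum]
  simp only [Set.mem_preimage]
  refine ((e.prodCongr e).sum_comp (fun p : Option (L ⊕ R) × Option (L ⊕ R) =>
    if p.1 ∈ probeSet u T ∧ p.2 ∉ probeSet u T then starWeight N p.1 p.2 else 0)).trans ?_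
  have hT : ∑ r : R, (if r ∉ T then (1 : ℝ) else 0) = Fintype.card R - #T := by
    rw [← Finset.sum_filter, Finset.sum_const, nsmul_eq_mul, mul_one,
      Finset.filter_not, Finset.filter_mem_eq_inter, Finset.univ_inter,
      ← Finset.compl_eq_univ_sdiff, Finset.card_compl,
      Nat.cast_sub (Finset.card_le_univ T)]
  rw [Fintype.sum_prod_type]
  simp only [Fintype.sum_option, Fintype.sum_sum_type, hnone, hinl, hinr, starWeight,
    not_false_eq_true, and_true, false_and, if_false, not_not, ite_self,
    Finset.sum_const_zero, add_zero, zero_add, hT]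
  rw [Finset.sum_add_distrib, Finset.sum_ite_eq' Finset.univ u]
  have : ∀ v : L, ∑ r : R, (if v = u ∧ r ∈ T then (if r ∈ N v then (1 : ℝ) else 0) else 0)
      = if v = u then (#(T ∩ N u) : ℝ) else 0 := by
    intro v
    split_ifs with h
    · subst h
      simp [Finset.sum_ite_mem]
    · simp [h]
  simp only [this, Finset.sum_ite_eq', Finset.mem_univ, if_true]
  ring

end Star

section HammingBall

variable {R : Type} [Fintype R]

theorem card_filter_card_le_mul_pow_le (d : ℕ) (hd : d ≤ Fintype.card R) :
    #{A : Finset R | #A ≤ d} * 4 ^ Fintype.card R ≤ 5 ^ Fintype.card R * 4 ^ d := by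
  have hsum : ∑ A : Finset R, 4 ^ (Fintype.card R - #A) = 5 ^ Fintype.card R := by
    have := Finset.sum_pow_mul_eq_add_pow 1 4 (Finset.univ : Finset R)
    simpa only [one_pow, one_mul, Finset.powerset_univ, Finset.card_univ] using this
  have hle : #{A : Finset R | #A ≤ d} * 4 ^ (Fintype.card R - d) ≤ 5 ^ Fintype.card R := by
    rw [← hsum, ← smul_eq_mul, ← Finset.sum_const]
    refine (Finset.sum_le_sum fun A hA => ?_).trans
      (Finset.sum_le_sum_of_subset (Finset.filter_subset _ _))
    exact Nat.pow_le_pow_right (by norm_num)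
      (Nat.sub_le_sub_left (Finset.mem_filter.1 hA).2 _)
  calc #{A : Finset R | #A ≤ d} * 4 ^ Fintype.card R
      = #{A : Finset R | #A ≤ d} * 4 ^ (Fintype.card R - d) * 4 ^ d := by
        rw [mul_assoc, ← pow_add, Nat.sub_add_cancel hd]
    _ ≤ _ := Nat.mul_le_mul_right _ hle

/-- A Hamming ball of relative radius at most `1/16` has at most `2 ^ (|R| / 2)` points. -/
theorem sq_card_filter_card_le_le_two_pow (d : ℕ) (hd : 16 * d ≤ Fintype.card R) :
    #{A : Finset R | #A ≤ d} ^ 2 ≤ 2 ^ Fintype.card R := by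
  set K := #{A : Finset R | #A ≤ d}
  set n := Fintype.card R
  have h : K * 4 ^ n ≤ 5 ^ n * 4 ^ d := card_filter_card_le_mul_pow_le d (by omega)
  refine (Nat.pow_le_pow_iff_left (n := 4) (by norm_num)).1 ?_
  refine Nat.le_of_mul_le_mul_right ?_ (show 0 < (4 ^ 8) ^ n by positivity)
  calc (K ^ 2) ^ 4 * (4 ^ 8) ^ n = (K * 4 ^ n) ^ 8 := by
        rw [mul_pow, ← pow_mul, ← pow_mul, ← pow_mul, mul_comm 8 n]
    _ ≤ (5 ^ n * 4 ^ d) ^ 8 := Nat.pow_le_pow_left h 8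
    _ = (5 ^ 8) ^ n * 2 ^ (16 * d) := by
        rw [mul_pow, ← pow_mul, ← pow_mul, ← pow_mul, show 4 = 2 ^ 2 by norm_num, ← pow_mul,
          mul_comm 8 n, show 2 * (d * 8) = 16 * d by ring]
    _ ≤ (5 ^ 8) ^ n * 2 ^ n :=
        Nat.mul_le_mul_left _ (Nat.pow_le_pow_right (by norm_num) hd)
    _ = (5 ^ 8 * 2) ^ n := (mul_pow _ _ _).symm
    _ ≤ (2 ^ 4 * 4 ^ 8) ^ n := Nat.pow_le_pow_left (by norm_num) n
    _ = (2 ^ n) ^ 4 * (4 ^ 8) ^ n := by rw [mul_pow, pow_right_comm]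

variable [DecidableEq R]

theorem card_filter_card_symmDiff_le (B : Finset R) (d : ℕ) :
    #{A : Finset R | #(symmDiff A B) ≤ d} ≤ #{A : Finset R | #A ≤ d} :=
  Finset.card_le_card_of_injOn (fun A => symmDiff A B) (fun A hA => by simpa using hA)
    (symmDiff_left_injective B).injOn

/-- If `F` only identifies set systems that are pointwise close, its codomain is large. -/
theorem two_pow_le_card_mul_pow {L X : Type} [Fintype L] [DecidableEq L] [Fintype X]
    [DecidableEq X] (d : ℕ) (F : (L → Finset R) → X)
    (hF : ∀ N N', F N = F N' → ∀ u, #(symmDiff (N u) (N' u)) ≤ d) :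
    (2 ^ Fintype.card R) ^ Fintype.card L
      ≤ #{A : Finset R | #A ≤ d} ^ Fintype.card L * Fintype.card X := by
  have hfib : ∀ x ∈ (Finset.univ : Finset X),
      #{N ∈ (Finset.univ : Finset (L → Finset R)) | F N = x}
        ≤ #{A : Finset R | #A ≤ d} ^ Fintype.card L := by
    intro x _
    rcases Finset.eq_empty_or_nonempty
      {N ∈ (Finset.univ : Finset (L → Finset R)) | F N = x} with h | ⟨N₀, hN₀⟩
    · rw [h]
      simp
    · calc _ ≤ #(Fintype.piFinset fun u => {A : Finset R | #(symmDiff A (N₀ u)) ≤ d}) := by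
            refine Finset.card_le_card fun N hN => ?_
            simp only [Finset.mem_filter, Finset.mem_univ, true_and] at hN hN₀
            simpa using hF N N₀ (hN.trans hN₀.symm)
        _ ≤ ∏ _u : L, #{A : Finset R | #A ≤ d} := by
            rw [Fintype.card_piFinset]
            exact Finset.prod_le_prod' fun u _ => card_filter_card_symmDiff_le _ _
        _ = _ := by simp
  have := Finset.card_le_mul_card_image_of_maps_to (s := (Finset.univ : Finset (L → Finset R)))
    (t := (Finset.univ : Finset X)) (f := F) (fun _ _ => Finset.mem_univ _) _ hfib
  simpa using this

end HammingBall

/-- A number approximating both `a` and `a - t` with relative error `ε` forces `t` to be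
at most `2 ε a`. -/
theorem le_two_mul_mul_of_abs_sub_le {x a t ε : ℝ} (hε : 0 ≤ ε) (ht : 0 ≤ t)
    (h : |x - a| ≤ ε * a) (h' : |x - (a - t)| ≤ ε * (a - t)) : t ≤ 2 * ε * a := by
  have := abs_le.1 h
  have := abs_le.1 h'
  nlinarith [mul_nonneg hε ht]

/-- Lower bound for deterministic for-all cut sketches, special case `β = 8n`,
`ε = ε₀` constant (Lemma `allcuts-lb-simple`): any `(1±ε₀)` for-all cut sketch
scheme for the `8n`-balanced unweighted digraphs on `2n` vertices needs `n²/4` bits. -/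
theorem forall_cut_sketch_lower_bound_simple :
    ∃ ε₀ : ℝ, 0 < ε₀ ∧
      ∃ n₀ : ℕ, ∀ n : ℕ, n₀ ≤ n →
        ∀ (V : Type) [Fintype V] [DecidableEq V],
          Fintype.card V = 2 * n →
          ∀ b : ℕ,
            (∃ (sk : (V × V → ℝ) → Fin (2 ^ b)) (f : Set V → Fin (2 ^ b) → ℝ),
              ∀ w : V × V → ℝ,
                (∀ p : V × V, w p = 0 ∨ w p = 1) → (∀ u : V, w (u, u) = 0) →
                (∀ u v : V, Relation.ReflTransGen (fun x y => 0 < w (x, y)) u v) →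
                (∀ S : Set V, cutS w S ≤ (8 * n : ℝ) * cutS w Sᶜ) →
                ∀ S : Set V, |f S (sk w) - cutS w S| ≤ ε₀ * cutS w S) →
            (n : ℝ) ^ 2 / 4 ≤ (b : ℝ) := by
  refine ⟨1 / 128, by norm_num, 2, ?_⟩
  rintro n hn V _ _ hcard b ⟨sk, f, hf⟩
  have e : V ≃ Option (Fin (n - 1) ⊕ Fin n) := Fintype.equivOfCardEq (by simp [hcard]; omega)
  set w : (Fin (n - 1) → Finset (Fin n)) → V × V → ℝ :=
    fun N p => starWeight N (e p.1) (e p.2) with hw_def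
  have hn' : (2 : ℝ) ≤ n := by exact_mod_cast hn
  have approx : ∀ N S, |f S (sk (w N)) - cutS (w N) S| ≤ 1 / 128 * cutS (w N) S := by
    intro N
    have hw : ∀ p, w N p = 0 ∨ w N p = 1 := fun p => starWeight_eq_zero_or_one N _ _
    have hw0 : ∀ p, 0 ≤ w N p := fun p => by rcases hw p with h | h <;> simp [h]
    have hw1 : ∀ p, w N p ≤ 1 := fun p => by rcases hw p with h | h <;> simp [h]
    have hne : ∀ v, v ≠ e.symm none → e v ≠ none := fun v hv h => hv (by simp [← h])
    have hout : ∀ v, v ≠ e.symm none → w N (e.symm none, v) = 1 := fun v hv => by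
      simpa [hw_def] using starWeight_none_left N (hne v hv)
    have hin : ∀ v, v ≠ e.symm none → w N (v, e.symm none) = 1 := fun v hv => by
      simpa [hw_def] using starWeight_none_right N (hne v hv)
    refine hf (w N) hw (fun u => starWeight_self N _) (fun u v => ?_) fun S => ?_
    · refine Relation.ReflTransGen.trans (b := e.symm none) ?_ ?_
      · rcases eq_or_ne u (e.symm none) with rfl | h
        · exact .refl
        · exact .single (by simp [hin u h])
      · rcases eq_or_ne v (e.symm none) with rfl | h
        · exact .refl
        · exact .single (by simp [hout v h])
    · refine (cutS_le_card_mul_cutS_compl hw0 hw1 _ hout hin S).trans ?_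
      refine mul_le_mul_of_nonneg_right ?_ (cutS_nonneg hw0 _)
      rw [hcard]
      push_cast
      linarith
  have sdiff_le : ∀ N N', sk (w N) = sk (w N') → ∀ u,
      (#(N u \ N' u) : ℝ) ≤ 1 / 64 * (n + 1) := by
    intro N N' h u
    have h₁ := approx N (e ⁻¹' probeSet u (N u \ N' u))
    have h₂ := approx N' (e ⁻¹' probeSet u (N u \ N' u))
    rw [cutS_starWeight_probeSet, Finset.inter_eq_left.2 Finset.sdiff_subset,
      Fintype.card_fin] at h₁
    rw [cutS_starWeight_probeSet, Finset.sdiff_inter_self, Finset.card_empty, Nat.cast_zero,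
      Fintype.card_fin, ← h] at h₂
    rw [show 1 + ((n : ℝ) - #(N u \ N' u)) + #(N u \ N' u) = n + 1 by ring] at h₁
    rw [show 1 + ((n : ℝ) - #(N u \ N' u)) + 0 = n + 1 - #(N u \ N' u) by ring] at h₂
    have := le_two_mul_mul_of_abs_sub_le (by norm_num) (by positivity) h₁ h₂
    linarith
  have close : ∀ N N', sk (w N) = sk (w N') → ∀ u, #(symmDiff (N u) (N' u)) ≤ n / 16 := by
    intro N N' h u
    have h₁ := sdiff_le N N' h u
    have h₂ := sdiff_le N' N h.symm u
    have h₃ : (#(symmDiff (N u) (N' u)) : ℝ) ≤ #(N u \ N' u) + #(N' u \ N u) := by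
      exact_mod_cast Finset.card_union_le _ _
    rw [Nat.le_div_iff_mul_le (by norm_num)]
    have : (#(symmDiff (N u) (N' u)) : ℝ) * 16 ≤ n := by linarith
    exact_mod_cast this
  have count := two_pow_le_card_mul_pow (n / 16) (fun N => sk (w N)) close
  have ball := sq_card_filter_card_le_le_two_pow (R := Fin n) (n / 16)
    (by rw [Fintype.card_fin]; omega)
  simp only [Fintype.card_fin] at count ball
  set K := #{A : Finset (Fin n) | #A ≤ n / 16}
  have hpow : (2 ^ n) ^ (n - 1) ≤ 2 ^ (2 * b) := by
    refine Nat.le_of_mul_le_mul_left ?_ (show 0 < (2 ^ n) ^ (n - 1) by positivity)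
    calc (2 ^ n) ^ (n - 1) * (2 ^ n) ^ (n - 1) = ((2 ^ n) ^ (n - 1)) ^ 2 := (sq _).symm
      _ ≤ (K ^ (n - 1) * 2 ^ b) ^ 2 := Nat.pow_le_pow_left count 2
      _ = (K ^ 2) ^ (n - 1) * 2 ^ (2 * b) := by
          rw [mul_pow, pow_right_comm, pow_right_comm 2 b 2, ← pow_mul 2 2 b]
      _ ≤ (2 ^ n) ^ (n - 1) * 2 ^ (2 * b) :=
          Nat.mul_le_mul_right _ (Nat.pow_le_pow_left ball _)
  rw [← pow_mul, Nat.pow_le_pow_iff_right (by norm_num)] at hpow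
  have hb : (n : ℝ) * (n - 1) ≤ 2 * b := by
    have : ((n * (n - 1) : ℕ) : ℝ) ≤ ((2 * b : ℕ) : ℝ) := by exact_mod_cast hpow
    rw [Nat.cast_mul, Nat.cast_sub (by omega)] at this
    simpa using this
  nlinarith
end

section
/- There is a constant n₀ such that for every n ≥ n₀ the following holds. Fix disjoint sets L, R with |L| = |R| = n and a bijection M : L → R. Then the number of subsets D ⊆ R × L for which the digraph G_D is 8n-balanced is at least 2^{n²/2}. -/
open Finset

/-- The number of edges of the digraph `G_D` (matching edges `(u, M u)` for `u ∈ L`,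
together with the edges in `D`) going from `S` to its complement. -/
def eCount {V : Type} [Fintype V] [DecidableEq V]
    (L : Finset V) (M : V → V) (D : Finset (V × V)) (S : Finset V) : ℕ :=
  (Finset.univ.filter
    (fun p : V × V => ((p.1 ∈ L ∧ p.2 = M p.1) ∨ p ∈ D) ∧ p.1 ∈ S ∧ p.2 ∉ S)).card

/-- `G_D` is `β`-balanced: strongly connected, and every cut has at most `β` times
as many edges in one direction as in the other. -/
def BalancedGD {V : Type} [Fintype V] [DecidableEq V]
    (β : ℝ) (L : Finset V) (M : V → V) (D : Finset (V × V)) : Prop :=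
  (∀ u v : V, Relation.ReflTransGen (fun x y => (x ∈ L ∧ y = M x) ∨ (x, y) ∈ D) u v) ∧
  ∀ S : Finset V, (eCount L M D S : ℝ) ≤ β * (eCount L M D Sᶜ : ℝ)

section HubEdges

variable {V : Type} [DecidableEq V] {L R H S : Finset V} {M : V → V}
  {D : Finset (V × V)}

/-- All edges from `R` into the hub set `H`, and all edges from the partners of `H` into `L`. -/
def hubEdges (L R H : Finset V) (M : V → V) : Finset (V × V) :=
  R ×ˢ H ∪ H.image M ×ˢ L

lemma hubEdges_subset (hH : H ⊆ L) (hM : Set.BijOn M ↑L ↑R) : hubEdges L R H M ⊆ R ×ˢ L := by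
  refine union_subset (product_subset_product_right hH) (product_subset_product_left ?_)
  intro x hx
  obtain ⟨h, hh, rfl⟩ := mem_image.1 hx
  exact hM.mapsTo (hH hh)

lemma card_hubEdges_le (L R H : Finset V) (M : V → V) :
    (hubEdges L R H M).card ≤ (R.card + L.card) * H.card := by
  refine (card_union_le _ _).trans ?_
  rw [card_product, card_product, add_mul, mul_comm L.card]
  exact Nat.add_le_add_left (Nat.mul_le_mul_right _ card_image_le) _

variable [Fintype V]

lemma reflTransGen_of_hubEdges_subset (hLR : L ∪ R = univ) (hM : Set.BijOn M ↑L ↑R)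
    {h : V} (hh : h ∈ H) (hH : H ⊆ L) (hD : hubEdges L R H M ⊆ D) (u v : V) :
    Relation.ReflTransGen (fun x y => (x ∈ L ∧ y = M x) ∨ (x, y) ∈ D) u v := by
  have mem_or (x : V) : x ∈ L ∨ x ∈ R := by simpa [hLR] using mem_union (a := x) (s := L) (t := R)
  have from_R {x : V} (hx : x ∈ R) :
      Relation.ReflTransGen (fun x y => (x ∈ L ∧ y = M x) ∨ (x, y) ∈ D) x h :=
    .single (.inr (hD (mem_union_left _ (mk_mem_product hx hh))))
  have to_hub : Relation.ReflTransGen (fun x y => (x ∈ L ∧ y = M x) ∨ (x, y) ∈ D) u h := by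
    rcases mem_or u with hu | hu
    · exact .head (.inl ⟨hu, rfl⟩) (from_R (hM.mapsTo hu))
    · exact from_R hu
  have to_L {x : V} (hx : x ∈ L) :
      Relation.ReflTransGen (fun x y => (x ∈ L ∧ y = M x) ∨ (x, y) ∈ D) h x :=
    .head (.inl ⟨hH hh, rfl⟩)
      (.single (.inr (hD (mem_union_right _ (mk_mem_product (mem_image_of_mem _ hh) hx)))))
  refine to_hub.trans ?_
  rcases mem_or v with hv | hv
  · exact to_L hv
  · obtain ⟨w, hw, rfl⟩ := hM.surjOn hv
    exact (to_L hw).tail (.inl ⟨hw, rfl⟩)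

lemma eCount_le (hD : D ⊆ R ×ˢ L) :
    eCount L M D S ≤ {u ∈ L | u ∈ S ∧ M u ∉ S}.card + {r ∈ R | r ∈ S}.card *
      {l ∈ L | l ∉ S}.card := by
  have hsub : (univ.filter fun p : V × V =>
      ((p.1 ∈ L ∧ p.2 = M p.1) ∨ p ∈ D) ∧ p.1 ∈ S ∧ p.2 ∉ S) ⊆
      {u ∈ L | u ∈ S ∧ M u ∉ S}.image (fun u => (u, M u)) ∪
        {r ∈ R | r ∈ S} ×ˢ {l ∈ L | l ∉ S} := by
    rintro ⟨x, y⟩ hp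
    obtain ⟨⟨hx, hy⟩ | hxy, hxS, hyS⟩ := (mem_filter.1 hp).2
    · dsimp only at hx hy hxS hyS
      subst hy
      exact mem_union_left _ (mem_image.2 ⟨x, mem_filter.2 ⟨hx, hxS, hyS⟩, rfl⟩)
    · obtain ⟨hx, hy⟩ := mem_product.1 (hD hxy)
      exact mem_union_right _
        (mem_product.2 ⟨mem_filter.2 ⟨hx, hxS⟩, mem_filter.2 ⟨hy, hyS⟩⟩)
  refine (card_le_card hsub).trans ((card_union_le _ _).trans ?_)
  rw [card_product]
  exact Nat.add_le_add_right card_image_le _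

lemma card_matching_le_eCount_compl :
    {u ∈ L | u ∉ S ∧ M u ∈ S}.card ≤ eCount L M D Sᶜ := by
  refine card_le_card_of_injOn (fun u => (u, M u)) ?_ fun x _ y _ hxy => congrArg Prod.fst hxy
  intro u hu
  have := mem_filter.1 hu
  simp [this]

lemma card_le_eCount_compl_of_hub_mem (hD : hubEdges L R H M ⊆ D) {h : V} (hh : h ∈ H)
    (hS : h ∈ S) : {r ∈ R | r ∉ S}.card ≤ eCount L M D Sᶜ := by
  refine card_le_card_of_injOn (fun r => (r, h)) ?_ fun x _ y _ hxy => congrArg Prod.fst hxy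
  intro r hr
  obtain ⟨hrR, hrS⟩ := mem_filter.1 hr
  have : (r, h) ∈ D := hD (mem_union_left _ (mk_mem_product hrR hh))
  simp [this, hrS, hS]

lemma card_le_eCount_compl_of_partner_notMem (hD : hubEdges L R H M ⊆ D) {h : V} (hh : h ∈ H)
    (hS : M h ∉ S) : {l ∈ L | l ∈ S}.card ≤ eCount L M D Sᶜ := by
  refine card_le_card_of_injOn (fun l => (M h, l)) ?_ fun x _ y _ hxy => congrArg Prod.snd hxy
  intro l hl
  obtain ⟨hlL, hlS⟩ := mem_filter.1 hl
  have : (M h, l) ∈ D := hD (mem_union_right _ (mk_mem_product (mem_image_of_mem _ hh) hlL))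
  simp [this, hlS, hS]

lemma eCount_le_mul_eCount_compl {n : ℕ} (hL : L.card = n) (hR : R.card = n)
    (hM : Set.BijOn M ↑L ↑R) (hH : H ⊆ L) (hn : n + 1 ≤ 8 * H.card)
    (hD : hubEdges L R H M ⊆ D) (hDRL : D ⊆ R ×ˢ L) :
    eCount L M D S ≤ 8 * n * eCount L M D Sᶜ := by
  have hout := eCount_le (M := M) (S := S) hDRL
  have hk := card_matching_le_eCount_compl (L := L) (M := M) (S := S) (D := D)
  have hn1 : H.card ≤ n := hL ▸ card_le_card hH
  have ha : {l ∈ L | l ∉ S}.card ≤ n := hL ▸ card_filter_le _ _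
  have hb : {r ∈ R | r ∈ S}.card ≤ n := hR ▸ card_filter_le _ _
  by_cases h₁ : ∃ h ∈ H, h ∈ S
  · obtain ⟨h, hh, hS⟩ := h₁
    have hc := card_le_eCount_compl_of_hub_mem (S := S) hD hh hS
    have hout_c : {u ∈ L | u ∈ S ∧ M u ∉ S}.card ≤ {r ∈ R | r ∉ S}.card := by
      refine card_le_card_of_injOn M (fun u hu => ?_) (hM.injOn.mono fun u hu => ?_)
      · obtain ⟨hu, -, hMu⟩ := mem_filter.1 hu
        exact mem_filter.2 ⟨hM.mapsTo hu, hMu⟩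
      · exact (mem_filter.1 hu).1
    have hsplit : {l ∈ L | l ∉ S}.card ≤
        {r ∈ R | r ∉ S}.card + {u ∈ L | u ∉ S ∧ M u ∈ S}.card := by
      have hle : {l ∈ L | l ∉ S ∧ M l ∉ S}.card ≤ {r ∈ R | r ∉ S}.card := by
        refine card_le_card_of_injOn M (fun u hu => ?_) (hM.injOn.mono fun u hu => ?_)
        · obtain ⟨hu, -, hMu⟩ := mem_filter.1 hu
          exact mem_filter.2 ⟨hM.mapsTo hu, hMu⟩
        · exact (mem_filter.1 hu).1
      have := card_filter_add_card_filter_not (s := {l ∈ L | l ∉ S}) (fun u => M u ∈ S)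
      simp only [filter_filter] at this
      omega
    have hmul := Nat.mul_le_mul hb (hsplit.trans (Nat.add_le_add hc hk))
    have hn0 : 1 ≤ n := by omega
    nlinarith [Nat.mul_le_mul_right (eCount L M D Sᶜ) hn0]
  by_cases h₂ : ∃ h ∈ H, M h ∉ S
  · obtain ⟨h, hh, hS⟩ := h₂
    have hc := card_le_eCount_compl_of_partner_notMem (S := S) hD hh hS
    have hout_a : {u ∈ L | u ∈ S ∧ M u ∉ S}.card ≤ {l ∈ L | l ∈ S}.card :=
      card_le_card (monotone_filter_right _ fun _ _ h => h.1)
    have hsplit : {r ∈ R | r ∈ S}.card ≤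
        {l ∈ L | l ∈ S}.card + {u ∈ L | u ∉ S ∧ M u ∈ S}.card := by
      have hsub : {r ∈ R | r ∈ S} ⊆
          ({l ∈ L | l ∈ S} ∪ {u ∈ L | u ∉ S ∧ M u ∈ S}).image M := by
        intro r hr
        obtain ⟨hrR, hrS⟩ := mem_filter.1 hr
        obtain ⟨u, hu, rfl⟩ := hM.surjOn hrR
        refine mem_image_of_mem _ ?_
        have hu' : u ∈ L := hu
        by_cases huS : u ∈ S <;> simp [hu', huS, hrS]
      exact (card_le_card hsub).trans (card_image_le.trans (card_union_le _ _))
    have hmul := Nat.mul_le_mul (hsplit.trans (Nat.add_le_add hc hk)) ha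
    have hn0 : 1 ≤ n := by omega
    nlinarith [Nat.mul_le_mul_right (eCount L M D Sᶜ) hn0]
  push Not at h₁ h₂
  have hHk : H.card ≤ {u ∈ L | u ∉ S ∧ M u ∈ S}.card :=
    card_le_card fun h hh => mem_filter.2 ⟨hH hh, h₁ h hh, h₂ h hh⟩
  have hout_n : {u ∈ L | u ∈ S ∧ M u ∉ S}.card ≤ n := hL ▸ card_filter_le _ _
  have hmul := Nat.mul_le_mul hb ha
  have he : n + 1 ≤ 8 * eCount L M D Sᶜ := by omega
  nlinarith [Nat.mul_le_mul_left n he]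

end HubEdges

/-- Lemma `gnbeta-size`: for all large enough `n`, at least `2^{n²/2}` of the subsets
`D ⊆ R × L` yield an `8n`-balanced digraph `G_D`. -/
theorem many_balanced_bipartite_graphs :
    ∃ n₀ : ℕ, ∀ n : ℕ, n₀ ≤ n →
      ∀ (V : Type) [Fintype V] [DecidableEq V] (L R : Finset V) (M : V → V),
        Disjoint L R → L ∪ R = Finset.univ → L.card = n → R.card = n →
        Set.BijOn M ↑L ↑R →
        (2 : ℝ) ^ ((n : ℝ) ^ 2 / 2) ≤
          ({D : Finset (V × V) | D ⊆ R ×ˢ L ∧ BalancedGD (8 * n : ℝ) L M D}.ncard : ℝ) := by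
  refine ⟨8, fun n hn V _ _ L R M _ hLR hL hR hM => ?_⟩
  obtain ⟨H, hH, hHcard⟩ := exists_subset_card_eq (s := L) (n := n / 4) (by omega)
  obtain ⟨h, hh⟩ : H.Nonempty := card_pos.1 (by omega)
  have hsub : (↑(Icc (hubEdges L R H M) (R ×ˢ L)) : Set (Finset (V × V))) ⊆
      {D | D ⊆ R ×ˢ L ∧ BalancedGD (8 * n : ℝ) L M D} := by
    intro D hD
    obtain ⟨hD, hDRL⟩ := mem_Icc.1 (mem_coe.1 hD)
    refine ⟨hDRL, reflTransGen_of_hubEdges_subset hLR hM hh hH hD, fun S => ?_⟩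
    exact_mod_cast eCount_le_mul_eCount_compl hL hR hM hH (by omega) hD hDRL
  have hcard := Set.ncard_le_ncard hsub (Set.toFinite _)
  rw [Set.ncard_coe_finset, card_Icc_finset (hubEdges_subset hH hM), card_product, hL, hR] at hcard
  have hhub : (hubEdges L R H M).card ≤ (n + n) * (n / 4) := by
    simpa only [hL, hR, hHcard] using card_hubEdges_le L R H M
  have hexp : n * n ≤ 2 * (n * n - (hubEdges L R H M).card) := by
    have : 4 * (n / 4) ≤ n := Nat.mul_div_le n 4
    have := Nat.mul_le_mul_left n this
    have : (n + n) * (n / 4) * 2 = n * (4 * (n / 4)) := by ring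
    omega
  calc (2 : ℝ) ^ ((n : ℝ) ^ 2 / 2)
      ≤ 2 ^ ((n * n - (hubEdges L R H M).card : ℕ) : ℝ) := by
        refine Real.rpow_le_rpow_of_exponent_le one_le_two ?_
        have : (n : ℝ) * n ≤ 2 * ((n * n - (hubEdges L R H M).card : ℕ) : ℝ) := by
          exact_mod_cast hexp
        linarith [sq (n : ℝ)]
    _ = ((2 ^ (n * n - (hubEdges L R H M).card) : ℕ) : ℝ) := by
        rw [Real.rpow_natCast]
        push_cast
        rfl
    _ ≤ _ := by exact_mod_cast hcard
end

section
/- There is a constant n₀ such that for every n ≥ n₀ the following holds. Fix disjoint sets L, R with |L| = |R| = n. The number of subsets D ⊆ R × L for which there exist A ⊆ L and B ⊆ R with |A| ≥ n/8, |B| ≥ n/8 and |D ∩ (B × A)| < |A|·|B|/4 is at most 2^{n²}/n². Equivalently, a uniformly random D ⊆ R × L satisfies |D ∩ (B × A)| ≥ |A|·|B|/4 for all A ⊆ L, B ⊆ R with |A|, |B| ≥ n/8, with probability at least 1 − 1/n². -/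
open Finset

theorem sum_powerset_pow_card_inter {α : Type*} [DecidableEq α] {S T : Finset α}
    (hST : S ⊆ T) (x : ℝ) :
    ∑ D ∈ T.powerset, x ^ (D ∩ S).card = (1 + x) ^ S.card * 2 ^ (T \ S).card := by
  have h := Finset.prod_one_add (f := fun i => if i ∈ S then x else (1 : ℝ)) T
  have hprod (D : Finset α) : ∏ i ∈ D, (if i ∈ S then x else (1 : ℝ)) = x ^ (D ∩ S).card := by
    rw [Finset.prod_ite_mem, Finset.prod_const]
  simp only [hprod] at h
  rw [← h, ← Finset.prod_sdiff hST, mul_comm]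
  congr 1
  · rw [← Finset.prod_const]
    refine Finset.prod_congr rfl fun i hi => ?_
    rw [if_pos hi]
  · rw [← Finset.prod_const]
    refine Finset.prod_congr rfl fun i hi => ?_
    rw [if_neg (Finset.mem_sdiff.1 hi).2]
    norm_num

/-- Chernoff-type bound for subsets of `T` containing less than a quarter of `S`. -/
theorem card_filter_four_mul_card_inter_lt_le {α : Type*} [DecidableEq α] {S T : Finset α}
    (hST : S ⊆ T) :
    ((T.powerset.filter fun D => 4 * (D ∩ S).card < S.card).card : ℝ) ≤
      2 ^ T.card * (337 / 384) ^ S.card := by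
  have hlow : ((T.powerset.filter fun D => 4 * (D ∩ S).card < S.card).card : ℝ) *
      (3 / 4) ^ S.card ≤ ∑ D ∈ T.powerset, ((3 / 4 : ℝ) ^ 4) ^ (D ∩ S).card := by
    rw [← nsmul_eq_mul, ← Finset.sum_const]
    refine (Finset.sum_le_sum fun D hD => ?_).trans
      (Finset.sum_le_sum_of_subset_of_nonneg (Finset.filter_subset _ _)
        fun _ _ _ => by positivity)
    rw [← pow_mul]
    exact pow_le_pow_of_le_one (by norm_num) (by norm_num) (Finset.mem_filter.1 hD).2.le
  rw [sum_powerset_pow_card_inter hST] at hlow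
  refine le_of_mul_le_mul_right (hlow.trans_eq ?_)
    (by positivity : (0 : ℝ) < (3 / 4) ^ S.card)
  rw [← Finset.card_sdiff_add_card_eq_card hST, pow_add, mul_assoc, mul_assoc, ← mul_pow,
    ← mul_pow, mul_comm]
  norm_num

theorem four_pow_mul_sq_mul_pow_le_one {n m : ℕ} (hm : 24 * n ≤ m) :
    (4 : ℝ) ^ n * n ^ 2 * (337 / 384) ^ m ≤ 1 := by
  have hn : (n : ℝ) ^ 2 ≤ 4 ^ n := by
    have h : (n : ℝ) ≤ 2 ^ n := by exact_mod_cast n.lt_two_pow_self.le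
    calc (n : ℝ) ^ 2 ≤ (2 ^ n) ^ 2 := by gcongr
      _ = 4 ^ n := by rw [← pow_mul, mul_comm, pow_mul]; norm_num
  have hc : (337 / 384 : ℝ) ^ m ≤ (1 / 16) ^ n :=
    calc (337 / 384 : ℝ) ^ m ≤ (337 / 384) ^ (24 * n) :=
          pow_le_pow_of_le_one (by norm_num) (by norm_num) hm
      _ = ((337 / 384) ^ 24) ^ n := pow_mul _ _ _
      _ ≤ (1 / 16) ^ n := pow_le_pow_left₀ (by norm_num) (by norm_num) n
  calc (4 : ℝ) ^ n * n ^ 2 * (337 / 384) ^ m ≤ 4 ^ n * 4 ^ n * (1 / 16) ^ n := by gcongr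
    _ = 1 := by rw [← mul_pow, ← mul_pow]; norm_num

/-- Lemma `rand-largesets`: for all large enough `n`, at most a `1/n²` fraction of the
`2^{n²}` subsets `D ⊆ R × L` admit large sets `A ⊆ L`, `B ⊆ R` (of size at least `n/8`)
with fewer than `|A|·|B|/4` edges of `D` from `B` to `A`. -/
theorem few_sparse_large_pair_subsets :
    ∃ n₀ : ℕ, ∀ n : ℕ, n₀ ≤ n →
      ∀ (V : Type) [Fintype V] [DecidableEq V] (L R : Finset V),
        Disjoint L R → L.card = n → R.card = n →
        ({D : Finset (V × V) | D ⊆ R ×ˢ L ∧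
            ∃ A ⊆ L, ∃ B ⊆ R,
              (n : ℝ) / 8 ≤ (A.card : ℝ) ∧ (n : ℝ) / 8 ≤ (B.card : ℝ) ∧
              ((D ∩ (B ×ˢ A)).card : ℝ) < (A.card : ℝ) * (B.card : ℝ) / 4}.ncard : ℝ) ≤
          (2 : ℝ) ^ (n ^ 2) / (n : ℝ) ^ 2 := by
  refine ⟨1536, fun n hn V _ _ L R _ hL hR => ?_⟩
  have hn0 : (0 : ℝ) < n := by exact_mod_cast (by omega : 0 < n)
  have hnR : (1536 : ℝ) ≤ n := by exact_mod_cast hn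
  let P := (L.powerset ×ˢ R.powerset).filter fun p => 24 * n ≤ (p.2 ×ˢ p.1).card
  let F : Finset V × Finset V → Finset (Finset (V × V)) := fun p =>
    (R ×ˢ L).powerset.filter fun D => 4 * (D ∩ (p.2 ×ˢ p.1)).card < (p.2 ×ˢ p.1).card
  have hP : (P.card : ℝ) ≤ 4 ^ n := by
    have h : P.card ≤ 4 ^ n := by
      refine (Finset.card_filter_le _ _).trans_eq ?_
      rw [Finset.card_product, Finset.card_powerset, Finset.card_powerset, hL, hR, ← mul_pow]
      norm_num
    exact_mod_cast h
  have hF : ∀ p ∈ P, ((F p).card : ℝ) ≤ 2 ^ (n ^ 2) / (4 ^ n * n ^ 2) := by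
    intro p hp
    obtain ⟨hp, hm⟩ := Finset.mem_filter.1 hp
    obtain ⟨hA, hB⟩ := Finset.mem_product.1 hp
    have h := card_filter_four_mul_card_inter_lt_le
      (Finset.product_subset_product (Finset.mem_powerset.1 hB) (Finset.mem_powerset.1 hA))
    rw [Finset.card_product R L, hL, hR, ← sq] at h
    refine h.trans ?_
    rw [le_div_iff₀ (by positivity), mul_assoc]
    refine mul_le_of_le_one_right (by positivity) ?_
    rw [mul_comm]
    exact four_pow_mul_sq_mul_pow_le_one hm
  have hsub : {D : Finset (V × V) | D ⊆ R ×ˢ L ∧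
      ∃ A ⊆ L, ∃ B ⊆ R,
        (n : ℝ) / 8 ≤ (A.card : ℝ) ∧ (n : ℝ) / 8 ≤ (B.card : ℝ) ∧
        ((D ∩ (B ×ˢ A)).card : ℝ) < (A.card : ℝ) * (B.card : ℝ) / 4} ⊆ ↑(P.biUnion F) := by
    rintro D ⟨hD, A, hA, B, hB, hAn, hBn, hlt⟩
    refine Finset.mem_coe.2 (Finset.mem_biUnion.2 ⟨(A, B), ?_, ?_⟩)
    · refine Finset.mem_filter.2 ⟨Finset.mem_product.2
        ⟨Finset.mem_powerset.2 hA, Finset.mem_powerset.2 hB⟩, ?_⟩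
      have hAB : (n : ℝ) / 8 * (n / 8) ≤ B.card * A.card := by gcongr
      have h : (24 * n : ℝ) ≤ B.card * A.card := by nlinarith
      rw [Finset.card_product]
      exact_mod_cast h
    · refine Finset.mem_filter.2 ⟨Finset.mem_powerset.2 hD, ?_⟩
      have h : (4 * (D ∩ (B ×ˢ A)).card : ℝ) < B.card * A.card := by linarith
      rw [Finset.card_product]
      exact_mod_cast h
  have hcard := Set.ncard_le_ncard hsub (Finset.finite_toSet _)
  rw [Set.ncard_coe_finset] at hcard
  calc _ ≤ ((P.biUnion F).card : ℝ) := by exact_mod_cast hcard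
    _ ≤ ∑ p ∈ P, ((F p).card : ℝ) := by exact_mod_cast Finset.card_biUnion_le
    _ ≤ P.card • ((2 : ℝ) ^ (n ^ 2) / (4 ^ n * n ^ 2)) := Finset.sum_le_card_nsmul _ _ _ hF
    _ ≤ 4 ^ n * ((2 : ℝ) ^ (n ^ 2) / (4 ^ n * n ^ 2)) := by
      rw [nsmul_eq_mul]
      gcongr
    _ = 2 ^ (n ^ 2) / n ^ 2 := by field_simp
end

section
/- There is a universal constant ε₀ > 0 such that for every 0 < ε ≤ ε₀ and every n ≥ 1 the following holds. Fix disjoint sets L, R with |L| = |R| = n and a bijection M : L → R. For every D ⊆ R × L, the number of subsets D' ⊆ R × L such that G_{D'} is a (1±3ε)-cut sparsifier of G_D is at most 2^{n²/4}. -/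
open Finset

/-- The sets of size at most `|U| / 48` form a fraction of the power set of `U` that is small enough
to number at most `2 ^ (|U| / 4)`; this is the Chernoff bound with weight `1 / 8`. -/
theorem card_filter_powerset_le_two_rpow {α : Type*} [DecidableEq α] (U : Finset α) :
    ((U.powerset.filter (fun T => (T.card : ℝ) ≤ U.card / 48)).card : ℝ) ≤
      (2 : ℝ) ^ ((U.card : ℝ) / 4) := by
  set N : ℝ := (U.card : ℝ) with hN
  have hsum : ∑ T ∈ U.powerset, (1 / 8 : ℝ) ^ T.card = (9 / 8 : ℝ) ^ U.card := by
    have h := Finset.sum_pow_mul_eq_add_pow (1 / 8 : ℝ) 1 U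
    norm_num at h ⊢
    exact h
  have hterm : ∀ T ∈ U.powerset.filter (fun T => (T.card : ℝ) ≤ N / 48),
      (2 : ℝ) ^ (-(N / 16)) ≤ (1 / 8 : ℝ) ^ T.card := by
    intro T hT
    have hT' := (mem_filter.mp hT).2
    have h8 : (1 / 8 : ℝ) ^ T.card = (2 : ℝ) ^ (-(3 * (T.card : ℝ))) := by
      rw [Real.rpow_neg zero_le_two, Real.rpow_mul zero_le_two, Real.rpow_natCast, one_div,
        inv_pow]
      norm_num
    rw [h8]
    exact Real.rpow_le_rpow_of_exponent_le one_le_two (by linarith)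
  have hcard : ((U.powerset.filter (fun T => (T.card : ℝ) ≤ N / 48)).card : ℝ) *
      (2 : ℝ) ^ (-(N / 16)) ≤ (9 / 8 : ℝ) ^ U.card := by
    rw [← nsmul_eq_mul, ← hsum]
    exact (card_nsmul_le_sum _ _ _ hterm).trans
      (sum_le_sum_of_subset_of_nonneg (filter_subset _ _) fun _ _ _ => by positivity)
  have hbase : (9 / 8 : ℝ) ≤ (2 : ℝ) ^ (3 / 16 : ℝ) := by
    refine le_of_pow_le_pow_left₀ (n := 16) (by norm_num) (by positivity) ?_
    rw [← Real.rpow_natCast ((2 : ℝ) ^ (3 / 16 : ℝ)), ← Real.rpow_mul zero_le_two]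
    norm_num
  have hpow : (9 / 8 : ℝ) ^ U.card ≤ (2 : ℝ) ^ (3 / 16 * N) := by
    rw [Real.rpow_mul zero_le_two, hN, Real.rpow_natCast]
    exact pow_le_pow_left₀ (by norm_num) hbase _
  calc _ = ((U.powerset.filter (fun T => (T.card : ℝ) ≤ N / 48)).card : ℝ) *
        (2 : ℝ) ^ (-(N / 16)) * (2 : ℝ) ^ (N / 16) := by
        rw [mul_assoc, ← Real.rpow_add zero_lt_two]; simp
    _ ≤ (2 : ℝ) ^ (3 / 16 * N) * (2 : ℝ) ^ (N / 16) := by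
        gcongr
        exact hcard.trans hpow
    _ = (2 : ℝ) ^ (N / 4) := by
        rw [← Real.rpow_add zero_lt_two]
        ring_nf

section Cuts

variable {V : Type} [Fintype V] [DecidableEq V] {L R : Finset V} {M : V → V}
  {D D' : Finset (V × V)} {A : Finset V} {j : V}

/-- The cut around `{j} ∪ (L \ A)` consists of matching edges, whose number does not depend on `D`,
and the edges of `D` from `j` to `A`. -/
theorem eCount_insert_sdiff (hLR : Disjoint L R) (hM : Set.MapsTo M ↑L ↑R)
    (hD : D ⊆ R ×ˢ L) (hj : j ∈ R) :
    eCount L M D (insert j (L \ A)) =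
      ((L \ A).filter (fun u => M u ≠ j)).card + (D ∩ ({j} ×ˢ A)).card := by
  have hdisj : ∀ x ∈ L, x ∉ R := fun x hx hx' => disjoint_left.mp hLR hx hx'
  have hMR : ∀ u ∈ L, M u ∈ R := fun u hu => hM hu
  have hDR : ∀ p ∈ D, p.1 ∈ R ∧ p.2 ∈ L := fun p hp => mem_product.mp (hD hp)
  rw [← card_image_of_injective ((L \ A).filter (fun u => M u ≠ j)) (f := fun u => (u, M u))
    (fun a b h => congrArg Prod.fst h), ← card_union_of_disjoint]
  · unfold eCount
    congr 1
    ext ⟨a, b⟩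
    simp only [mem_filter, mem_univ, true_and, mem_union, mem_image, mem_inter, mem_product,
      mem_singleton, mem_insert, mem_sdiff, Prod.mk.injEq]
    constructor
    · rintro ⟨⟨ha, rfl⟩ | hab, h1, h2⟩
      · grind
      · have := hDR _ hab
        grind
    · rintro (⟨u, hu, rfl, rfl⟩ | ⟨hab, rfl, hb⟩)
      · grind
      · have := hDR _ hab
        grind
  · rw [disjoint_left]
    rintro ⟨a, b⟩ h1 h2
    simp only [mem_image, mem_filter, mem_sdiff, Prod.mk.injEq] at h1
    obtain ⟨u, hu, rfl, rfl⟩ := h1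
    have := hDR _ (mem_inter.mp h2).1
    grind

theorem eCount_insert_sdiff_le (hLR : Disjoint L R) (hM : Set.MapsTo M ↑L ↑R)
    (hD : D ⊆ R ×ˢ L) (hA : A ⊆ L) (hj : j ∈ R) :
    eCount L M D (insert j (L \ A)) ≤ L.card := by
  rw [eCount_insert_sdiff hLR hM hD hj, ← card_sdiff_add_card_eq_card hA]
  gcongr
  · exact filter_subset _ _
  · exact (card_le_card inter_subset_right).trans (by simp)

/-- Two graphs whose cuts agree up to a factor `1 ± δ` have neighbourhoods of `j ∈ R` that differ in
at most `2 δ |L|` vertices. -/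
theorem card_symmDiff_fiber_le {δ : ℝ} (hδ : 0 ≤ δ) (hLR : Disjoint L R)
    (hM : Set.MapsTo M ↑L ↑R) (hD : D ⊆ R ×ˢ L) (hD' : D' ⊆ R ×ˢ L)
    (h : ∀ S : Finset V, (1 - δ) * (eCount L M D S : ℝ) ≤ (eCount L M D' S : ℝ) ∧
      (eCount L M D' S : ℝ) ≤ (1 + δ) * (eCount L M D S : ℝ)) (hj : j ∈ R) :
    (((symmDiff D D').filter (fun p => p.1 = j)).card : ℝ) ≤ 2 * δ * L.card := by
  have key : ∀ A ⊆ L,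
      |((D' ∩ ({j} ×ˢ A)).card : ℝ) - ((D ∩ ({j} ×ˢ A)).card : ℝ)| ≤ δ * L.card := by
    intro A hA
    have hle : δ * (eCount L M D (insert j (L \ A)) : ℝ) ≤ δ * L.card := by
      gcongr
      exact eCount_insert_sdiff_le hLR hM hD hA hj
    obtain ⟨h1, h2⟩ := h (insert j (L \ A))
    rw [eCount_insert_sdiff hLR hM hD hj] at h1 h2 hle
    rw [eCount_insert_sdiff hLR hM hD' hj] at h1 h2
    push_cast at h1 h2 hle
    rw [abs_le]
    constructor <;> linarith
  have hDR : ∀ p ∈ D, p.1 ∈ R ∧ p.2 ∈ L := fun p hp => mem_product.mp (hD hp)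
  have hDR' : ∀ p ∈ D', p.1 ∈ R ∧ p.2 ∈ L := fun p hp => mem_product.mp (hD' hp)
  have hnew := (abs_le.mp (key (L.filter (fun u => (j, u) ∉ D)) (filter_subset _ _))).2
  have hold := (abs_le.mp (key (L.filter (fun u => (j, u) ∈ D)) (filter_subset _ _))).1
  have hempty : D ∩ ({j} ×ˢ L.filter (fun u => (j, u) ∉ D)) = ∅ := by
    ext ⟨a, b⟩
    simp only [mem_inter, mem_product, mem_singleton, mem_filter, notMem_empty]
    grind
  have hsub : D' ∩ ({j} ×ˢ L.filter (fun u => (j, u) ∈ D)) ⊆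
      D ∩ ({j} ×ˢ L.filter (fun u => (j, u) ∈ D)) := by
    rintro ⟨a, b⟩
    simp only [mem_inter, mem_product, mem_singleton, mem_filter]
    grind
  have hunion : (symmDiff D D').filter (fun p => p.1 = j) ⊆
      (D ∩ ({j} ×ˢ L.filter (fun u => (j, u) ∈ D))) \
        (D' ∩ ({j} ×ˢ L.filter (fun u => (j, u) ∈ D))) ∪
      D' ∩ ({j} ×ˢ L.filter (fun u => (j, u) ∉ D)) := by
    rintro ⟨a, b⟩ hab
    have h1 := hDR (a, b)
    have h2 := hDR' (a, b)
    simp only [mem_union, mem_sdiff, mem_inter, mem_product, mem_singleton, mem_filter,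
      mem_symmDiff] at hab ⊢
    grind
  have hcard : (((symmDiff D D').filter (fun p => p.1 = j)).card : ℝ) ≤ _ :=
    Nat.cast_le.mpr ((card_le_card hunion).trans (card_union_le _ _))
  have hsplit := card_sdiff_add_card_eq_card hsub
  rw [hempty] at hnew
  rw [← hsplit] at hold
  push_cast at hcard hold
  simp only [card_empty, Nat.cast_zero] at hnew
  linarith

theorem card_symmDiff_le {δ : ℝ} (hδ : 0 ≤ δ) (hLR : Disjoint L R)
    (hM : Set.MapsTo M ↑L ↑R) (hD : D ⊆ R ×ˢ L) (hD' : D' ⊆ R ×ˢ L)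
    (h : ∀ S : Finset V, (1 - δ) * (eCount L M D S : ℝ) ≤ (eCount L M D' S : ℝ) ∧
      (eCount L M D' S : ℝ) ≤ (1 + δ) * (eCount L M D S : ℝ)) :
    ((symmDiff D D').card : ℝ) ≤ 2 * δ * (R ×ˢ L).card := by
  have hmaps : ∀ p ∈ symmDiff D D', p.1 ∈ R := by
    intro p hp
    rcases mem_symmDiff.mp hp with hp | hp
    · exact (mem_product.mp (hD hp.1)).1
    · exact (mem_product.mp (hD' hp.1)).1
  rw [card_eq_sum_card_fiberwise hmaps, card_product]
  push_cast
  refine (sum_le_card_nsmul R _ _ fun j hj =>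
    card_symmDiff_fiber_le hδ hLR hM hD hD' h hj).trans_eq ?_
  rw [nsmul_eq_mul]
  ring

end Cuts

/-- Lemma `encode-H`: for sufficiently small `ε > 0` and every `D ⊆ R × L`, the number
of `D' ⊆ R × L` such that `G_{D'}` is a `(1 ± 3ε)`-cut sparsifier of `G_D` is at most
`2^{n²/4}`. -/
theorem few_cut_sparsifiers_of_bipartite_graph :
    ∃ ε₀ : ℝ, 0 < ε₀ ∧
      ∀ ε : ℝ, 0 < ε → ε ≤ ε₀ →
        ∀ n : ℕ, 1 ≤ n →
          ∀ (V : Type) [Fintype V] [DecidableEq V] (L R : Finset V) (M : V → V),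
            Disjoint L R → L ∪ R = Finset.univ → L.card = n → R.card = n →
            Set.BijOn M ↑L ↑R →
            ∀ D : Finset (V × V), D ⊆ R ×ˢ L →
              ({D' : Finset (V × V) | D' ⊆ R ×ˢ L ∧
                  ∀ S : Finset V,
                    (1 - 3 * ε) * (eCount L M D S : ℝ) ≤ (eCount L M D' S : ℝ) ∧
                    (eCount L M D' S : ℝ) ≤ (1 + 3 * ε) * (eCount L M D S : ℝ)}.ncard : ℝ) ≤
                (2 : ℝ) ^ ((n : ℝ) ^ 2 / 4) := by
  refine ⟨1 / 288, by norm_num, ?_⟩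
  intro ε hε hε₀ n _ V _ _ L R M hLR _ hL hR hM D hD
  have hU : ((R ×ˢ L).card : ℝ) = (n : ℝ) ^ 2 := by
    rw [card_product, hL, hR]
    push_cast
    ring
  rw [← hU]
  refine le_trans (Nat.cast_le.mpr ?_) (card_filter_powerset_le_two_rpow (R ×ˢ L))
  rw [← Set.ncard_coe_finset]
  refine Set.ncard_le_ncard_of_injOn (fun D' => symmDiff D D') ?_
    (symmDiff_right_injective D).injOn (Finset.finite_toSet _)
  rintro D' ⟨hD', h⟩
  rw [mem_coe, mem_filter, mem_powerset]
  refine ⟨symmDiff_le_sup.trans (union_subset hD hD'), ?_⟩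
  refine (card_symmDiff_le (by positivity) hLR hM.mapsTo hD hD' h).trans ?_
  have hN : (0 : ℝ) ≤ (R ×ˢ L).card := Nat.cast_nonneg _
  nlinarith
end

section
/- For every real a ≥ 1 there is a constant C = C(a) > 0 such that for every finite set V with |V| = n ≥ 2, every β ≥ 1, and every 0 < ε < 1, there exists a (1±ε) for-each cut sketch scheme of b bits for the class of β-balanced weighted digraphs on V whose positive edge weights all lie in [1, n^a], with b ≤ C·√β·n·(log n)³/ε. Explicitly: there exist a finite type Ω with a probability mass function μ, functions sk : (V × V → ℝ) → Ω → Fin(2^b), and f : Set V → Fin(2^b) → ℝ such that for every such graph w and every S ⊆ V, μ{ω : |f(S)(sk(w)(ω)) − w(S,S̄)| ≤ ε·w(S,S̄)} ≥ 2/3. -/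
open Finset

namespace CutSketch

section SecondMoment

variable {K : Type} [Fintype K] [DecidableEq K] {R : K → Type} [∀ k, Fintype (R k)]

lemma sum_pi_apply_mul_apply_eq_zero {k l : K} (hkl : k ≠ l) (g : R k → ℝ) (h : R l → ℝ)
    (hg : ∑ r, g r = 0) : ∑ ω : ∀ k, R k, g (ω k) * h (ω l) = 0 := by
  rw [← (Equiv.piSplitAt k R).symm.sum_comp, Fintype.sum_prod_type, Finset.sum_comm]
  refine Finset.sum_eq_zero fun ω' _ => ?_
  simp only [Equiv.piSplitAt_symm_apply, dite_true, hkl.symm, dite_false]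
  rw [← Finset.sum_mul]
  simp [hg]

lemma card_mul_sum_pi_apply (k : K) (g : R k → ℝ) :
    (Fintype.card (R k) : ℝ) * ∑ ω : ∀ k, R k, g (ω k) =
      Fintype.card (∀ k, R k) * ∑ r, g r := by
  rw [← (Equiv.piSplitAt k R).symm.sum_comp, Fintype.card_congr (Equiv.piSplitAt k R),
    Fintype.card_prod, Fintype.sum_prod_type]
  simp only [Equiv.piSplitAt_symm_apply, dite_true, Finset.sum_const, Finset.card_univ,
    nsmul_eq_mul, ← Finset.mul_sum]
  push_cast
  simp [mul_assoc]

/-- Second moment of a sum of independent centred random variables, where the variables are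
functions of distinct coordinates of a uniformly random point of a finite product. -/
lemma sum_sq_sum_apply_le [∀ k, Nonempty (R k)] {I : Type} [Fintype I]
    {φ : I → K} (hφ : Function.Injective φ) (g : ∀ i, R (φ i) → ℝ) (v : I → ℝ)
    (hg : ∀ i, ∑ r, g i r = 0) (hv : ∀ i, ∑ r, g i r ^ 2 ≤ Fintype.card (R (φ i)) * v i) :
    ∑ ω : ∀ k, R k, (∑ i, g i (ω (φ i))) ^ 2 ≤ Fintype.card (∀ k, R k) * ∑ i, v i := by
  classical
  have key : ∑ ω : ∀ k, R k, (∑ i, g i (ω (φ i))) ^ 2 =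
      ∑ i, ∑ ω : ∀ k, R k, g i (ω (φ i)) ^ 2 := by
    simp_rw [sq, Finset.sum_mul_sum]
    rw [Finset.sum_comm]
    refine Finset.sum_congr rfl fun i _ => ?_
    rw [Finset.sum_comm]
    refine Finset.sum_eq_single i (fun j _ hj => ?_) (by simp)
    exact sum_pi_apply_mul_apply_eq_zero (fun h => hj (hφ h).symm) _ _ (hg i)
  rw [key, Finset.mul_sum]
  refine Finset.sum_le_sum fun i _ => ?_
  have h1 := card_mul_sum_pi_apply (R := R) (φ i) (fun r => g i r ^ 2)
  have hpos : (0 : ℝ) < Fintype.card (R (φ i)) := by exact_mod_cast Fintype.card_pos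
  refine le_of_mul_le_mul_left ?_ hpos
  rw [h1]
  have := mul_le_mul_of_nonneg_left (hv i) (Nat.cast_nonneg (α := ℝ) (Fintype.card (∀ k, R k)))
  linarith

end SecondMoment

open scoped Classical in
/-- Chebyshev's inequality under the uniform distribution on a finite type. -/
lemma two_mul_card_le_of_sum_sq_le {Ω : Type} [Fintype Ω] (D : Ω → ℝ) {v t : ℝ} (ht : 0 ≤ t)
    (hD : ∑ ω, D ω ^ 2 ≤ Fintype.card Ω * v) (hv : 3 * v ≤ t ^ 2) :
    2 * Fintype.card Ω ≤ 3 * #{ω | |D ω| ≤ t} := by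
  have hsplit := Finset.card_filter_add_card_filter_not (s := (Finset.univ : Finset Ω))
    (fun ω => |D ω| ≤ t)
  rw [Finset.card_univ] at hsplit
  suffices h : 3 * #{ω | ¬ |D ω| ≤ t} ≤ Fintype.card Ω by omega
  have hsub : ∑ ω with ¬ |D ω| ≤ t, D ω ^ 2 ≤ ∑ ω, D ω ^ 2 :=
    Finset.sum_le_sum_of_subset_of_nonneg (Finset.filter_subset _ _) fun _ _ _ => sq_nonneg _
  have hcard : (0 : ℝ) ≤ Fintype.card Ω := Nat.cast_nonneg _
  rcases ht.eq_or_lt with rfl | ht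
  · have h0 : ∑ ω, D ω ^ 2 ≤ 0 := hD.trans (by nlinarith)
    have hz : ∀ ω, D ω = 0 := fun ω => by
      have := Finset.single_le_sum (fun ω _ => sq_nonneg (D ω)) (Finset.mem_univ ω)
      nlinarith [sq_nonneg (D ω)]
    simp [hz]
  · have hlow : #{ω | ¬ |D ω| ≤ t} * t ^ 2 ≤ ∑ ω with ¬ |D ω| ≤ t, D ω ^ 2 := by
      rw [← nsmul_eq_mul]
      refine Finset.card_nsmul_le_sum _ _ _ fun ω hω => ?_
      have : t < |D ω| := by simpa using hω
      rw [← sq_abs (D ω)]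
      gcongr
    have hmul : (3 * #{ω | ¬ |D ω| ≤ t} : ℝ) * t ^ 2 ≤ Fintype.card Ω * t ^ 2 := by nlinarith
    exact_mod_cast le_of_mul_le_mul_right hmul (by positivity)

lemma two_thirds_le_uniform {Ω : Type} [Fintype Ω] [Nonempty Ω] (P : Ω → Prop)
    [DecidablePred P] (h : 2 * Fintype.card Ω ≤ 3 * #{ω | P ω}) :
    (2 / 3 : ENNReal) ≤ (PMF.uniformOfFintype Ω).toOuterMeasure {ω | P ω} := by
  rw [PMF.toOuterMeasure_uniformOfFintype_apply]
  have hc : Fintype.card {ω | P ω} = #{ω | P ω} := Fintype.card_subtype _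
  have hpos : (Fintype.card Ω : ENNReal) ≠ 0 := by exact_mod_cast Fintype.card_ne_zero
  rw [ENNReal.le_div_iff_mul_le (Or.inl hpos) (Or.inl (ENNReal.natCast_ne_top _)),
    ENNReal.div_eq_inv_mul, mul_assoc, ENNReal.inv_mul_le_iff (by norm_num) (by norm_num)]
  rw [← hc] at h
  exact_mod_cast h

section Decomposition

open scoped Classical in
/-- Every directed graph can be partitioned, by deleting few edges, into parts in which every
set of at most half of the vertices is left or entered by many edges. -/
lemma exists_sparse_partition {V : Type} [Fintype V] (E : Finset (V × V)) (τ : ℕ) :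
    ∃ c : V → Option V,
      (#{p ∈ E | c p.1 ≠ c p.2} : ℝ) ≤
        τ * (Fintype.card V * Real.logb 2 (Fintype.card V)) ∧
      ∀ (l : Option V) (A : Finset V), (∀ v ∈ A, c v = l) → 2 * #A ≤ #{v | c v = l} →
        τ * #A ≤ #{p ∈ E | c p.1 = l ∧ c p.2 = l ∧ ¬(p.1 ∈ A ↔ p.2 ∈ A)} := by
  let Φ : (V → Option V) → ℝ := fun c =>
    #{p ∈ E | c p.1 ≠ c p.2} + τ * ∑ v, Real.logb 2 #{u | c u = c v}
  obtain ⟨c, hc⟩ := Finite.exists_min Φ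
  have hlog : ∀ (c : V → Option V) (v : V), 0 ≤ Real.logb 2 #{u | c u = c v} := fun c v => by
    refine Real.logb_nonneg one_lt_two ?_
    exact_mod_cast Finset.card_pos.mpr ⟨v, by simp⟩
  refine ⟨c, ?_, ?_⟩
  · have h := hc fun _ => none
    have h1 : 0 ≤ (τ : ℝ) * ∑ v, Real.logb 2 #{u | c u = c v} :=
      mul_nonneg (Nat.cast_nonneg _) (Finset.sum_nonneg fun v _ => hlog c v)
    simp only [Φ, ne_eq, not_true_eq_false, Finset.filter_false, Finset.card_empty,
      Finset.filter_true, Finset.sum_const, Finset.card_univ, nsmul_eq_mul] at h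
    push_cast at h
    simp only [ne_eq]
    linarith
  · intro l A hA hhalf
    by_contra hlt
    rw [not_le] at hlt
    have hApos : 0 < #A := Nat.pos_of_ne_zero fun h => by simp [h] at hlt
    have hτ : 0 < τ := Nat.pos_of_ne_zero fun h => by simp [h] at hlt
    obtain ⟨f, hf⟩ : ∃ f : Option V, ∀ v, c v ≠ f := by
      by_contra! hsurj
      have := Fintype.card_le_of_surjective c hsurj
      simp at this
    let c' : V → Option V := fun v => if v ∈ A then f else c v
    have hcross : #{p ∈ E | c' p.1 ≠ c' p.2} ≤ #{p ∈ E | c p.1 ≠ c p.2} +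
        #{p ∈ E | c p.1 = l ∧ c p.2 = l ∧ ¬(p.1 ∈ A ↔ p.2 ∈ A)} := by
      refine (Finset.card_le_card fun p hp => ?_).trans (Finset.card_union_le _ _)
      simp only [Finset.mem_filter, Finset.mem_union, c'] at hp ⊢
      have h1 := hA p.1
      have h2 := hA p.2
      by_cases hp1 : p.1 ∈ A <;> by_cases hp2 : p.2 ∈ A <;> simp_all
      all_goals
        by_cases h : c p.1 = c p.2 <;> simp_all
    have hpoint : ∀ v, Real.logb 2 #{u | c' u = c' v} + (if v ∈ A then 1 else 0) ≤
        Real.logb 2 #{u | c u = c v} := fun v => by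
      by_cases hv : v ∈ A
      · have hsub : #{u | c' u = c' v} ≤ #A := Finset.card_le_card fun u hu => by
          by_contra hu'
          have := hf u
          simp_all [c']
        have hpos : 0 < #{u | c' u = c' v} := Finset.card_pos.mpr ⟨v, by rw [Finset.mem_filter]; simp⟩
        rw [hA v hv, if_pos hv]
        have h2 : (2 : ℝ) * #{u | c' u = c' v} ≤ #{u | c u = l} := by
          exact_mod_cast (Nat.mul_le_mul_left 2 hsub).trans hhalf
        have hpos' : (0 : ℝ) < #{u | c' u = c' v} := by exact_mod_cast hpos
        have h3 : Real.logb 2 (2 * #{u | c' u = c' v}) =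
            1 + Real.logb 2 #{u | c' u = c' v} := by
          rw [Real.logb_mul (by norm_num) hpos'.ne', Real.logb_self_eq_one one_lt_two]
        have h4 := Real.logb_le_logb_of_le one_lt_two (mul_pos two_pos hpos') h2
        linarith
      · have hsub : #{u | c' u = c' v} ≤ #{u | c u = c v} := Finset.card_le_card fun u hu => by
          rw [Finset.mem_filter] at hu ⊢
          by_cases hu' : u ∈ A
          · have h : c' u = c' v := hu.2
            simp only [c', if_pos hu', if_neg hv] at h
            exact absurd h.symm (hf v)
          · have h : c' u = c' v := hu.2
            simp only [c', if_neg hu', if_neg hv] at h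
            exact ⟨hu.1, h⟩
        have hpos : 0 < #{u | c' u = c' v} := Finset.card_pos.mpr ⟨v, by rw [Finset.mem_filter]; simp⟩
        rw [if_neg hv, add_zero]
        exact Real.logb_le_logb_of_le one_lt_two (by exact_mod_cast hpos)
          (by exact_mod_cast hsub)
    have hsum := Finset.sum_le_sum fun v (_ : v ∈ Finset.univ) => hpoint v
    rw [Finset.sum_add_distrib, Finset.sum_boole] at hsum
    simp only [Finset.filter_univ_mem] at hsum
    have hmin := hc c'
    simp only [Φ] at hmin
    have hcross' : (#{p ∈ E | c' p.1 ≠ c' p.2} : ℝ) ≤ #{p ∈ E | c p.1 ≠ c p.2} +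
        #{p ∈ E | c p.1 = l ∧ c p.2 = l ∧ ¬(p.1 ∈ A ↔ p.2 ∈ A)} := by exact_mod_cast hcross
    have hlt' : (#{p ∈ E | c p.1 = l ∧ c p.2 = l ∧ ¬(p.1 ∈ A ↔ p.2 ∈ A)} : ℝ) < τ * #A := by
      rw [← Nat.cast_mul]
      exact Nat.cast_lt.mpr hlt
    have hτ' : (0 : ℝ) < τ := by exact_mod_cast hτ
    have := mul_le_mul_of_nonneg_left hsum hτ'.le
    linarith

end Decomposition

section Query

open scoped Classical

variable {V : Type} [Fintype V]

/-- `v` lies on the smaller side of the split of its part of the partition `c` into the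
vertices inside and outside `S`. -/
def Minor (c : V → Option V) (S : Set V) (v : V) : Prop :=
  if v ∈ S then 2 * #{u | c u = c v ∧ u ∈ S} ≤ #{u | c u = c v}
  else #{u | c u = c v} < 2 * #{u | c u = c v ∧ u ∈ S}

/-- The out-neighbours (`b = true`) or in-neighbours (`b = false`) of `v` in its own part. -/
noncomputable def nbrs (E : Finset (V × V)) (c : V → Option V) (v : V) (b : Bool) : Finset V :=
  {x | (if b then (v, x) ∈ E else (x, v) ∈ E) ∧ c x = c v}

/-- The number of edges of `E` that leave `S`. -/
noncomputable def outCard (E : Finset (V × V)) (S : Set V) : ℕ :=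
  #{p ∈ E | p.1 ∈ S ∧ p.2 ∉ S}

/-- The number of edges of `E` that leave or enter `S`. -/
noncomputable def bdCard (E : Finset (V × V)) (S : Set V) : ℕ :=
  #{p ∈ E | ¬(p.1 ∈ S ↔ p.2 ∈ S)}

/-- The number of edges of `E` between `v` and the other side of the cut `S` inside the part of
`v`, counted in the direction from `S` to its complement. -/
noncomputable def oppCard (E : Finset (V × V)) (c : V → Option V) (S : Set V) (v : V) : ℕ :=
  #{x ∈ nbrs E c v (decide (v ∈ S)) | ¬(x ∈ S ↔ v ∈ S)}

lemma outCard_eq (E : Finset (V × V)) (c : V → Option V) (S : Set V) :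
    outCard E S = outCard {p ∈ E | c p.1 ≠ c p.2} S +
      ∑ v, if Minor c S v then oppCard E c S v else 0 := by
  have h1 : ∀ v, (if Minor c S v then oppCard E c S v else 0) =
      (∑ x, if (v, x) ∈ E ∧ c x = c v ∧ v ∈ S ∧ x ∉ S ∧ Minor c S v then 1 else 0) +
      ∑ x, if (x, v) ∈ E ∧ c x = c v ∧ v ∉ S ∧ x ∈ S ∧ Minor c S v then 1 else 0 := fun v => by
    by_cases hm : Minor c S v <;> by_cases hv : v ∈ S <;>
      simp [hm, hv, oppCard, nbrs, Finset.filter_filter, and_assoc]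
  have h2 : ∀ E' : Finset (V × V), outCard E' S =
      ∑ u, ∑ x, if (u, x) ∈ E' ∧ u ∈ S ∧ x ∉ S then 1 else 0 := fun E' => by
    rw [outCard, ← Fintype.sum_prod_type', Finset.sum_boole, Nat.cast_id]
    congr 1
    ext p
    simp
  have h3 : ∀ u x, c u = c x → u ∈ S → x ∉ S → (Minor c S u ↔ ¬ Minor c S x) :=
    fun u x hux hu hx => by simp [Minor, hu, hx, hux]
  simp_rw [h1, Finset.sum_add_distrib]
  rw [Finset.sum_comm (f := fun v x => if (x, v) ∈ E ∧ c x = c v ∧ v ∉ S ∧ x ∈ S ∧ Minor c S v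
    then 1 else 0), h2, h2, ← Finset.sum_add_distrib, ← Finset.sum_add_distrib]
  refine Finset.sum_congr rfl fun u _ => ?_
  rw [← Finset.sum_add_distrib, ← Finset.sum_add_distrib]
  refine Finset.sum_congr rfl fun x _ => ?_
  have := h3 u x
  by_cases hE : (u, x) ∈ E <;> by_cases hu : u ∈ S <;> by_cases hx : x ∈ S <;>
    by_cases hc : c u = c x <;> by_cases hm : Minor c S x <;> simp_all [eq_comm]

lemma mul_card_le_bdCard {E : Finset (V × V)} {c : V → Option V} {τ : ℕ}
    (hc : ∀ (l : Option V) (A : Finset V), (∀ v ∈ A, c v = l) → 2 * #A ≤ #{v | c v = l} →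
        τ * #A ≤ #{p ∈ E | c p.1 = l ∧ c p.2 = l ∧ ¬(p.1 ∈ A ↔ p.2 ∈ A)})
    {S : Set V} {v : V} (hv : Minor c S v) :
    τ * #{x ∈ nbrs E c v (decide (v ∈ S)) | x ∈ S ↔ v ∈ S} ≤ bdCard E S := by
  have hsplit := Finset.card_filter_add_card_filter_not (s := ({u | c u = c v} : Finset V))
    (fun u => u ∈ S)
  rw [Finset.filter_filter, Finset.filter_filter] at hsplit
  have hhalf : 2 * #{u | c u = c v ∧ (u ∈ S ↔ v ∈ S)} ≤ #{u | c u = c v} := by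
    by_cases h : v ∈ S <;> simp only [Minor, h, if_true, if_false, iff_true, iff_false] at hv ⊢ <;>
      omega
  have h1 := hc (c v) {u | c u = c v ∧ (u ∈ S ↔ v ∈ S)} (by simp +contextual) hhalf
  refine (Nat.mul_le_mul_left τ (Finset.card_le_card fun x hx => ?_)).trans
    (h1.trans (Finset.card_le_card fun p hp => ?_))
  · rw [Finset.mem_filter] at hx ⊢
    refine ⟨Finset.mem_univ _, ?_, hx.2⟩
    have := hx.1
    by_cases h : v ∈ S <;> simp_all [nbrs]
  · simp only [Finset.mem_filter, Finset.mem_univ, true_and] at hp ⊢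
    refine ⟨hp.1, fun h => hp.2.2.2 ?_⟩
    simp [hp.2.1, hp.2.2.1, h]

end Query

section Sketch

open scoped Classical

variable {V : Type} [Fintype V]

/-- The vertices among which a uniform sample is drawn to sample from `A`. -/
noncomputable def pool (A : Finset V) : Finset V := if A.Nonempty then A else Finset.univ

instance [Nonempty V] (A : Finset V) : Nonempty (pool A) := by
  rw [pool]
  split_ifs with h
  · exact h.coe_sort
  · exact Finset.univ_nonempty.coe_sort

lemma sum_pool_centred (A : Finset V) (P : V → Prop) [DecidablePred P] :
    ∑ r : pool A, ((#A : ℝ) * (if P r then 1 else 0) - (#{x ∈ A | P x} : ℝ)) = 0 := by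
  rw [Finset.sum_coe_sort (pool A) fun r => (#A : ℝ) * (if P r then 1 else 0) - (#{x ∈ A | P x} : ℝ)]
  rcases A.eq_empty_or_nonempty with rfl | h
  · simp
  · rw [pool, if_pos h, Finset.sum_sub_distrib, ← Finset.mul_sum, Finset.sum_boole]
    simp

lemma sum_pool_sq (A : Finset V) (P : V → Prop) [DecidablePred P] :
    ∑ r : pool A, ((#A : ℝ) * (if P r then 1 else 0) - (#{x ∈ A | P x} : ℝ)) ^ 2 =
      (Fintype.card (pool A) : ℝ) * (#{x ∈ A | P x} * #{x ∈ A | ¬ P x}) := by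
  rw [Finset.sum_coe_sort (pool A)
    fun r => ((#A : ℝ) * (if P r then 1 else 0) - (#{x ∈ A | P x} : ℝ)) ^ 2]
  rcases A.eq_empty_or_nonempty with rfl | h
  · simp
  · have hsplit : (#{x ∈ A | P x} : ℝ) + #{x ∈ A | ¬ P x} = #A := by
      exact_mod_cast Finset.card_filter_add_card_filter_not (s := A) P
    have hpt : ∀ r, ((#A : ℝ) * (if P r then 1 else 0) - (#{x ∈ A | P x} : ℝ)) ^ 2 =
        ((#A : ℝ) ^ 2 - 2 * #A * #{x ∈ A | P x}) * (if P r then 1 else 0) +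
          (#{x ∈ A | P x} : ℝ) ^ 2 :=
      fun r => by split_ifs <;> ring
    rw [Fintype.card_coe, pool, if_pos h]
    simp_rw [hpt]
    rw [Finset.sum_add_distrib, ← Finset.mul_sum, Finset.sum_boole, Finset.sum_const,
      nsmul_eq_mul, ← hsplit]
    ring

/-- The centred contribution of a sampled neighbour `r` of `v` to the estimate of the cut `S`. -/
noncomputable def centred (E : Finset (V × V)) (c : V → Option V) (S : Set V) (v r : V) : ℝ :=
  if Minor c S v then
    (#(nbrs E c v (decide (v ∈ S))) : ℝ) * (if ¬(r ∈ S ↔ v ∈ S) then 1 else 0) - oppCard E c S v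
  else 0

/-- The variance of `centred` at a uniformly random neighbour. -/
noncomputable def centredVar (E : Finset (V × V)) (c : V → Option V) (S : Set V) (v : V) : ℝ :=
  if Minor c S v then
    (oppCard E c S v : ℝ) * #{x ∈ nbrs E c v (decide (v ∈ S)) | x ∈ S ↔ v ∈ S}
  else 0

lemma sum_centred (E : Finset (V × V)) (c : V → Option V) (S : Set V) (v : V) :
    ∑ r : pool (nbrs E c v (decide (v ∈ S))), centred E c S v r = 0 := by
  simp only [centred, oppCard]
  split_ifs
  · exact sum_pool_centred _ fun x => ¬(x ∈ S ↔ v ∈ S)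
  · simp

lemma sum_centred_sq (E : Finset (V × V)) (c : V → Option V) (S : Set V) (v : V) :
    ∑ r : pool (nbrs E c v (decide (v ∈ S))), centred E c S v r ^ 2 =
      Fintype.card (pool (nbrs E c v (decide (v ∈ S)))) * centredVar E c S v := by
  simp only [centred, centredVar, oppCard]
  split_ifs
  · rw [sum_pool_sq _ fun x => ¬(x ∈ S ↔ v ∈ S)]
    simp only [not_not]
  · simp

lemma mul_sum_centredVar_le {E : Finset (V × V)} {c : V → Option V} {τ : ℕ}
    (hc : ∀ (l : Option V) (A : Finset V), (∀ v ∈ A, c v = l) → 2 * #A ≤ #{v | c v = l} →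
        τ * #A ≤ #{p ∈ E | c p.1 = l ∧ c p.2 = l ∧ ¬(p.1 ∈ A ↔ p.2 ∈ A)}) (S : Set V) :
    τ * ∑ v, centredVar E c S v ≤ outCard E S * bdCard E S := by
  have hv : ∀ v, τ * centredVar E c S v ≤
      (if Minor c S v then (oppCard E c S v : ℝ) else 0) * bdCard E S := fun v => by
    simp only [centredVar]
    split_ifs with hm
    · have hb : (τ * #{x ∈ nbrs E c v (decide (v ∈ S)) | x ∈ S ↔ v ∈ S} : ℝ) ≤ bdCard E S := by
        exact_mod_cast mul_card_le_bdCard hc hm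
      rw [mul_left_comm]
      exact mul_le_mul_of_nonneg_left hb (Nat.cast_nonneg _)
    · simp
  rw [Finset.mul_sum]
  refine (Finset.sum_le_sum fun v _ => hv v).trans ?_
  rw [← Finset.sum_mul]
  refine mul_le_mul_of_nonneg_right ?_ (Nat.cast_nonneg _)
  have h2 : (∑ v, if Minor c S v then oppCard E c S v else 0) ≤ outCard E S := by
    rw [outCard_eq E c S]
    exact Nat.le_add_left _ _
  exact_mod_cast h2

variable (V) in
/-- The random choices of the sketch: independent uniform samples from every set of vertices. -/
abbrev SampleSpace (J s : ℕ) : Type :=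
  ∀ k : (Fin J × V × Bool × Fin s) × Finset V, pool k.2

variable (V) in
/-- The data stored by the sketch for each of `J` graphs: the edges between different parts of a
partition, the partition, the degrees inside the parts, and `s` sampled neighbours of every vertex
in either direction. -/
abbrev SketchData (J s M : ℕ) : Type :=
  Fin J → (Fin M → Option (V × V)) × (V → Option V) × (V × Bool → Fin (Fintype.card V + 1)) ×
    (V × Bool × Fin s → V)

lemma card_sketchData_le (J s M : ℕ) (hV : 2 ≤ Fintype.card V) :
    Fintype.card (SketchData V J s M) ≤ Fintype.card V ^
      (J * (3 * M + 6 * Fintype.card V + 2 * Fintype.card V * s)) := by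
  simp only [SketchData, Fintype.card_fun, Fintype.card_prod, Fintype.card_option,
    Fintype.card_fin, Fintype.card_bool]
  generalize Fintype.card V = n at *
  have h1 : n * n + 1 ≤ n ^ 3 := by nlinarith [Nat.mul_le_mul hV hV, Nat.mul_le_mul_left (n * n) hV]
  have h2 : n + 1 ≤ n ^ 2 := by nlinarith
  rw [mul_comm J, pow_mul _ _ J]
  refine Nat.pow_le_pow_left ?_ J
  calc (n * n + 1) ^ M * ((n + 1) ^ n * ((n + 1) ^ (n * 2) * n ^ (n * (2 * s))))
      ≤ (n ^ 3) ^ M * ((n ^ 2) ^ n * ((n ^ 2) ^ (n * 2) * n ^ (n * (2 * s)))) := by gcongr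
    _ = n ^ (3 * M + 6 * n + 2 * n * s) := by
      simp only [← pow_mul, ← pow_add]
      congr 1
      ring

lemma exists_fin_option_enum {α : Type} (A : Finset α) {M : ℕ} (h : #A ≤ M) :
    ∃ g : Fin M → Option α, ∀ x, (∃ i, g i = some x) ↔ x ∈ A := by
  refine ⟨fun i => A.toList[(i : ℕ)]?, fun x => ?_⟩
  rw [← Finset.mem_toList, List.mem_iff_getElem?]
  constructor
  · rintro ⟨i, hi⟩
    exact ⟨i, hi⟩
  · rintro ⟨i, hi⟩
    have := (List.getElem?_eq_some_iff.mp hi).1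
    rw [Finset.length_toList] at this
    exact ⟨⟨i, this.trans_le h⟩, hi⟩

/-- The estimate of a weighted sum of cut sizes computed from a sketch. -/
noncomputable def estimate {J s M : ℕ} (α : Fin J → ℝ) (S : Set V) (y : SketchData V J s M) : ℝ :=
  ∑ j, α j * (outCard {p | ∃ i, (y j).1 i = some p} S +
    ∑ v, if Minor (y j).2.1 S v then
      ∑ i, ((y j).2.2.1 (v, decide (v ∈ S)) : ℝ) / s *
        (if ¬((y j).2.2.2 (v, decide (v ∈ S), i) ∈ S ↔ v ∈ S) then 1 else 0) else 0)

/-- The sketch of the graphs `E` determined by partitions `c`, encodings `e` of the edges between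
different parts, and the random samples `ω`. -/
noncomputable def sketch {J s M : ℕ} (E : Fin J → Finset (V × V)) (c : Fin J → V → Option V)
    (e : Fin J → Fin M → Option (V × V)) (ω : SampleSpace V J s) : SketchData V J s M := fun j =>
  ⟨e j, c j,
    fun p => ⟨#(nbrs (E j) (c j) p.1 p.2), Nat.lt_succ_of_le (Finset.card_le_univ _)⟩,
    fun p => ω ((j, p), nbrs (E j) (c j) p.1 p.2.1)⟩

lemma estimate_sketch_sub {J s M : ℕ} (hs : 0 < s) (α : Fin J → ℝ) (E : Fin J → Finset (V × V))
    (c : Fin J → V → Option V) (e : Fin J → Fin M → Option (V × V))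
    (he : ∀ j x, (∃ i, e j i = some x) ↔ x ∈ {p ∈ E j | c j p.1 ≠ c j p.2})
    (S : Set V) (ω : SampleSpace V J s) :
    estimate α S (sketch E c e ω) - ∑ j, α j * outCard (E j) S =
      ∑ k : Fin J × V × Fin s, α k.1 / s * centred (E k.1) (c k.1) S k.2.1
        (ω ((k.1, k.2.1, decide (k.2.1 ∈ S), k.2.2),
          nbrs (E k.1) (c k.1) k.2.1 (decide (k.2.1 ∈ S)))) := by
  have hs' : (s : ℝ) ≠ 0 := by exact_mod_cast hs.ne'
  rw [estimate, ← Finset.sum_sub_distrib, Fintype.sum_prod_type]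
  refine Finset.sum_congr rfl fun j _ => ?_
  rw [← mul_sub, outCard_eq (E j) (c j) S, Fintype.sum_prod_type]
  have hset : ({p | ∃ i, (sketch E c e ω j).1 i = some p} : Finset (V × V)) =
      {p ∈ E j | c j p.1 ≠ c j p.2} := by
    ext p
    rw [← he, Finset.mem_filter]
    exact ⟨fun h => h.2, fun h => ⟨Finset.mem_univ _, h⟩⟩
  rw [hset]
  simp only [sketch]
  push_cast
  rw [add_sub_add_left_eq_sub, ← Finset.sum_sub_distrib, Finset.mul_sum]
  refine Finset.sum_congr rfl fun v _ => ?_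
  by_cases hm : Minor (c j) S v
  · simp only [centred, hm, if_true]
    rw [← Finset.mul_sum, ← Finset.mul_sum, Finset.sum_sub_distrib, Finset.sum_const,
      ← Finset.mul_sum, Finset.card_univ, Fintype.card_fin, nsmul_eq_mul]
    field_simp
    congr!
  · simp [centred, hm]

lemma exists_sketch [Nonempty V] {J s M : ℕ} (hs : 0 < s)
    (hM : (s * (Fintype.card V * Real.logb 2 (Fintype.card V)) : ℝ) < M + 1) (α : Fin J → ℝ)
    (hα : ∀ j, 0 ≤ α j) (E : Fin J → Finset (V × V)) :
    ∃ sk : SampleSpace V J s → SketchData V J s M, ∀ (S : Set V) (t : ℝ), 0 ≤ t →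
      3 * ((∑ j, α j * outCard (E j) S) * ∑ j, α j * bdCard (E j) S) ≤ (t * s) ^ 2 →
      2 * Fintype.card (SampleSpace V J s) ≤
        3 * #{ω | |estimate α S (sk ω) - ∑ j, α j * outCard (E j) S| ≤ t} := by
  choose c hcross hc using fun j => exists_sparse_partition (E j) s
  have hcard : ∀ j, #{p ∈ E j | c j p.1 ≠ c j p.2} ≤ M := fun j => by
    have := (hcross j).trans_lt hM
    exact_mod_cast Nat.lt_succ_iff.mp (by exact_mod_cast this)
  choose e he using fun j => exists_fin_option_enum _ (hcard j)
  refine ⟨sketch E c e, fun S t ht hvar => ?_⟩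
  have hs' : (0 : ℝ) < s := by exact_mod_cast hs
  let φ : Fin J × V × Fin s → (Fin J × V × Bool × Fin s) × Finset V := fun k =>
    ((k.1, k.2.1, decide (k.2.1 ∈ S), k.2.2), nbrs (E k.1) (c k.1) k.2.1 (decide (k.2.1 ∈ S)))
  have hφ : Function.Injective φ := by
    rintro ⟨j, v, i⟩ ⟨j', v', i'⟩ h
    simp only [φ, Prod.mk.injEq] at h
    simp [h.1.1, h.1.2.1, h.1.2.2.2]
  have hmom := sum_sq_sum_apply_le
    (R := fun k : (Fin J × V × Bool × Fin s) × Finset V => pool k.2) hφ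
    (fun k r => α k.1 / s * centred (E k.1) (c k.1) S k.2.1 r)
    (fun k => (α k.1 / s) ^ 2 * centredVar (E k.1) (c k.1) S k.2.1)
    (fun k => by rw [← Finset.mul_sum, sum_centred, mul_zero])
    (fun k => by
      simp_rw [mul_pow]
      rw [← Finset.mul_sum, sum_centred_sq]
      exact (mul_left_comm _ _ _).le)
  have hj : ∀ j, ∑ v, ∑ _i : Fin s, (α j / s) ^ 2 * centredVar (E j) (c j) S v ≤
      (α j * outCard (E j) S) * (α j * bdCard (E j) S) / s ^ 2 := fun j => by
    simp only [Finset.sum_const, Finset.card_univ, Fintype.card_fin, nsmul_eq_mul]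
    rw [← Finset.mul_sum, ← Finset.mul_sum]
    have := mul_le_mul_of_nonneg_left (mul_sum_centredVar_le (hc j) S) (sq_nonneg (α j / s))
    refine le_of_eq_of_le (mul_left_comm _ _ _) (this.trans_eq ?_)
    ring
  have hsum : ∑ k : Fin J × V × Fin s, (α k.1 / s) ^ 2 * centredVar (E k.1) (c k.1) S k.2.1 ≤
      (∑ j, α j * outCard (E j) S) * (∑ j, α j * bdCard (E j) S) / s ^ 2 := by
    rw [Fintype.sum_prod_type]
    simp_rw [Fintype.sum_prod_type]
    refine (Finset.sum_le_sum fun j _ => hj j).trans ?_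
    rw [← Finset.sum_div]
    gcongr
    rw [Finset.sum_mul]
    refine Finset.sum_le_sum fun j _ => ?_
    refine mul_le_mul_of_nonneg_left ?_ (mul_nonneg (hα j) (Nat.cast_nonneg _))
    exact Finset.single_le_sum (f := fun j => α j * (bdCard (E j) S : ℝ))
      (fun j _ => mul_nonneg (hα j) (Nat.cast_nonneg _)) (Finset.mem_univ j)
  rw [le_div_iff₀ (by positivity)] at hsum
  simp_rw [estimate_sketch_sub hs α E c e he]
  refine two_mul_card_le_of_sum_sq_le _ ht hmom ?_
  refine le_of_mul_le_mul_right ?_ (show (0 : ℝ) < s ^ 2 by positivity)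
  rw [← mul_pow]
  linarith

end Sketch

section Rounding

lemma sum_two_pow_testBit {N J : ℕ} (h : N < 2 ^ J) :
    ∑ j : Fin J, 2 ^ (j : ℕ) * (if N.testBit j then 1 else 0) = N := by
  rw [Fin.sum_univ_eq_sum_range fun j => 2 ^ j * (if N.testBit j then 1 else 0)]
  suffices ∀ J, ∑ j ∈ Finset.range J, 2 ^ j * (if N.testBit j then 1 else 0) = N % 2 ^ J by
    rw [this, Nat.mod_eq_of_lt h]
  intro J
  induction J with
  | zero => simp [Nat.mod_one]
  | succ J ih =>
    rw [Finset.sum_range_succ, ih, Nat.mod_pow_succ, Nat.testBit_eq_decide_div_mod_eq]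
    rcases Nat.mod_two_eq_zero_or_one (N / 2 ^ J) with h | h <;> simp [h]

open scoped Classical

variable {V : Type} [Fintype V]

lemma cutS_eq_sum (w : V × V → ℝ) (S : Set V) :
    cutS w S = ∑ p : V × V, if p.1 ∈ S ∧ p.2 ∉ S then w p else 0 := rfl

lemma cutS_nonneg {w : V × V → ℝ} (hw : ∀ p, 0 ≤ w p) (S : Set V) : 0 ≤ cutS w S := by
  rw [cutS_eq_sum]
  refine Finset.sum_nonneg fun p _ => ?_
  split_ifs
  exacts [hw p, le_rfl]

lemma cutS_mono {w w' : V × V → ℝ} (h : ∀ p, w p ≤ w' p) (S : Set V) :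
    cutS w S ≤ cutS w' S := by
  rw [cutS_eq_sum, cutS_eq_sum]
  refine Finset.sum_le_sum fun p _ => ?_
  split_ifs
  exacts [h p, le_rfl]

lemma cutS_const_mul (r : ℝ) (w : V × V → ℝ) (S : Set V) :
    cutS (fun p => r * w p) S = r * cutS w S := by
  rw [cutS_eq_sum, cutS_eq_sum, Finset.mul_sum]
  refine Finset.sum_congr rfl fun p _ => ?_
  rw [mul_ite, mul_zero]

lemma abs_cutS_sub_le {w w' : V × V → ℝ} {δ : ℝ} (h₁ : ∀ p, w' p ≤ w p)
    (h₂ : ∀ p, (1 - δ) * w p ≤ w' p) (S : Set V) : |cutS w' S - cutS w S| ≤ δ * cutS w S := by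
  have h1 := cutS_mono h₁ S
  have h2 := cutS_mono h₂ S
  rw [cutS_const_mul] at h2
  rw [abs_sub_comm, abs_of_nonneg (sub_nonneg.mpr h1)]
  linarith

/-- The edges whose weight, rounded down to a multiple of `δ`, has `1` as its `j`-th digit. -/
noncomputable def digitGraph (δ : ℝ) (w : V × V → ℝ) (j : ℕ) : Finset (V × V) :=
  {p | (⌊w p / δ⌋₊).testBit j}

lemma sum_digitGraph {δ : ℝ} {w : V × V → ℝ} {J : ℕ} (hJ : ∀ p, ⌊w p / δ⌋₊ < 2 ^ J)
    (P : V × V → Prop) [DecidablePred P] :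
    ∑ j : Fin J, δ * 2 ^ (j : ℕ) * #{p ∈ digitGraph δ w j | P p} =
      ∑ p, if P p then δ * ⌊w p / δ⌋₊ else 0 := by
  have h : ∀ p, (δ * ⌊w p / δ⌋₊ : ℝ) =
      ∑ j : Fin J, δ * 2 ^ (j : ℕ) * (if (⌊w p / δ⌋₊).testBit j then 1 else 0) := fun p => by
    simp_rw [mul_assoc]
    rw [← Finset.mul_sum]
    conv_lhs => rw [← sum_two_pow_testBit (hJ p)]
    push_cast
    rfl
  simp_rw [h]
  rw [← Finset.sum_filter, Finset.sum_comm]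
  refine Finset.sum_congr rfl fun j _ => ?_
  rw [← Finset.mul_sum, Finset.sum_boole, digitGraph, Finset.filter_filter, Finset.filter_filter]
  simp_rw [and_comm]

lemma sum_outCard_digitGraph {δ : ℝ} {w : V × V → ℝ} {J : ℕ} (hJ : ∀ p, ⌊w p / δ⌋₊ < 2 ^ J)
    (S : Set V) : ∑ j : Fin J, δ * 2 ^ (j : ℕ) * outCard (digitGraph δ w j) S =
      cutS (fun p => δ * ⌊w p / δ⌋₊) S := by
  rw [cutS_eq_sum]
  simp only [outCard]
  convert sum_digitGraph hJ fun p => p.1 ∈ S ∧ p.2 ∉ S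

lemma sum_bdCard_digitGraph {δ : ℝ} {w : V × V → ℝ} {J : ℕ} (hJ : ∀ p, ⌊w p / δ⌋₊ < 2 ^ J)
    (S : Set V) : ∑ j : Fin J, δ * 2 ^ (j : ℕ) * bdCard (digitGraph δ w j) S =
      cutS (fun p => δ * ⌊w p / δ⌋₊) S + cutS (fun p => δ * ⌊w p / δ⌋₊) Sᶜ := by
  rw [cutS_eq_sum, cutS_eq_sum, ← Finset.sum_add_distrib]
  simp only [bdCard]
  refine (sum_digitGraph hJ fun p => ¬(p.1 ∈ S ↔ p.2 ∈ S)).trans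
    (Finset.sum_congr rfl fun p _ => ?_)
  by_cases h1 : p.1 ∈ S <;> by_cases h2 : p.2 ∈ S <;> simp [h1, h2]

lemma mul_floor_div_le {δ x : ℝ} (hδ : 0 < δ) (hx : 0 ≤ x) : δ * ⌊x / δ⌋₊ ≤ x := by
  rw [mul_comm, ← le_div_iff₀ hδ]
  exact Nat.floor_le (by positivity)

lemma le_mul_floor_div {δ x : ℝ} (hδ : 0 < δ) (hx : 0 ≤ x) (hx1 : 0 < x → 1 ≤ x) :
    (1 - δ) * x ≤ δ * ⌊x / δ⌋₊ := by
  rcases hx.eq_or_lt with rfl | h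
  · simp
  · have h1 := (div_lt_iff₀ hδ).mp (Nat.lt_floor_add_one (x / δ))
    have h2 := mul_le_mul_of_nonneg_left (hx1 h) hδ.le
    linarith

end Rounding

section Schemes

variable (V : Type) [Fintype V]

/-- There is a for-each cut sketch scheme of `b` bits for the `β`-balanced digraphs on `V` with
positive weights in `[1, W]`. -/
def HasSketch (β ε W : ℝ) (b : ℕ) : Prop :=
  ∃ (Ω : Type) (_ : Finite Ω) (μ : PMF Ω)
    (sk : (V × V → ℝ) → Ω → Fin (2 ^ b)) (f : Set V → Fin (2 ^ b) → ℝ),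
    ∀ w : V × V → ℝ, (∀ p, 0 ≤ w p) → (∀ p, 0 < w p → 1 ≤ w p ∧ w p ≤ W) →
      (∀ S : Set V, cutS w S ≤ β * cutS w Sᶜ) →
      ∀ S : Set V,
        (2 / 3 : ENNReal) ≤
          μ.toOuterMeasure {ω | |f S (sk w ω) - cutS w S| ≤ ε * cutS w S}

variable {V}

open scoped Classical in
lemma HasSketch.of_uniform {β ε W : ℝ} {b : ℕ} {Ω Y : Type} [Fintype Ω] [Nonempty Ω] [Fintype Y]
    [Nonempty Y] (hY : Fintype.card Y ≤ 2 ^ b) (f : Set V → Y → ℝ)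
    (h : ∀ w : V × V → ℝ, (∀ p, 0 ≤ w p) → (∀ p, 0 < w p → 1 ≤ w p ∧ w p ≤ W) →
      (∀ S : Set V, cutS w S ≤ β * cutS w Sᶜ) → ∃ sk : Ω → Y, ∀ S : Set V,
        2 * Fintype.card Ω ≤ 3 * #{ω | |f S (sk ω) - cutS w S| ≤ ε * cutS w S}) :
    HasSketch V β ε W b := by
  obtain ⟨e⟩ := Function.Embedding.nonempty_of_card_le (α := Y) (β := Fin (2 ^ b)) (by simpa)
  choose! sk hsk using h
  refine ⟨Ω, inferInstance, PMF.uniformOfFintype Ω, fun w ω => e (sk w ω),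
    fun S y => f S (Function.invFun e y), fun w h0 h1 h2 S => ?_⟩
  simp_rw [Function.leftInverse_invFun e.injective _]
  exact two_thirds_le_uniform _ (hsk w h0 h1 h2 S)

lemma floor_div_lt_two_pow {α : Type*} {w : α → ℝ} {W δ : ℝ} {J : ℕ} (hδ : 0 < δ)
    (hJ : W / δ < 2 ^ J) (h0 : ∀ p, 0 ≤ w p) (h1 : ∀ p, 0 < w p → 1 ≤ w p ∧ w p ≤ W)
    (p : α) : ⌊w p / δ⌋₊ < 2 ^ J := by
  rcases (h0 p).eq_or_lt with h | h
  · simp [← h]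
  · rw [Nat.floor_lt (div_nonneg (h0 p) hδ.le)]
    push_cast
    exact (div_le_div_of_nonneg_right (h1 p h).2 hδ.le).trans_lt hJ

/-- Storing all rounded weights. -/
lemma hasSketch_dense {β ε W : ℝ} (hε : 0 < ε) {J : ℕ} (hJ : W / ε < 2 ^ J) :
    HasSketch V β ε W (J * (Fintype.card V * Fintype.card V)) := by
  classical
  refine HasSketch.of_uniform (Ω := Unit) (Y := V × V → Fin (2 ^ J))
    (by simp [pow_mul]) (fun S y => cutS (fun p => ε * (y p : ℕ)) S) fun w h0 h1 _ => ?_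
  refine ⟨fun _ p => ⟨⌊w p / ε⌋₊, floor_div_lt_two_pow hε hJ h0 h1 p⟩, fun S => ?_⟩
  have := abs_cutS_sub_le (δ := ε) (fun p => mul_floor_div_le hε (h0 p))
    (fun p => le_mul_floor_div hε (h0 p) fun h => (h1 p h).1) S
  simp [this]

lemma hasSketch_sparse {β ε W : ℝ} (hβ : 1 ≤ β) (hε : 0 < ε) (hV : 2 ≤ Fintype.card V)
    {J s M : ℕ} (hJ : W / (ε / 2) < 2 ^ J) (hs : 24 * β ≤ (ε * s) ^ 2)
    (hM : (s * (Fintype.card V * Real.logb 2 (Fintype.card V)) : ℝ) < M + 1) :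
    HasSketch V β ε W (Nat.clog 2 (Fintype.card V) *
      (J * (3 * M + 6 * Fintype.card V + 2 * Fintype.card V * s))) := by
  classical
  have hne : Nonempty V := Fintype.card_pos_iff.mp (by omega)
  have hs0 : 0 < s := Nat.pos_of_ne_zero fun h => by
    rw [h] at hs
    norm_num at hs
    linarith
  have hY : Fintype.card (SketchData V J s M) ≤ 2 ^ (Nat.clog 2 (Fintype.card V) *
      (J * (3 * M + 6 * Fintype.card V + 2 * Fintype.card V * s))) := by
    refine (card_sketchData_le J s M hV).trans ?_
    rw [pow_mul _ (Nat.clog 2 _)]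
    exact Nat.pow_le_pow_left (Nat.le_pow_clog one_lt_two _) _
  have hδ : 0 < ε / 2 := half_pos hε
  refine HasSketch.of_uniform (Ω := SampleSpace V J s) hY
    (estimate fun j : Fin J => ε / 2 * 2 ^ (j : ℕ)) fun w h0 h1 hbal => ?_
  obtain ⟨sk, hsk⟩ := exists_sketch hs0 hM (fun j : Fin J => ε / 2 * 2 ^ (j : ℕ))
    (fun j => by positivity) fun j => digitGraph (ε / 2) w j
  refine ⟨sk, fun S => ?_⟩
  have hfl := floor_div_lt_two_pow hδ hJ h0 h1
  have hk := cutS_nonneg h0 S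
  have hle : ∀ T, cutS (fun p => ε / 2 * ⌊w p / (ε / 2)⌋₊) T ≤ cutS w T :=
    cutS_mono fun p => mul_floor_div_le hδ (h0 p)
  have h0' : ∀ T, 0 ≤ cutS (fun p => ε / 2 * ⌊w p / (ε / 2)⌋₊) T :=
    cutS_nonneg fun p => by positivity
  have hround := abs_cutS_sub_le (fun p => mul_floor_div_le hδ (h0 p))
    (fun p => le_mul_floor_div hδ (h0 p) fun h => (h1 p h).1) S
  have key := hsk S (ε / 2 * cutS w S) (by positivity)
  rw [sum_outCard_digitGraph hfl, sum_bdCard_digitGraph hfl] at key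
  refine (key ?_).trans (Nat.mul_le_mul_left 3 (Finset.card_le_card fun ω hω => ?_))
  · have hbd := hbal Sᶜ
    rw [compl_compl] at hbd
    have hU : cutS (fun p => ε / 2 * ⌊w p / (ε / 2)⌋₊) S +
        cutS (fun p => ε / 2 * ⌊w p / (ε / 2)⌋₊) Sᶜ ≤ 2 * β * cutS w S := by
      have := hle S
      have := hle Sᶜ
      nlinarith
    calc 3 * (cutS (fun p => ε / 2 * ⌊w p / (ε / 2)⌋₊) S *
          (cutS (fun p => ε / 2 * ⌊w p / (ε / 2)⌋₊) S +
            cutS (fun p => ε / 2 * ⌊w p / (ε / 2)⌋₊) Sᶜ))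
        ≤ 3 * (cutS w S * (2 * β * cutS w S)) := by
          gcongr
          · exact add_nonneg (h0' _) (h0' _)
          · exact hle S
      _ = 24 * β * (cutS w S ^ 2 / 4) := by ring
      _ ≤ (ε * s) ^ 2 * (cutS w S ^ 2 / 4) := by gcongr
      _ = (ε / 2 * cutS w S * s) ^ 2 := by ring
  · simp only [Finset.mem_filter, Finset.mem_univ, true_and] at hω ⊢
    have := abs_sub_le (estimate (fun j : Fin J => ε / 2 * 2 ^ (j : ℕ)) S (sk ω))
      (cutS (fun p => ε / 2 * ⌊w p / (ε / 2)⌋₊) S) (cutS w S)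
    linarith

end Schemes

lemma exists_hasSketch {V : Type} [Fintype V] {a β ε : ℝ} (ha : 1 ≤ a) (hV : 2 ≤ Fintype.card V)
    (hβ : 1 ≤ β) (hε : 0 < ε) (hε1 : ε < 1) :
    ∃ b : ℕ, (b : ℝ) ≤ 1056 * (a + 3) * Real.sqrt β * Fintype.card V *
        (Real.log (Fintype.card V)) ^ 3 / ε ∧
      HasSketch V β ε ((Fintype.card V : ℝ) ^ a) b := by
  have hn2 : (2 : ℝ) ≤ Fintype.card V := by exact_mod_cast hV
  have hclog : (Nat.clog 2 (Fintype.card V) : ℝ) < Real.logb 2 (Fintype.card V) + 1 := by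
    rw [← Real.natCeil_logb_natCast]
    refine Nat.ceil_lt_add_one (Real.logb_nonneg one_lt_two (by linarith))
  have hdense := fun J => hasSketch_dense (V := V) (β := β) (W := (Fintype.card V : ℝ) ^ a) hε
    (J := J)
  have hsparse := fun J s M => hasSketch_sparse (V := V) (W := (Fintype.card V : ℝ) ^ a) hβ hε hV
    (J := J) (s := s) (M := M)
  generalize Fintype.card V = m at *
  set n : ℝ := (m : ℝ) with hn
  set L := Real.logb 2 n with hL
  set r := Real.sqrt β with hr
  have hr1 : 1 ≤ r := Real.one_le_sqrt.mpr hβ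
  have hn0 : 0 < n := by linarith
  have hL1 : 1 ≤ L := by
    rw [hL, Real.le_logb_iff_rpow_le one_lt_two hn0]
    simpa using hn2
  have hLlog : L ≤ 2 * Real.log n := by
    have h2 := Real.log_two_gt_d9
    have h3 : 0 ≤ Real.log n := Real.log_nonneg (by linarith)
    rw [hL, Real.logb, div_le_iff₀ (by linarith)]
    nlinarith
  have hL3 : L ^ 3 ≤ 8 * Real.log n ^ 3 :=
    (pow_le_pow_left₀ (by linarith) hLlog 3).trans_eq (by ring)
  set x := 1 / ε with hx
  have hx1 : 1 ≤ x := by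
    rw [hx, le_div_iff₀ hε]
    linarith
  set J := ⌊Real.logb 2 (n ^ a / (ε / 2))⌋₊ + 1 with hJdef
  have hWpos : 0 < n ^ a / (ε / 2) := by positivity
  have hJ : n ^ a / (ε / 2) < 2 ^ J := by
    have h := Nat.lt_floor_add_one (Real.logb 2 (n ^ a / (ε / 2)))
    rw [Real.logb_lt_iff_lt_rpow one_lt_two hWpos] at h
    exact_mod_cast h
  have hlogb : Real.logb 2 (n ^ a / (ε / 2)) = a * L + 1 + Real.logb 2 x := by
    have : n ^ a / (ε / 2) = n ^ a * 2 * x := by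
      rw [hx]
      field_simp
    rw [this, Real.logb_mul (by positivity) (by positivity),
      Real.logb_mul (by positivity) (by positivity), Real.logb_rpow_eq_mul_logb_of_pos hn0,
      Real.logb_self_eq_one one_lt_two]
  have hlx : 0 ≤ Real.logb 2 x := Real.logb_nonneg one_lt_two hx1
  have hJle : (J : ℝ) ≤ a * L + 2 + Real.logb 2 x := by
    have := Nat.floor_le (a := Real.logb 2 (n ^ a / (ε / 2))) (by rw [hlogb]; positivity)
    rw [hJdef]
    push_cast
    linarith
  suffices h : ∃ b : ℕ, (b : ℝ) ≤ 132 * (a + 3) * r * n * L ^ 3 * x ∧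
      HasSketch V β ε (n ^ a) b by
    obtain ⟨b, hb, hsk⟩ := h
    refine ⟨b, hb.trans ?_, hsk⟩
    calc 132 * (a + 3) * r * n * L ^ 3 * x
        ≤ 132 * (a + 3) * r * n * (8 * Real.log n ^ 3) * x := by gcongr
      _ = 1056 * (a + 3) * r * n * Real.log n ^ 3 / ε := by
        rw [hx]
        ring
  rcases le_total n x with hnx | hnx
  · refine ⟨_, ?_, hdense J (lt_of_le_of_lt ?_ hJ)⟩
    · have hlog : n * Real.logb 2 x ≤ 3 * x * L := by
        have h1 : Real.logb 2 x = L + Real.logb 2 (x / n) := by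
          have h := Real.logb_div (b := 2) (x := x) (y := n) (by positivity) (by positivity)
          linarith
        have h2 : Real.logb 2 (x / n) ≤ 2 * (x / n) := by
          have hl := Real.log_le_sub_one_of_pos (show 0 < x / n by positivity)
          have h2 := Real.log_two_gt_d9
          have h3 : 0 < x / n := by positivity
          rw [Real.logb, div_le_iff₀ (by linarith)]
          nlinarith
        have h3 : n * Real.logb 2 (x / n) ≤ 2 * x := by
          refine (mul_le_mul_of_nonneg_left h2 hn0.le).trans_eq ?_
          field_simp
        rw [h1, mul_add]
        nlinarith
      have hnJ : n * J ≤ (a + 5) * x * L := by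
        have h1 := mul_le_mul_of_nonneg_left hJle hn0.le
        have h2 : n * (a * L) ≤ x * (a * L) := by gcongr
        have h3 : n * 2 ≤ x * L * 2 := by nlinarith
        nlinarith
      push_cast
      calc J * (n * n) = n * (n * J) := by ring
        _ ≤ n * ((a + 5) * x * L) := by gcongr
        _ = (a + 5) * 1 * n * L * x := by ring
        _ ≤ 132 * (a + 3) * r * n * L ^ 3 * x := by
          gcongr
          · linarith
          · exact le_self_pow₀ hL1 (by norm_num)
    · gcongr
      linarith
  · set s := ⌈5 * r * x⌉₊ with hs
    have hrx : 1 ≤ r * x := by nlinarith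
    have hs_lo : 5 * r * x ≤ s := Nat.le_ceil _
    have hs_hi : (s : ℝ) ≤ 6 * (r * x) := by
      have := Nat.ceil_lt_add_one (a := 5 * r * x) (by positivity)
      linarith
    have hs1 : (1 : ℝ) ≤ s := by linarith
    have hJL : (J : ℝ) ≤ (a + 3) * L := by
      have : Real.logb 2 x ≤ L := Real.logb_le_logb_of_le one_lt_two (by linarith) hnx
      linarith
    set M := ⌊s * (n * L)⌋₊ with hM
    have hM_hi : (M : ℝ) ≤ s * (n * L) := Nat.floor_le (by positivity)
    refine ⟨_, ?_, hsparse J s M hJ ?_ (Nat.lt_floor_add_one _)⟩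
    · push_cast
      have hc : (Nat.clog 2 m : ℝ) ≤ 2 * L := by linarith
      have hsL : 1 ≤ s * L := by nlinarith
      have hsum : (3 * M + 6 * n + 2 * n * s : ℝ) ≤ 11 * (s * (n * L)) := by
        have h1 : n * 1 ≤ n * (s * L) := by gcongr
        have h2 : n * s * 1 ≤ n * s * L := by gcongr
        linarith
      calc (Nat.clog 2 m : ℝ) * (J * (3 * M + 6 * n + 2 * n * s))
          ≤ (2 * L) * (((a + 3) * L) * (11 * (6 * (r * x) * (n * L)))) := by
            gcongr
            refine hsum.trans ?_
            gcongr
        _ = 132 * (a + 3) * r * n * L ^ 3 * x := by ring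
    · have h1 : 5 * r ≤ ε * s := by
        have := mul_le_mul_of_nonneg_left hs_lo hε.le
        have h2 : ε * (5 * r * x) = 5 * r := by
          rw [hx]
          field_simp
        linarith
      have h2 := pow_le_pow_left₀ (by linarith) h1 2
      have h3 : r ^ 2 = β := Real.sq_sqrt (by linarith)
      nlinarith

end CutSketch

/-- For-each cut sketch upper bound (Theorem `beta-12`): for every `a ≥ 1` there is a
constant `C = C(a)` such that every class of `β`-balanced digraphs on `n ≥ 2` vertices
with weights in `[1, n^a]` admits a `(1 ± ε)` for-each cut sketch scheme using
`b ≤ C·√β·n·(log n)³/ε` bits. -/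
theorem foreach_cut_sketch_upper_bound :
    ∀ a : ℝ, 1 ≤ a →
      ∃ C : ℝ, 0 < C ∧
        ∀ (V : Type) [Fintype V] [DecidableEq V] (n : ℕ) (β ε : ℝ),
          n = Fintype.card V → 2 ≤ n → 1 ≤ β → 0 < ε → ε < 1 →
          ∃ b : ℕ, (b : ℝ) ≤ C * Real.sqrt β * n * (Real.log n) ^ 3 / ε ∧
            ∃ (Ω : Type) (_ : Finite Ω) (μ : PMF Ω)
              (sk : (V × V → ℝ) → Ω → Fin (2 ^ b)) (f : Set V → Fin (2 ^ b) → ℝ),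
              ∀ w : V × V → ℝ,
                (∀ p : V × V, 0 ≤ w p) → (∀ u : V, w (u, u) = 0) →
                (∀ p : V × V, 0 < w p → 1 ≤ w p ∧ w p ≤ (n : ℝ) ^ a) →
                (∀ u v : V, Relation.ReflTransGen (fun x y => 0 < w (x, y)) u v) →
                (∀ S : Set V, cutS w S ≤ β * cutS w Sᶜ) →
                ∀ S : Set V,
                  (2 / 3 : ENNReal) ≤
                    μ.toOuterMeasure {ω | |f S (sk w ω) - cutS w S| ≤ ε * cutS w S} := by
  intro a ha
  refine ⟨1056 * (a + 3), by linarith, fun V _ _ n β ε hn hn2 hβ hε hε1 => ?_⟩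
  subst hn
  obtain ⟨b, hb, Ω, hΩ, μ, sk, f, h⟩ := CutSketch.exists_hasSketch ha hn2 hβ hε hε1
  exact ⟨b, hb, Ω, hΩ, μ, sk, f, fun w h0 _ h1 _ hbal => h w h0 h1 hbal⟩
end

section
/- Let V be a finite set with |V| = n ≥ 2, let E ⊆ V × V, and let λ ≥ 0 be a real number. Let P_0, P_1, …, P_T be a sequence of partitions of V such that P_0 = {V} and for each k < T, the partition P_{k+1} is obtained from P_k by replacing one part P ∈ P_k with two nonempty parts A_k and P ∖ A_k, where the number of pairs of E with one endpoint in A_k and the other endpoint in P ∖ A_k (counting both orientations) is at most λ·min(|A_k|, |P ∖ A_k|). Then the total number of such crossing pairs removed over all steps satisfies Σ_{k=0}^{T−1} |{(x,y) ∈ E : (x ∈ A_k and y ∈ P ∖ A_k) or (y ∈ A_k and x ∈ P ∖ A_k)}| ≤ λ·n·log₂ n. -/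
open Finset

/-- The number of edges of `E` crossing (in either direction) the split of a part
into `A` and `P \ A`. -/
def splitCross {V : Type*} [DecidableEq V]
    (E : Finset (V × V)) (A P : Finset V) : ℕ :=
  (E.filter (fun p =>
    (p.1 ∈ A ∧ p.2 ∈ P \ A) ∨ (p.2 ∈ A ∧ p.1 ∈ P \ A))).card

/-- The entropy-type potential `x ↦ x log₂ x` of a sum exceeds the sum of the potentials by at
least the smaller summand. -/
theorem min_le_mul_logb_add_sub {a b : ℝ} (ha : 0 < a) (hb : 0 < b) :
    a * Real.logb 2 a + b * Real.logb 2 b + min a b ≤ (a + b) * Real.logb 2 (a + b) := by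
  wlog hab : a ≤ b generalizing a b
  · have := this hb ha (le_of_not_ge hab)
    rw [min_comm, add_comm a b]
    linarith
  have h₁ : Real.logb 2 a + 1 ≤ Real.logb 2 (a + b) := by
    have h : Real.logb 2 (a * 2) = Real.logb 2 a + 1 := by
      rw [Real.logb_mul ha.ne' two_ne_zero, Real.logb_self_eq_one one_lt_two]
    rw [← h]
    exact Real.logb_le_logb_of_le one_lt_two (by positivity) (by linarith)
  have h₂ : Real.logb 2 b ≤ Real.logb 2 (a + b) :=
    Real.logb_le_logb_of_le one_lt_two hb (by linarith)
  rw [min_eq_left hab]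
  nlinarith [mul_le_mul_of_nonneg_left h₁ ha.le, mul_le_mul_of_nonneg_left h₂ hb.le]

/-- The sum over a disjoint family in which the member `P` is split into two nonempty pieces. -/
theorem sum_split_part {V : Type*} [DecidableEq V] (F : Finset (Finset V)) {A P : Finset V}
    (hdisj : ∀ Q ∈ F, ∀ Q' ∈ F, Q ≠ Q' → Disjoint Q Q') (hP : P ∈ F) (hAP : A ⊆ P)
    (hA : A.Nonempty) (hB : (P \ A).Nonempty) (f : Finset V → ℝ) :
    ∑ Q ∈ insert A (insert (P \ A) (F.erase P)), f Q + f P =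
      f A + f (P \ A) + ∑ Q ∈ F, f Q := by
  have hnot : ∀ B ⊆ P, B.Nonempty → B ∉ F.erase P := by
    intro B hBP hne hmem
    obtain ⟨hBne, hBF⟩ := Finset.mem_erase.1 hmem
    exact hne.ne_empty ((hdisj B hBF P hP hBne).eq_bot_of_le hBP)
  have hAB : A ≠ P \ A := fun h =>
    hA.ne_empty (Finset.disjoint_self_iff_empty A |>.1 (by
      conv_rhs => rw [h]
      exact Finset.disjoint_sdiff))
  rw [Finset.sum_insert (by simpa [Finset.mem_insert, hAB] using hnot A hAP hA),
    Finset.sum_insert (hnot _ Finset.sdiff_subset hB), ← Finset.sum_erase_add F f hP]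
  ring

/-- Charging bound for iteratively removing `λ`-sparse cuts: if a partition of `V`
(`|V| = n ≥ 2`) is refined step by step, each step splitting one part `Pt k` into
nonempty parts `A k` and `Pt k \ A k` across which at most
`λ·min(|A k|, |Pt k \ A k|)` edges of `E` cross (in both orientations combined), then
the total number of crossing edges removed over all steps is at most `λ·n·log₂ n`. -/
theorem sparse_cut_removal_bound {V : Type*} [Fintype V] [DecidableEq V]
    (n : ℕ) (hn : n = Fintype.card V) (h2 : 2 ≤ n)
    (E : Finset (V × V)) (lam : ℝ) (hlam : 0 ≤ lam)
    (T : ℕ) (P : ℕ → Finset (Finset V)) (A Pt : ℕ → Finset V)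
    (hpart : ∀ k ≤ T,
      (∀ Q ∈ P k, Q.Nonempty) ∧
      (∀ Q ∈ P k, ∀ Q' ∈ P k, Q ≠ Q' → Disjoint Q Q') ∧
      (P k).sup id = Finset.univ)
    (h0 : P 0 = {Finset.univ})
    (hstep : ∀ k < T,
      Pt k ∈ P k ∧ A k ⊆ Pt k ∧ (A k).Nonempty ∧ (Pt k \ A k).Nonempty ∧
      P (k + 1) = insert (A k) (insert (Pt k \ A k) ((P k).erase (Pt k))) ∧
      (splitCross E (A k) (Pt k) : ℝ) ≤
        lam * min ((A k).card : ℝ) (((Pt k \ A k).card : ℝ))) :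
    (∑ k ∈ Finset.range T, (splitCross E (A k) (Pt k) : ℝ)) ≤
      lam * n * Real.logb 2 n := by
  set f : Finset V → ℝ := fun Q => (Q.card : ℝ) * Real.logb 2 (Q.card : ℝ) with hf
  have key : ∀ k ≤ T, (∑ i ∈ Finset.range k, (splitCross E (A i) (Pt i) : ℝ)) +
      lam * ∑ Q ∈ P k, f Q ≤ lam * n * Real.logb 2 n := by
    intro k
    induction k with
    | zero =>
      intro _
      simp [h0, hf, hn, mul_assoc]
    | succ k ih =>
      intro hk
      obtain ⟨hP, hAP, hA, hB, hnext, hcut⟩ := hstep k hk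
      have hsum := sum_split_part (P k) (hpart k (by omega)).2.1 hP hAP hA hB f
      rw [← hnext] at hsum
      have hgain := min_le_mul_logb_add_sub (a := ((A k).card : ℝ))
        (b := ((Pt k \ A k).card : ℝ)) (by exact_mod_cast hA.card_pos)
        (by exact_mod_cast hB.card_pos)
      have hcard : ((A k).card : ℝ) + ((Pt k \ A k).card : ℝ) = (Pt k).card := by
        rw [add_comm]
        exact_mod_cast Finset.card_sdiff_add_card_eq_card hAP
      rw [hcard] at hgain
      have hdrop : min ((A k).card : ℝ) ((Pt k \ A k).card : ℝ) + ∑ Q ∈ P (k + 1), f Q ≤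
          ∑ Q ∈ P k, f Q := by
        simp only [hf] at hsum ⊢
        linarith
      have hmul := mul_le_mul_of_nonneg_left hdrop hlam
      rw [Finset.sum_range_succ]
      linarith [ih (by omega)]
  have hnonneg : 0 ≤ lam * ∑ Q ∈ P T, f Q := by
    refine mul_nonneg hlam (Finset.sum_nonneg fun Q _ => ?_)
    rw [hf]
    simp only [Real.logb]
    positivity
  linarith [key T le_rfl]
end
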